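/- arXiv:1812.01847 — 3 statements merged into one kernel-verified Lean document; each statement's English description precedes it below -/
import Mathlib

section
/- Let n ≥ 1, s ∈ (0,1), N ≥ 1 and R > 0. There exists an increasing sequence 0 < r̃_0 < r̃_1 < ⋯ < r̃_{2N−1} < r̃_{2N} = R such that, setting Ẽ = B_{r̃_0} ∪ ⋃_{k=1}^{N} (B_{r̃_{2k}} \ B_{r̃_{2k−1}}), the principal values H_s(x_{r̃_i}, Ẽ) exist for all i ∈ {0,…,2N} (x_{r̃_i} ∈ ∂B_{r̃_i}), and r̃_i · H_s(x_R, Ẽ) + (−1)^{i−1} · R · H_s(x_{r̃_i}, Ẽ) = 0 for every i ∈ {0,…,2N−1}. (These equations say that Ẽ is a homothetically shrinking solution of the fractional mean curvature flow.) -/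
open MeasureTheory Filter Metric Set

/-- `HasFracMeanCurvAt n s E x H` means that the fractional mean curvature of
`E ⊆ ℝⁿ` at the point `x`, i.e. the principal value
`lim_{ε→0⁺} ∫_{|y-x|>ε} (χ_{Eᶜ}(y) - χ_E(y)) |x-y|^{-(n+s)} dy`, exists and equals `H`. -/
def HasFracMeanCurvAt (n : ℕ) (s : ℝ) (E : Set (EuclideanSpace ℝ (Fin n)))
    (x : EuclideanSpace ℝ (Fin n)) (H : ℝ) : Prop :=
  Tendsto (fun ε : ℝ =>
      ∫ y in {y : EuclideanSpace ℝ (Fin n) | ε < dist y x},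
        (Set.indicator Eᶜ (fun _ => (1 : ℝ)) y - Set.indicator E (fun _ => (1 : ℝ)) y)
          * ‖x - y‖ ^ (-((n : ℝ) + s)))
    (nhdsWithin 0 (Set.Ioi 0)) (nhds H)

open scoped ENNReal

section Riesz

variable {n : ℕ}

/-- The kernel `|z|^{-(n+s)}` on `ℝⁿ`, with values in `[0, ∞]`. -/
noncomputable def rieszKernel (n : ℕ) (s : ℝ) (z : EuclideanSpace ℝ (Fin n)) : ℝ≥0∞ :=
  ENNReal.ofReal (‖z‖ ^ (-((n : ℝ) + s)))

/-- The mass of the kernel `k`, centered at `x`, outside the ball `B_T`. -/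
noncomputable def outerMass (k : EuclideanSpace ℝ (Fin n) → ℝ≥0∞) (x : EuclideanSpace ℝ (Fin n))
    (T : ℝ) : ℝ≥0∞ :=
  ∫⁻ y in {y | T ≤ ‖y‖}, k (x - y)

/-- The mass of the kernel `k`, centered at `x`, inside the closed ball of radius `T`. -/
noncomputable def innerMass (k : EuclideanSpace ℝ (Fin n) → ℝ≥0∞) (x : EuclideanSpace ℝ (Fin n))
    (T : ℝ) : ℝ≥0∞ :=
  ∫⁻ y in {y | ‖y‖ ≤ T}, k (x - y)

/-- The mass of the kernel `k`, centered at `x`, outside both balls of radius `|x|` whose boundary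
passes through `x` with normal `x`. -/
noncomputable def tangentMass (k : EuclideanSpace ℝ (Fin n) → ℝ≥0∞)
    (x : EuclideanSpace ℝ (Fin n)) : ℝ≥0∞ :=
  ∫⁻ z in {z | ‖x‖ ≤ ‖x + z‖ ∧ ‖x‖ ≤ ‖x - z‖}, k z

@[fun_prop]
lemma measurable_rieszKernel (s : ℝ) : Measurable (rieszKernel n s) := by
  unfold rieszKernel
  fun_prop

lemma rieszKernel_neg (s : ℝ) (z : EuclideanSpace ℝ (Fin n)) :
    rieszKernel n s (-z) = rieszKernel n s z := by
  simp [rieszKernel]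

lemma rieszKernel_smul (s : ℝ) {c : ℝ} (hc : 0 < c) (z : EuclideanSpace ℝ (Fin n)) :
    rieszKernel n s (c • z) = ENNReal.ofReal (c ^ (-((n : ℝ) + s))) * rieszKernel n s z := by
  rw [rieszKernel, rieszKernel, ← ENNReal.ofReal_mul (by positivity), norm_smul,
    Real.norm_of_nonneg hc.le, Real.mul_rpow hc.le (norm_nonneg _)]

lemma innerMass_eq_lt [NeZero n] (k : EuclideanSpace ℝ (Fin n) → ℝ≥0∞)
    (x : EuclideanSpace ℝ (Fin n)) (T : ℝ) :
    innerMass k x T = ∫⁻ y in {y | ‖y‖ < T}, k (x - y) := by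
  refine setLIntegral_congr ?_
  have h : volume (sphere (0 : EuclideanSpace ℝ (Fin n)) T) = 0 := Measure.addHaar_sphere _ _ _
  filter_upwards [measure_eq_zero_iff_ae_notMem.1 h] with y hy
  simp only [mem_sphere_zero_iff_norm] at hy
  exact propext ⟨fun h => lt_of_le_of_ne h hy, fun h => le_of_lt h⟩

/-- Change of variables by a linear isometry followed by a homothety. -/
lemma lintegral_smul_isometry [NeZero n] {c : ℝ} (hc : 0 < c)
    (L : EuclideanSpace ℝ (Fin n) ≃ₗᵢ[ℝ] EuclideanSpace ℝ (Fin n))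
    {f : EuclideanSpace ℝ (Fin n) → ℝ≥0∞} (hf : Measurable f) :
    ∫⁻ y, f y = ENNReal.ofReal (c ^ n) * ∫⁻ y, f (c • L y) := by
  have h1 : ∫⁻ y, f (c • L y) = ∫⁻ y, f (c • y) :=
    L.measurePreserving.lintegral_comp (f := fun y => f (c • y)) (by fun_prop)
  have h2 : ∫⁻ y, f (c • y) = ENNReal.ofReal ((c ^ n)⁻¹) * ∫⁻ y, f y := by
    rw [← lintegral_map hf (by fun_prop), Measure.map_addHaar_smul _ hc.ne',
      lintegral_smul_measure, finrank_euclideanSpace_fin, abs_of_pos (by positivity), smul_eq_mul]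
  rw [h1, h2, ← mul_assoc, ← ENNReal.ofReal_mul (by positivity), mul_inv_cancel₀ (by positivity)]
  simp

lemma exists_isometry_smul_eq {e x : EuclideanSpace ℝ (Fin n)} (he : ‖e‖ = 1) (hx : x ≠ 0) :
    ∃ L : EuclideanSpace ℝ (Fin n) ≃ₗᵢ[ℝ] EuclideanSpace ℝ (Fin n), ‖x‖ • L e = x := by
  have hx' : ‖x‖ ≠ 0 := norm_ne_zero_iff.2 hx
  have h : ‖e‖ = ‖‖x‖⁻¹ • x‖ := by
    rw [he, norm_smul, norm_inv, norm_norm, inv_mul_cancel₀ hx']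
  refine ⟨(ℝ ∙ (e - ‖x‖⁻¹ • x))ᗮ.reflection, ?_⟩
  rw [Submodule.reflection_sub h, smul_smul, mul_inv_cancel₀ hx', one_smul]

lemma ofReal_pow_mul_ofReal_rpow {s c : ℝ} (hc : 0 < c) (a : ℝ≥0∞) :
    ENNReal.ofReal (c ^ n) * (ENNReal.ofReal (c ^ (-((n : ℝ) + s))) * a)
      = ENNReal.ofReal (c ^ (-s)) * a := by
  rw [← mul_assoc, ← ENNReal.ofReal_mul (by positivity), ← Real.rpow_natCast, ← Real.rpow_add hc]
  congr 3
  ring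

lemma setLIntegral_rieszKernel_scale [NeZero n] (s : ℝ) {e x : EuclideanSpace ℝ (Fin n)}
    {c : ℝ} (hc : 0 < c)
    (L : EuclideanSpace ℝ (Fin n) ≃ₗᵢ[ℝ] EuclideanSpace ℝ (Fin n)) (hL : c • L e = x)
    {A B : Set (EuclideanSpace ℝ (Fin n))} (hA : MeasurableSet A) (hB : MeasurableSet B)
    (hAB : ∀ y, c • L y ∈ A ↔ y ∈ B) :
    ∫⁻ y in A, rieszKernel n s (x - y)
      = ENNReal.ofReal (c ^ (-s)) * ∫⁻ y in B, rieszKernel n s (e - y) := by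
  rw [← lintegral_indicator hA, ← lintegral_indicator hB,
    lintegral_smul_isometry hc L (by measurability), ← ofReal_pow_mul_ofReal_rpow (n := n) hc]
  refine congrArg _ ?_
  rw [← lintegral_const_mul' _ _ ENNReal.ofReal_ne_top]
  refine lintegral_congr fun y => ?_
  by_cases h : y ∈ B
  · rw [indicator_of_mem h, indicator_of_mem ((hAB y).2 h), ← hL, ← smul_sub, ← map_sub,
      rieszKernel_smul s hc]
    simp only [rieszKernel, LinearIsometryEquiv.norm_map]
  · rw [indicator_of_notMem h, indicator_of_notMem (fun h' => h ((hAB y).1 h')), mul_zero]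

lemma outerMass_rieszKernel [NeZero n] (s : ℝ) {e x : EuclideanSpace ℝ (Fin n)} (he : ‖e‖ = 1)
    (hx : x ≠ 0) (T : ℝ) :
    outerMass (rieszKernel n s) x T
      = ENNReal.ofReal (‖x‖ ^ (-s)) * outerMass (rieszKernel n s) e (T / ‖x‖) := by
  obtain ⟨L, hL⟩ := exists_isometry_smul_eq he hx
  have hx' : 0 < ‖x‖ := norm_pos_iff.2 hx
  refine setLIntegral_rieszKernel_scale s hx' L hL (measurableSet_le (by fun_prop) (by fun_prop))
    (measurableSet_le (by fun_prop) (by fun_prop)) fun y => ?_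
  simp only [mem_ofPred_eq, norm_smul, norm_norm, LinearIsometryEquiv.norm_map]
  rw [div_le_iff₀' hx']

lemma innerMass_rieszKernel [NeZero n] (s : ℝ) {e x : EuclideanSpace ℝ (Fin n)} (he : ‖e‖ = 1)
    (hx : x ≠ 0) (T : ℝ) :
    innerMass (rieszKernel n s) x T
      = ENNReal.ofReal (‖x‖ ^ (-s)) * innerMass (rieszKernel n s) e (T / ‖x‖) := by
  obtain ⟨L, hL⟩ := exists_isometry_smul_eq he hx
  have hx' : 0 < ‖x‖ := norm_pos_iff.2 hx
  refine setLIntegral_rieszKernel_scale s hx' L hL (measurableSet_le (by fun_prop) (by fun_prop))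
    (measurableSet_le (by fun_prop) (by fun_prop)) fun y => ?_
  simp only [mem_ofPred_eq, norm_smul, norm_norm, LinearIsometryEquiv.norm_map]
  rw [le_div_iff₀' hx']

lemma measurableSet_tangent (x : EuclideanSpace ℝ (Fin n)) :
    MeasurableSet {z | ‖x‖ ≤ ‖x + z‖ ∧ ‖x‖ ≤ ‖x - z‖} := by
  have h1 : MeasurableSet {z | ‖x‖ ≤ ‖x + z‖} := measurableSet_le (by fun_prop) (by fun_prop)
  have h2 : MeasurableSet {z | ‖x‖ ≤ ‖x - z‖} := measurableSet_le (by fun_prop) (by fun_prop)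
  exact h1.inter h2

lemma tangentMass_rieszKernel [NeZero n] (s : ℝ) {e x : EuclideanSpace ℝ (Fin n)} (he : ‖e‖ = 1)
    (hx : x ≠ 0) :
    tangentMass (rieszKernel n s) x
      = ENNReal.ofReal (‖x‖ ^ (-s)) * tangentMass (rieszKernel n s) e := by
  obtain ⟨L, hL⟩ := exists_isometry_smul_eq he hx
  have hx' : 0 < ‖x‖ := norm_pos_iff.2 hx
  have := setLIntegral_rieszKernel_scale s (e := 0) (x := 0) hx' L (by simp)
    (measurableSet_tangent x)
    (measurableSet_tangent e)
    fun y => ?_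
  · simpa [tangentMass, rieszKernel] using this
  · have h1 : x + ‖x‖ • L y = ‖x‖ • L (e + y) := by rw [map_add, smul_add, hL]
    have h2 : x - ‖x‖ • L y = ‖x‖ • L (e - y) := by rw [map_sub, smul_sub, hL]
    simp only [mem_ofPred_eq, h1, h2, norm_smul, norm_norm, LinearIsometryEquiv.norm_map, he]
    constructor <;> rintro ⟨h, h'⟩ <;> constructor <;> nlinarith

/-- The kernel `k` truncated to `{ε < |z|}`. -/
noncomputable def truncKernel (ε : ℝ) (k : EuclideanSpace ℝ (Fin n) → ℝ≥0∞) :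
    EuclideanSpace ℝ (Fin n) → ℝ≥0∞ :=
  {z | ε < ‖z‖}.indicator k

lemma measurableSet_lt_norm (ε : ℝ) : MeasurableSet {z : EuclideanSpace ℝ (Fin n) | ε < ‖z‖} :=
  measurableSet_lt (by fun_prop) (by fun_prop)

lemma lintegral_truncKernel_lt_top {s ε : ℝ} (hs : 0 < s) (hε : 0 < ε) :
    ∫⁻ z, truncKernel ε (rieszKernel n s) z < ∞ := by
  have h : ∀ z : EuclideanSpace ℝ (Fin n), truncKernel ε (rieszKernel n s) z
      ≤ ENNReal.ofReal ((ε / (1 + ε)) ^ (-((n : ℝ) + s)))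
        * ENNReal.ofReal ((1 + ‖z‖) ^ (-((n : ℝ) + s))) := by
    intro z
    by_cases hz : ε < ‖z‖
    · rw [truncKernel, indicator_of_mem (by exact hz), rieszKernel,
        ← ENNReal.ofReal_mul (by positivity), ← Real.mul_rpow (by positivity) (by positivity)]
      refine ENNReal.ofReal_le_ofReal ?_
      refine Real.rpow_le_rpow_of_nonpos (by positivity) ?_
        (by linarith [(n.cast_nonneg : (0 : ℝ) ≤ n)])
      rw [div_mul_eq_mul_div, div_le_iff₀ (by positivity)]
      nlinarith
    · rw [truncKernel, indicator_of_notMem (by exact hz)]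
      exact zero_le
  refine (lintegral_mono h).trans_lt ?_
  rw [lintegral_const_mul' _ _ ENNReal.ofReal_ne_top]
  refine ENNReal.mul_lt_top ENNReal.ofReal_lt_top (finite_integral_one_add_norm ?_)
  simpa using hs

lemma setLIntegral_rieszKernel_lt_top {s ε : ℝ} (hs : 0 < s) (hε : 0 < ε)
    {x : EuclideanSpace ℝ (Fin n)} {A : Set (EuclideanSpace ℝ (Fin n))} (hA : MeasurableSet A)
    (h : ∀ y ∈ A, ε < ‖x - y‖) : ∫⁻ y in A, rieszKernel n s (x - y) < ∞ := by
  refine lt_of_le_of_lt ?_ (lintegral_truncKernel_lt_top (n := n) hs hε)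
  rw [← lintegral_sub_left_eq_self (truncKernel ε (rieszKernel n s)) x, ← lintegral_indicator hA]
  refine lintegral_mono fun y => ?_
  by_cases hy : y ∈ A
  · rw [indicator_of_mem hy, truncKernel, indicator_of_mem (by exact h y hy)]
  · simp [hy]

lemma outerMass_lt_top {s : ℝ} (hs : 0 < s) {x : EuclideanSpace ℝ (Fin n)} {T : ℝ}
    (hT : ‖x‖ < T) : outerMass (rieszKernel n s) x T < ∞ := by
  refine setLIntegral_rieszKernel_lt_top hs (half_pos (sub_pos.2 hT))
    (measurableSet_le (by fun_prop) (by fun_prop)) fun y hy => ?_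
  have h1 := norm_sub_norm_le y x
  rw [norm_sub_rev] at h1
  simp only [mem_ofPred_eq] at hy
  linarith

lemma innerMass_lt_top {s : ℝ} (hs : 0 < s) {x : EuclideanSpace ℝ (Fin n)} {T : ℝ}
    (hT : T < ‖x‖) : innerMass (rieszKernel n s) x T < ∞ := by
  refine setLIntegral_rieszKernel_lt_top hs (half_pos (sub_pos.2 hT))
    (measurableSet_le (by fun_prop) (by fun_prop)) fun y hy => ?_
  have h1 := norm_sub_norm_le x y
  simp only [mem_ofPred_eq] at hy
  linarith

lemma integrableOn_abs_rpow {α : ℝ} (hα : α < 1) :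
    IntegrableOn (fun t : ℝ => |t| ^ (-α)) (Icc (-1) 1) := by
  have h1 : IntegrableOn (fun t : ℝ => |t| ^ (-α)) (Icc 0 1) := by
    have h := (intervalIntegral.intervalIntegrable_rpow' (a := 0) (b := 1)
      (by linarith : -1 < -α))
    rw [intervalIntegrable_iff_integrableOn_Icc_of_le zero_le_one] at h
    refine h.congr_fun (fun t ht => ?_) measurableSet_Icc
    simp [abs_of_nonneg ht.1]
  have h2 : IntegrableOn (fun t : ℝ => |t| ^ (-α)) (Icc (-1) 0) := by
    have h := h1.comp_neg
    simpa using h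
  have := h2.union h1
  rwa [Icc_union_Icc_eq_Icc (by norm_num) (by norm_num)] at this

lemma abs_apply_le_norm (z : EuclideanSpace ℝ (Fin n)) (i : Fin n) : |z i| ≤ ‖z‖ :=
  PiLp.norm_apply_le z i

lemma two_mul_abs_le_of_tangent [NeZero n] {z : EuclideanSpace ℝ (Fin n)}
    (h1 : ‖EuclideanSpace.single (0 : Fin n) (1 : ℝ)‖ ≤ ‖EuclideanSpace.single (0 : Fin n) 1 + z‖)
    (h2 : ‖EuclideanSpace.single (0 : Fin n) (1 : ℝ)‖ ≤ ‖EuclideanSpace.single (0 : Fin n) 1 - z‖) :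
    2 * |z 0| ≤ ‖z‖ ^ 2 := by
  have h1' := pow_le_pow_left₀ (norm_nonneg _) h1 2
  have h2' := pow_le_pow_left₀ (norm_nonneg _) h2 2
  rw [norm_add_sq_real] at h1'
  rw [norm_sub_sq_real] at h2'
  simp only [EuclideanSpace.inner_single_left, map_one, one_mul] at h1' h2'
  rw [← abs_two, ← abs_mul, abs_le]
  constructor <;> linarith

lemma prod_abs_le_of_two_mul_abs_le [NeZero n] {z : EuclideanSpace ℝ (Fin n)}
    (h : 2 * |z 0| ≤ ‖z‖ ^ 2) : ∏ i, |z i| ≤ ‖z‖ ^ (n + 1) := by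
  rw [← Finset.mul_prod_erase _ _ (Finset.mem_univ (0 : Fin n))]
  have h1 : ∏ i ∈ Finset.univ.erase (0 : Fin n), |z i| ≤ ‖z‖ ^ (n - 1) := by
    refine (Finset.prod_le_prod (fun _ _ => abs_nonneg _)
      fun i _ => abs_apply_le_norm z i).trans_eq ?_
    simp [Finset.card_erase_of_mem]
  calc |z 0| * ∏ i ∈ Finset.univ.erase (0 : Fin n), |z i|
      ≤ ‖z‖ ^ 2 * ‖z‖ ^ (n - 1) :=
        mul_le_mul (by linarith [abs_nonneg (z 0)]) h1 (Finset.prod_nonneg fun _ _ => abs_nonneg _)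
          (by positivity)
    _ = ‖z‖ ^ (n + 1) := by
        rw [← pow_add]
        congr 1
        have := Nat.pos_of_ne_zero (NeZero.ne n)
        omega

lemma norm_rpow_le_prod [NeZero n] {s : ℝ} (hs : s ∈ Ioo (0 : ℝ) 1)
    {z : EuclideanSpace ℝ (Fin n)} (h : 2 * |z 0| ≤ ‖z‖ ^ 2) (hz : ∀ i, z i ≠ 0) :
    ‖z‖ ^ (-((n : ℝ) + s)) ≤ ∏ i, |z i| ^ (-(((n : ℝ) + s) / (n + 1))) := by
  have hn : (0 : ℝ) < n := by exact_mod_cast Nat.pos_of_ne_zero (NeZero.ne n)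
  rw [Real.finsetProd_rpow _ _ fun _ _ => abs_nonneg _]
  have h1 : 0 < ∏ i, |z i| := Finset.prod_pos fun i _ => abs_pos.2 (hz i)
  refine le_trans (le_of_eq ?_) (Real.rpow_le_rpow_of_nonpos h1 (prod_abs_le_of_two_mul_abs_le h)
    (neg_nonpos.2 (div_nonneg (by linarith [hs.1]) (by positivity))))
  rw [← Real.rpow_natCast, ← Real.rpow_mul (norm_nonneg _)]
  congr 1
  push_cast
  field_simp

lemma integrable_prod_comp {f : ℝ → ℝ} (hf : Integrable f) :
    Integrable fun z : EuclideanSpace ℝ (Fin n) => ∏ i, f (z i) := by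
  have h1 : Integrable fun z : Fin n → ℝ => ∏ i, f (z i) := Integrable.fintype_prod fun _ => hf
  exact ((PiLp.volume_preserving_ofLp (Fin n)).integrable_comp h1.aestronglyMeasurable).2 h1

lemma ae_apply_ne_zero : ∀ᵐ z : EuclideanSpace ℝ (Fin n), ∀ i, z i ≠ 0 := by
  have h : ∀ᵐ z : Fin n → ℝ, ∀ i, z i ≠ 0 := ae_all_iff.2 fun i =>
    Measure.ae_eval_ne (fun _ => volume) i 0
  exact (PiLp.volume_preserving_ofLp (Fin n)).quasiMeasurePreserving.ae h

lemma tangentMass_lt_top_of_ae_le {s : ℝ} (hs : 0 < s) {e : EuclideanSpace ℝ (Fin n)}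
    {F : EuclideanSpace ℝ (Fin n) → ℝ} (hF : Integrable F)
    (h : ∀ᵐ z, z ∈ {z | ‖e‖ ≤ ‖e + z‖ ∧ ‖e‖ ≤ ‖e - z‖} → ‖z‖ ≤ 1 →
      ‖z‖ ^ (-((n : ℝ) + s)) ≤ F z) :
    tangentMass (rieszKernel n s) e < ∞ := by
  calc tangentMass (rieszKernel n s) e
      ≤ ∫⁻ z in {z | ‖e‖ ≤ ‖e + z‖ ∧ ‖e‖ ≤ ‖e - z‖},
          (truncKernel 1 (rieszKernel n s) z + ENNReal.ofReal (F z)) := by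
        refine setLIntegral_mono_ae' (measurableSet_tangent e) ?_
        filter_upwards [h] with z hz hze
        by_cases hz1 : 1 < ‖z‖
        · rw [truncKernel, indicator_of_mem (by exact hz1)]
          exact le_self_add
        · exact le_add_left (ENNReal.ofReal_le_ofReal (hz hze (not_lt.1 hz1)))
    _ ≤ ∫⁻ z, (truncKernel 1 (rieszKernel n s) z + ENNReal.ofReal (F z)) :=
        setLIntegral_le_lintegral _ _
    _ = (∫⁻ z, truncKernel 1 (rieszKernel n s) z) + ∫⁻ z, ENNReal.ofReal (F z) :=
        lintegral_add_left ((measurable_rieszKernel s).indicator (measurableSet_lt_norm 1)) _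
    _ < ∞ := ENNReal.add_lt_top.2 ⟨lintegral_truncKernel_lt_top hs one_pos, hF.lintegral_lt_top⟩

lemma tangentMass_single_lt_top [NeZero n] {s : ℝ} (hs : s ∈ Ioo (0 : ℝ) 1) :
    tangentMass (rieszKernel n s) (EuclideanSpace.single (0 : Fin n) 1) < ∞ := by
  have hα : ((n : ℝ) + s) / (n + 1) < 1 := by
    rw [div_lt_one (by positivity)]
    linarith [hs.2]
  refine tangentMass_lt_top_of_ae_le hs.1 (integrable_prod_comp
    ((integrable_indicator_iff measurableSet_Icc).2 (integrableOn_abs_rpow hα))) ?_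
  filter_upwards [ae_apply_ne_zero] with z hz0
  rintro ⟨h1, h2⟩ hz
  refine (norm_rpow_le_prod hs (two_mul_abs_le_of_tangent h1 h2) hz0).trans_eq ?_
  refine Finset.prod_congr rfl fun i _ => ?_
  have hi : z i ∈ Icc (-1 : ℝ) 1 := abs_le.1 ((abs_apply_le_norm z i).trans hz)
  rw [indicator_of_mem hi]

lemma tangentMass_lt_top [NeZero n] {s : ℝ} (hs : s ∈ Ioo (0 : ℝ) 1)
    {x : EuclideanSpace ℝ (Fin n)} (hx : x ≠ 0) : tangentMass (rieszKernel n s) x < ∞ := by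
  rw [tangentMass_rieszKernel s (e := EuclideanSpace.single (0 : Fin n) 1) (by simp) hx]
  exact ENNReal.mul_lt_top ENNReal.ofReal_lt_top (tangentMass_single_lt_top hs)

lemma measurable_outerMass {k : EuclideanSpace ℝ (Fin n) → ℝ≥0∞} (hk : Measurable k) (T : ℝ) :
    Measurable fun x => outerMass k x T :=
  Measurable.lintegral_prod_right' (f := fun p : EuclideanSpace ℝ (Fin n) ×
    EuclideanSpace ℝ (Fin n) => k (p.1 - p.2)) (by fun_prop)

lemma measurable_tangentMass {k : EuclideanSpace ℝ (Fin n) → ℝ≥0∞} (hk : Measurable k) :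
    Measurable fun x => tangentMass k x := by
  have h1 : MeasurableSet {p : EuclideanSpace ℝ (Fin n) × EuclideanSpace ℝ (Fin n) |
      ‖p.1‖ ≤ ‖p.1 + p.2‖} := measurableSet_le (by fun_prop) (by fun_prop)
  have h2 : MeasurableSet {p : EuclideanSpace ℝ (Fin n) × EuclideanSpace ℝ (Fin n) |
      ‖p.1‖ ≤ ‖p.1 - p.2‖} := measurableSet_le (by fun_prop) (by fun_prop)
  have h : Measurable fun x => ∫⁻ y, (({p : EuclideanSpace ℝ (Fin n) × EuclideanSpace ℝ (Fin n) |
      ‖p.1‖ ≤ ‖p.1 + p.2‖} ∩ {p | ‖p.1‖ ≤ ‖p.1 - p.2‖}).indicator fun p => k p.2) (x, y) :=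
    Measurable.lintegral_prod_right' (Measurable.indicator (by fun_prop) (h1.inter h2))
  convert! h using 2 with x
  rw [tangentMass, ← lintegral_indicator (measurableSet_tangent x)]
  rfl

/-- Splitting `{|x| ≤ t|y|}` according to whether `y` lies in the unit ball, and exchanging the
order of integration on the bounded part. -/
lemma setLIntegral_outerMass_div {k : EuclideanSpace ℝ (Fin n) → ℝ≥0∞} (hk : Measurable k)
    (hk' : ∀ z, k (-z) = k z) {t : ℝ} (ht : 0 < t) :
    ∫⁻ x in {x | ‖x‖ < t}, outerMass k x (‖x‖ / t)
      = (∫⁻ x in {x | ‖x‖ < t}, outerMass k x 1)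
        + ∫⁻ y in {y | ‖y‖ < 1}, innerMass k y (t * ‖y‖) := by
  have hlt : ∀ r : ℝ, MeasurableSet {x : EuclideanSpace ℝ (Fin n) | ‖x‖ < r} := fun r =>
    measurableSet_lt (by fun_prop) (by fun_prop)
  set P : Set (EuclideanSpace ℝ (Fin n) × EuclideanSpace ℝ (Fin n)) :=
    {p | ‖p.1‖ ≤ t * ‖p.2‖} ∩ {p | ‖p.2‖ < 1} with hP
  have hPm : MeasurableSet P := MeasurableSet.inter
    (measurableSet_le (by fun_prop) (by fun_prop)) (measurableSet_lt (by fun_prop) (by fun_prop))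
  set φ : EuclideanSpace ℝ (Fin n) × EuclideanSpace ℝ (Fin n) → ℝ≥0∞ :=
    P.indicator fun p => k (p.1 - p.2) with hφ
  have hφm : Measurable φ := Measurable.indicator (by fun_prop) hPm
  have h1 : ∀ x ∈ {x : EuclideanSpace ℝ (Fin n) | ‖x‖ < t}, outerMass k x (‖x‖ / t)
      = outerMass k x 1 + ∫⁻ y, φ (x, y) := by
    intro x hx
    have hx1 : ‖x‖ / t < 1 := (div_lt_one ht).2 hx
    have hm : MeasurableSet {y : EuclideanSpace ℝ (Fin n) | 1 ≤ ‖y‖} :=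
      measurableSet_le (by fun_prop) (by fun_prop)
    have hm' : MeasurableSet {y : EuclideanSpace ℝ (Fin n) | ‖x‖ / t ≤ ‖y‖} :=
      measurableSet_le (by fun_prop) (by fun_prop)
    rw [outerMass, outerMass, ← lintegral_indicator hm, ← lintegral_indicator hm',
      ← lintegral_add_left (Measurable.indicator (by fun_prop) hm)]
    refine lintegral_congr fun y => ?_
    have e1 : ‖x‖ / t ≤ ‖y‖ ↔ ‖x‖ ≤ t * ‖y‖ := div_le_iff₀' ht
    by_cases hy : 1 ≤ ‖y‖
    · have : ‖x‖ / t ≤ ‖y‖ := by linarith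
      simp [hφ, hP, indicator, hy, this, not_lt.2 hy]
    · simp [hφ, hP, indicator, hy, e1, not_le.1 hy]
  have h2 : ∫⁻ x in {x | ‖x‖ < t}, ∫⁻ y, φ (x, y) = ∫⁻ x, ∫⁻ y, φ (x, y) := by
    rw [← lintegral_indicator (hlt t)]
    refine lintegral_congr fun x => ?_
    by_cases hx : ‖x‖ < t
    · rw [indicator_of_mem (by exact hx)]
    · rw [indicator_of_notMem (by exact hx), eq_comm, lintegral_eq_zero_iff (by fun_prop)]
      refine Eventually.of_forall fun y => indicator_of_notMem ?_ _
      rintro ⟨hy1, hy2⟩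
      simp only [mem_ofPred_eq] at hy1 hy2
      nlinarith
  rw [setLIntegral_congr_fun (hlt t) h1,
    lintegral_add_left (measurable_outerMass hk 1), h2,
    lintegral_lintegral_swap (f := fun x y => φ (x, y)) hφm.aemeasurable,
    ← lintegral_indicator (hlt 1)]
  congr 1
  refine lintegral_congr fun y => ?_
  by_cases hy : ‖y‖ < 1
  · rw [indicator_of_mem (by exact hy), innerMass,
      ← lintegral_indicator (measurableSet_le (by fun_prop) (by fun_prop))]
    refine lintegral_congr fun x => ?_
    have := hk' (y - x)
    rw [neg_sub] at this
    simp [hφ, hP, indicator, hy, this]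
  · rw [indicator_of_notMem (by exact hy), lintegral_eq_zero_iff (by fun_prop)]
    refine Eventually.of_forall fun x => indicator_of_notMem ?_ _
    exact fun h => hy h.2

/-- Points outside the ball `B_{|x|}` are either tangential or reflect through `x` into the ball. -/
lemma outerMass_norm_eq [NeZero n] {k : EuclideanSpace ℝ (Fin n) → ℝ≥0∞}
    (hk : Measurable k) (hk' : ∀ z, k (-z) = k z) (x : EuclideanSpace ℝ (Fin n)) :
    outerMass k x ‖x‖ = tangentMass k x + innerMass k x ‖x‖ := by
  have m1 : ∀ r : ℝ, MeasurableSet {y : EuclideanSpace ℝ (Fin n) | r ≤ ‖y‖} := fun r =>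
    measurableSet_le (by fun_prop) (by fun_prop)
  have m2 : ∀ r : ℝ, MeasurableSet {y : EuclideanSpace ℝ (Fin n) | ‖y‖ < r} := fun r =>
    measurableSet_lt (by fun_prop) (by fun_prop)
  rw [innerMass_eq_lt, outerMass, tangentMass, ← lintegral_indicator (m1 _),
    ← lintegral_indicator (m2 _), ← lintegral_indicator (measurableSet_tangent x),
    ← lintegral_add_left_eq_self _ x,
    ← lintegral_sub_left_eq_self ({y | ‖y‖ < ‖x‖}.indicator fun y => k (x - y)) x,
    ← lintegral_add_left (hk.indicator (measurableSet_tangent x))]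
  refine lintegral_congr fun z => ?_
  have e1 : k (x - (x + z)) = k z := by rw [← hk' z]; congr 1; abel
  have e2 : k (x - (x - z)) = k z := by congr 1; abel
  simp only [indicator, mem_ofPred_eq, e1, e2]
  have hpar := parallelogram_law_with_norm ℝ x z
  by_cases h1 : ‖x‖ ≤ ‖x + z‖ <;> by_cases h2 : ‖x‖ ≤ ‖x - z‖
  · simp [h1, h2, not_lt.2 h2]
  · simp [h1, h2, not_le.1 h2]
  · simp [h1, h2, not_lt.2 h2]
  · push Not at h1 h2
    nlinarith [norm_nonneg (x + z), norm_nonneg (x - z), norm_nonneg z, norm_nonneg x]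

lemma measurable_truncKernel (s ε : ℝ) : Measurable (truncKernel ε (rieszKernel n s)) :=
  (measurable_rieszKernel s).indicator (measurableSet_lt_norm ε)

lemma truncKernel_neg (s ε : ℝ) (z : EuclideanSpace ℝ (Fin n)) :
    truncKernel ε (rieszKernel n s) (-z) = truncKernel ε (rieszKernel n s) z := by
  simp [truncKernel, indicator, rieszKernel_neg]

lemma truncKernel_anti {k : EuclideanSpace ℝ (Fin n) → ℝ≥0∞} {ε δ : ℝ} (h : ε ≤ δ) :
    truncKernel δ k ≤ truncKernel ε k :=
  indicator_le_indicator_of_subset (fun _ hz => lt_of_le_of_lt h hz) fun _ => zero_le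

lemma tendsto_truncKernel {s : ℝ} (hs : 0 < s) {ι : Type*} {l : Filter ι} {ε : ι → ℝ}
    (hε : Tendsto ε l (nhds 0)) (z : EuclideanSpace ℝ (Fin n)) :
    Tendsto (fun i => truncKernel (ε i) (rieszKernel n s) z) l (nhds (rieszKernel n s z)) := by
  refine tendsto_const_nhds.congr' ?_
  rcases eq_or_ne z 0 with rfl | hz
  · refine Eventually.of_forall fun i => ?_
    have h : -((n : ℝ) + s) ≠ 0 := by
      have : (0 : ℝ) ≤ n := n.cast_nonneg
      linarith
    have h0 : rieszKernel n s 0 = 0 := by rw [rieszKernel, norm_zero, Real.zero_rpow h]; simp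
    change rieszKernel n s 0 = truncKernel (ε i) (rieszKernel n s) 0
    rw [truncKernel, indicator_apply, h0, ite_self]
  · filter_upwards [hε.eventually_lt_const (norm_pos_iff.2 hz)] with i hi
    rw [truncKernel, indicator_of_mem (by exact hi)]

lemma tendsto_one_div_nat : Tendsto (fun m : ℕ => 1 / ((m : ℝ) + 1)) atTop (nhds 0) :=
  tendsto_one_div_add_atTop_nhds_zero_nat

lemma one_div_nat_anti {a b : ℕ} (h : a ≤ b) : 1 / ((b : ℝ) + 1) ≤ 1 / ((a : ℝ) + 1) := by
  gcongr

lemma setLIntegral_outerMass_one [NeZero n] {s : ℝ} (hs : 0 < s) :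
    ∫⁻ x in {x | ‖x‖ < 1}, outerMass (rieszKernel n s) x 1
      = ∫⁻ x in {x | ‖x‖ < 1}, tangentMass (rieszKernel n s) x := by
  set κ : ℕ → EuclideanSpace ℝ (Fin n) → ℝ≥0∞ :=
    fun m => truncKernel (1 / ((m : ℝ) + 1)) (rieszKernel n s) with hκ
  have hκm : ∀ m, Measurable (κ m) := fun m => measurable_truncKernel s _
  have hmono : ∀ z, Monotone fun m => κ m z := fun z a b hab =>
    truncKernel_anti (one_div_nat_anti hab) z
  have hlim : ∀ z, Tendsto (fun m => κ m z) atTop (nhds (rieszKernel n s z)) :=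
    tendsto_truncKernel hs tendsto_one_div_nat
  have heq : ∀ m, ∫⁻ x in {x | ‖x‖ < 1}, outerMass (κ m) x 1
      = ∫⁻ x in {x | ‖x‖ < 1}, tangentMass (κ m) x := by
    intro m
    have h1 := setLIntegral_outerMass_div (hκm m) (truncKernel_neg s _) one_pos
    simp only [div_one, one_mul, outerMass_norm_eq (hκm m) (truncKernel_neg s _)] at h1
    rw [lintegral_add_left (measurable_tangentMass (hκm m))] at h1
    refine ((ENNReal.add_left_inj ?_).1 h1).symm
    have h2 : ∀ x, innerMass (κ m) x ‖x‖ ≤ ∫⁻ z, κ m z := fun x =>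
      (setLIntegral_le_lintegral _ _).trans_eq (lintegral_sub_left_eq_self _ x)
    refine ((lintegral_mono h2).trans_lt ?_).ne
    rw [lintegral_const, Measure.restrict_apply_univ]
    refine ENNReal.mul_lt_top (lintegral_truncKernel_lt_top hs (by positivity)) ?_
    have : {x : EuclideanSpace ℝ (Fin n) | ‖x‖ < 1} = ball 0 1 := by ext; simp
    rw [this]
    exact measure_ball_lt_top
  have hA : Tendsto (fun m => ∫⁻ x in {x | ‖x‖ < 1}, outerMass (κ m) x 1) atTop
      (nhds (∫⁻ x in {x | ‖x‖ < 1}, outerMass (rieszKernel n s) x 1)) := by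
    refine lintegral_tendsto_of_tendsto_of_monotone
      (fun m => (measurable_outerMass (hκm m) 1).aemeasurable)
      (Eventually.of_forall fun x a b hab => lintegral_mono fun y => hmono _ hab)
      (Eventually.of_forall fun x => ?_)
    exact lintegral_tendsto_of_tendsto_of_monotone
      (fun m => ((hκm m).comp (measurable_const.sub measurable_id)).aemeasurable)
      (Eventually.of_forall fun y => hmono _) (Eventually.of_forall fun y => hlim _)
  have hB : Tendsto (fun m => ∫⁻ x in {x | ‖x‖ < 1}, tangentMass (κ m) x) atTop
      (nhds (∫⁻ x in {x | ‖x‖ < 1}, tangentMass (rieszKernel n s) x)) := by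
    refine lintegral_tendsto_of_tendsto_of_monotone
      (fun m => (measurable_tangentMass (hκm m)).aemeasurable)
      (Eventually.of_forall fun x a b hab => lintegral_mono fun y => hmono _ hab)
      (Eventually.of_forall fun x => ?_)
    exact lintegral_tendsto_of_tendsto_of_monotone (fun m => (hκm m).aemeasurable)
      (Eventually.of_forall fun y => hmono _) (Eventually.of_forall fun y => hlim _)
  exact tendsto_nhds_unique hA (by simpa only [heq] using hB)

/-- Integration of radial functions in polar coordinates. -/
lemma lintegral_fun_norm [NeZero n] {f : ℝ → ℝ≥0∞} (hf : Measurable f) :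
    ∫⁻ x : EuclideanSpace ℝ (Fin n), f ‖x‖
      = (volume : Measure (EuclideanSpace ℝ (Fin n))).toSphere univ
        * ∫⁻ y in Ioi (0 : ℝ), ENNReal.ofReal (y ^ (n - 1)) * f y := by
  set μ : Measure (EuclideanSpace ℝ (Fin n)) := volume
  calc ∫⁻ x, f ‖x‖ ∂μ
      = ∫⁻ x : ({(0)}ᶜ : Set (EuclideanSpace ℝ (Fin n))), f ‖x.1‖ ∂(μ.comap (↑)) := by
        rw [lintegral_subtype_comap (measurableSet_singleton _).compl fun x => f ‖x‖,
          restrict_compl_singleton]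
    _ = ∫⁻ x, f x.2 ∂μ.toSphere.prod (.volumeIoiPow (n - 1)) := by
        have := μ.measurePreserving_homeomorphUnitSphereProd.lintegral_comp_emb
          (Homeomorph.measurableEmbedding _) (f ∘ Subtype.val ∘ Prod.snd)
        simpa using this
    _ = μ.toSphere univ * ∫⁻ x : Ioi (0 : ℝ), f x ∂.volumeIoiPow (n - 1) := by
        rw [lintegral_prod _ (by fun_prop), mul_comm]
        simp only [lintegral_const]
    _ = _ := by
        rw [Measure.volumeIoiPow, lintegral_withDensity_eq_lintegral_mul _ (by fun_prop)
          (by fun_prop), ← lintegral_subtype_comap measurableSet_Ioi]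
        rfl

/-- The total mass of the unit sphere. -/
noncomputable def sphereMass (n : ℕ) : ℝ≥0∞ :=
  (volume : Measure (EuclideanSpace ℝ (Fin n))).toSphere univ

lemma sphereMass_ne_top : sphereMass n ≠ ∞ := measure_ne_top _ _

lemma sphereMass_ne_zero [NeZero n] : sphereMass n ≠ 0 := by
  rw [sphereMass, Measure.measure_univ_ne_zero]
  exact Measure.toSphere_ne_zero _

lemma setLIntegral_fun_norm [NeZero n] {f : ℝ → ℝ≥0∞} (hf : Measurable f) (t : ℝ) :
    ∫⁻ x in {x : EuclideanSpace ℝ (Fin n) | ‖x‖ < t}, f ‖x‖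
      = sphereMass n * ∫⁻ y in Ioo 0 t, ENNReal.ofReal (y ^ (n - 1)) * f y := by
  rw [← lintegral_indicator (measurableSet_lt (by fun_prop) (by fun_prop))]
  have := lintegral_fun_norm (n := n) (hf.indicator (measurableSet_Iio (a := t)))
  rw [show Ioo 0 t = Iio t ∩ Ioi 0 by ext; simp [and_comm],
    ← Measure.restrict_restrict measurableSet_Iio, ← lintegral_indicator measurableSet_Iio]
  have h2 : ∀ y, ENNReal.ofReal (y ^ (n - 1)) * (Iio t).indicator f y
      = (Iio t).indicator (fun y => ENNReal.ofReal (y ^ (n - 1)) * f y) y := fun y => by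
    by_cases hy : y ∈ Iio t <;> simp [hy]
  simp only [h2] at this
  exact (lintegral_congr fun x => rfl).trans this

lemma ofReal_pow_mul_rpow [NeZero n] {s ρ : ℝ} (hρ : 0 < ρ) :
    ENNReal.ofReal (ρ ^ (n - 1)) * ENNReal.ofReal (ρ ^ (-s))
      = ENNReal.ofReal (ρ ^ ((n : ℝ) - s - 1)) := by
  rw [← ENNReal.ofReal_mul (by positivity), ← Real.rpow_natCast, ← Real.rpow_add hρ,
    Nat.cast_sub (Nat.one_le_iff_ne_zero.2 (NeZero.ne n))]
  congr 2
  push_cast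
  ring

lemma sub_pos_of_mem_Ioo [NeZero n] {s : ℝ} (hs : s ∈ Ioo (0 : ℝ) 1) : 0 < (n : ℝ) - s := by
  have : (1 : ℝ) ≤ n := by exact_mod_cast Nat.one_le_iff_ne_zero.2 (NeZero.ne n)
  linarith [hs.2]

lemma setLIntegral_rpow {d t : ℝ} (hd : 0 < d) (ht : 0 < t) :
    ∫⁻ ρ in Ioo 0 t, ENNReal.ofReal (ρ ^ (d - 1)) = ENNReal.ofReal (t ^ d / d) := by
  have hi : IntegrableOn (fun ρ : ℝ => ρ ^ (d - 1)) (Ioo 0 t) :=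
    (intervalIntegral.integrableOn_Ioo_rpow_iff ht).2 (by linarith)
  rw [← ofReal_integral_eq_lintegral_ofReal hi
    ((ae_restrict_iff' measurableSet_Ioo).2 (Eventually.of_forall fun ρ hρ =>
      Real.rpow_nonneg hρ.1.le _)), ← integral_Ioc_eq_integral_Ioo,
    ← intervalIntegral.integral_of_le ht.le, integral_rpow (Or.inl (by linarith))]
  simp [Real.zero_rpow hd.ne']

lemma setLIntegral_norm_rpow [NeZero n] {s t : ℝ} (hs : s ∈ Ioo (0 : ℝ) 1) (ht : 0 < t) :
    ∫⁻ x in {x : EuclideanSpace ℝ (Fin n) | ‖x‖ < t}, ENNReal.ofReal (‖x‖ ^ (-s))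
      = sphereMass n * ENNReal.ofReal (t ^ ((n : ℝ) - s) / (n - s)) := by
  rw [setLIntegral_fun_norm (f := fun y => ENNReal.ofReal (y ^ (-s))) (by fun_prop),
    ← setLIntegral_rpow (sub_pos_of_mem_Ioo hs) ht]
  congr 1
  exact setLIntegral_congr_fun measurableSet_Ioo fun ρ hρ => ofReal_pow_mul_rpow hρ.1

/-- A unit vector. -/
noncomputable def baseVec (n : ℕ) [NeZero n] : EuclideanSpace ℝ (Fin n) :=
  EuclideanSpace.single (0 : Fin n) 1

lemma norm_baseVec [NeZero n] : ‖baseVec n‖ = 1 := by simp [baseVec]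

lemma baseVec_ne_zero [NeZero n] : baseVec n ≠ 0 := by
  rw [← norm_ne_zero_iff, norm_baseVec]
  exact one_ne_zero

lemma ae_restrict_ne_zero [NeZero n] (A : Set (EuclideanSpace ℝ (Fin n))) :
    ∀ᵐ x ∂(volume.restrict A), x ≠ 0 :=
  ae_restrict_of_ae (measure_eq_zero_iff_ae_notMem.1 (measure_singleton 0))

lemma antitone_outerMass (k : EuclideanSpace ℝ (Fin n) → ℝ≥0∞) (x : EuclideanSpace ℝ (Fin n)) :
    Antitone (outerMass k x) := fun _ _ hab =>
  lintegral_mono_set fun _ hy => le_trans hab hy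

lemma setLIntegral_outerMass_rieszKernel [NeZero n] (s t : ℝ) :
    ∫⁻ x in {x | ‖x‖ < t}, outerMass (rieszKernel n s) x 1
      = sphereMass n * ∫⁻ ρ in Ioo 0 t, ENNReal.ofReal (ρ ^ ((n : ℝ) - s - 1))
        * outerMass (rieszKernel n s) (baseVec n) (1 / ρ) := by
  have hm : Measurable (outerMass (rieszKernel n s) (baseVec n)) :=
    (antitone_outerMass _ _).measurable
  have h1 : ∀ᵐ x ∂(volume.restrict {x : EuclideanSpace ℝ (Fin n) | ‖x‖ < t}),
      outerMass (rieszKernel n s) x 1 = ENNReal.ofReal (‖x‖ ^ (-s))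
        * outerMass (rieszKernel n s) (baseVec n) (1 / ‖x‖) := by
    filter_upwards [ae_restrict_ne_zero _] with x hx
    exact outerMass_rieszKernel s norm_baseVec hx 1
  rw [lintegral_congr_ae h1, setLIntegral_fun_norm (f := fun y => ENNReal.ofReal (y ^ (-s))
        * outerMass (rieszKernel n s) (baseVec n) (1 / y)) (by fun_prop)]
  congr 1
  refine setLIntegral_congr_fun measurableSet_Ioo fun ρ hρ => ?_
  rw [← ofReal_pow_mul_rpow hρ.1, mul_assoc]

lemma outerMass_eq_lintegral_add_innerMass [NeZero n] {s t : ℝ} (hs : s ∈ Ioo (0 : ℝ) 1)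
    (ht : 0 < t) :
    ENNReal.ofReal (t ^ ((n : ℝ) - s) / (n - s)) * outerMass (rieszKernel n s) (baseVec n) (1 / t)
      = (∫⁻ ρ in Ioo 0 t, ENNReal.ofReal (ρ ^ ((n : ℝ) - s - 1))
          * outerMass (rieszKernel n s) (baseVec n) (1 / ρ))
        + ENNReal.ofReal (1 / (n - s)) * innerMass (rieszKernel n s) (baseVec n) t := by
  have h := setLIntegral_outerMass_div (measurable_rieszKernel (n := n) s) (rieszKernel_neg s) ht
  have h1 : ∀ᵐ x ∂(volume.restrict {x : EuclideanSpace ℝ (Fin n) | ‖x‖ < t}),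
      outerMass (rieszKernel n s) x (‖x‖ / t) = ENNReal.ofReal (‖x‖ ^ (-s))
        * outerMass (rieszKernel n s) (baseVec n) (1 / t) := by
    filter_upwards [ae_restrict_ne_zero _] with x hx
    rw [outerMass_rieszKernel s norm_baseVec hx]
    have : ‖x‖ ≠ 0 := norm_ne_zero_iff.2 hx
    congr 2
    field_simp
  have h2 : ∀ᵐ x ∂(volume.restrict {x : EuclideanSpace ℝ (Fin n) | ‖x‖ < 1}),
      innerMass (rieszKernel n s) x (t * ‖x‖) = ENNReal.ofReal (‖x‖ ^ (-s))
        * innerMass (rieszKernel n s) (baseVec n) t := by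
    filter_upwards [ae_restrict_ne_zero _] with x hx
    rw [innerMass_rieszKernel s norm_baseVec hx]
    have : ‖x‖ ≠ 0 := norm_ne_zero_iff.2 hx
    congr 2
    field_simp
  rw [lintegral_congr_ae h1, lintegral_congr_ae h2, setLIntegral_outerMass_rieszKernel,
    lintegral_mul_const _ (by fun_prop), lintegral_mul_const _ (by fun_prop),
    setLIntegral_norm_rpow hs ht, setLIntegral_norm_rpow hs one_pos, mul_assoc, mul_assoc,
    ← mul_add, Real.one_rpow] at h
  exact (ENNReal.mul_right_inj sphereMass_ne_zero sphereMass_ne_top).1 h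

lemma lintegral_outerMass_eq_tangentMass [NeZero n] {s : ℝ} (hs : s ∈ Ioo (0 : ℝ) 1) :
    (∫⁻ ρ in Ioo 0 1, ENNReal.ofReal (ρ ^ ((n : ℝ) - s - 1))
          * outerMass (rieszKernel n s) (baseVec n) (1 / ρ))
      = ENNReal.ofReal (1 / (n - s)) * tangentMass (rieszKernel n s) (baseVec n) := by
  have h := setLIntegral_outerMass_one (n := n) hs.1
  have h1 : ∀ᵐ x ∂(volume.restrict {x : EuclideanSpace ℝ (Fin n) | ‖x‖ < 1}),
      tangentMass (rieszKernel n s) x = ENNReal.ofReal (‖x‖ ^ (-s))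
        * tangentMass (rieszKernel n s) (baseVec n) := by
    filter_upwards [ae_restrict_ne_zero _] with x hx
    exact tangentMass_rieszKernel s norm_baseVec hx
  rw [lintegral_congr_ae h1, setLIntegral_outerMass_rieszKernel,
    lintegral_mul_const _ (by fun_prop), setLIntegral_norm_rpow hs one_pos, mul_assoc,
    Real.one_rpow] at h
  exact (ENNReal.mul_right_inj sphereMass_ne_zero sphereMass_ne_top).1 h

lemma tendsto_outerMass [NeZero n] {s : ℝ} (hs : 0 < s) {ι : Type*} {l : Filter ι}
    [l.IsCountablyGenerated] {T : ι → ℝ} {e : EuclideanSpace ℝ (Fin n)} {T₀ : ℝ} (h₀ : ‖e‖ < T₀)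
    (hT : ∀ᶠ i in l, T₀ ≤ T i) {A : Set (EuclideanSpace ℝ (Fin n))}
    (hA : ∀ᵐ y : EuclideanSpace ℝ (Fin n), ∀ᶠ i in l, T i ≤ ‖y‖ ↔ y ∈ A)
    (hAm : MeasurableSet A) :
    Tendsto (fun i => outerMass (rieszKernel n s) e (T i)) l
      (nhds (∫⁻ y in A, rieszKernel n s (e - y))) := by
  have hm : ∀ T : ℝ, MeasurableSet {y : EuclideanSpace ℝ (Fin n) | T ≤ ‖y‖} := fun T =>
    measurableSet_le (by fun_prop) (by fun_prop)
  unfold outerMass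
  simp only [← lintegral_indicator (hm _), ← lintegral_indicator hAm]
  refine tendsto_lintegral_filter_of_dominated_convergence
    ({y : EuclideanSpace ℝ (Fin n) | T₀ ≤ ‖y‖}.indicator fun y => rieszKernel n s (e - y))
    (Eventually.of_forall fun i => Measurable.indicator (by fun_prop) (hm _)) ?_ ?_ ?_
  · filter_upwards [hT] with i hi
    exact Eventually.of_forall fun y => indicator_le_indicator_of_subset
      (fun y hy => le_trans hi hy) (fun _ => zero_le) y
  · rw [lintegral_indicator (hm _)]
    exact (outerMass_lt_top hs h₀).ne
  · filter_upwards [hA] with y hy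
    refine tendsto_const_nhds.congr' ?_
    filter_upwards [hy] with i hi
    by_cases h : y ∈ A
    · simp [h, hi.2 h]
    · simp [h, mt hi.1 h]

lemma continuousAt_outerMass [NeZero n] {s : ℝ} (hs : 0 < s) {e : EuclideanSpace ℝ (Fin n)} {T : ℝ}
    (hT : ‖e‖ < T) : ContinuousAt (outerMass (rieszKernel n s) e) T := by
  obtain ⟨T₀, h₀, h₁⟩ := exists_between hT
  refine tendsto_outerMass hs h₀ (eventually_ge_nhds h₁) ?_
    (measurableSet_le (by fun_prop) (by fun_prop))
  have h : volume (sphere (0 : EuclideanSpace ℝ (Fin n)) T) = 0 := Measure.addHaar_sphere _ _ _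
  filter_upwards [measure_eq_zero_iff_ae_notMem.1 h] with y hy
  simp only [mem_sphere_zero_iff_norm] at hy
  rcases lt_or_gt_of_ne hy with h | h
  · filter_upwards [lt_mem_nhds h] with i hi
    exact ⟨fun h' => absurd h' (not_le.2 hi), fun h' => absurd h' (not_le.2 h)⟩
  · filter_upwards [gt_mem_nhds h] with i hi
    exact ⟨fun _ => h.le, fun _ => hi.le⟩

lemma tendsto_outerMass_atTop [NeZero n] {s : ℝ} (hs : 0 < s) (e : EuclideanSpace ℝ (Fin n)) :
    Tendsto (outerMass (rieszKernel n s) e) atTop (nhds 0) := by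
  have := tendsto_outerMass (T := id) hs (lt_add_one ‖e‖) (eventually_ge_atTop (‖e‖ + 1))
    (A := ∅) (Eventually.of_forall fun y => by
      filter_upwards [eventually_gt_atTop ‖y‖] with i hi
      simpa using hi) MeasurableSet.empty
  simpa using this

lemma tangentMass_pos [NeZero n] (s : ℝ) : 0 < tangentMass (rieszKernel n s) (baseVec n) := by
  rw [tangentMass, setLIntegral_pos_iff (measurable_rieszKernel s)]
  have ho : IsOpen {z : EuclideanSpace ℝ (Fin n) | 2 < ‖z‖} :=
    isOpen_lt continuous_const continuous_norm
  refine (ho.measure_pos volume ⟨(3 : ℝ) • baseVec n, ?_⟩).trans_le (measure_mono ?_)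
  · simp only [mem_ofPred_eq, norm_smul, norm_baseVec]
    norm_num
  · intro z hz
    simp only [mem_ofPred_eq] at hz
    have h1 := norm_sub_norm_le z (-baseVec n)
    have h2 := norm_sub_norm_le z (baseVec n)
    rw [norm_neg, sub_neg_eq_add, add_comm z] at h1
    rw [norm_sub_rev z] at h2
    simp only [norm_baseVec] at h1 h2
    refine ⟨?_, ?_, ?_⟩
    · rw [Function.mem_support, rieszKernel]
      have : 0 < ‖z‖ := by linarith
      exact (ENNReal.ofReal_pos.2 (by positivity)).ne'
    · rw [norm_baseVec]
      linarith
    · rw [norm_baseVec]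
      linarith

/-- The fractional mass of the complement of `B_T` seen from a unit vector. -/
noncomputable def outerReal (n : ℕ) [NeZero n] (s T : ℝ) : ℝ :=
  (outerMass (rieszKernel n s) (baseVec n) T).toReal

/-- The fractional mass of `B_t` seen from a unit vector. -/
noncomputable def innerReal (n : ℕ) [NeZero n] (s t : ℝ) : ℝ :=
  (innerMass (rieszKernel n s) (baseVec n) t).toReal

/-- The fractional mean curvature of the unit ball. -/
noncomputable def tangentReal (n : ℕ) [NeZero n] (s : ℝ) : ℝ :=
  (tangentMass (rieszKernel n s) (baseVec n)).toReal

/-- The radial primitive of `outerReal`. -/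
noncomputable def radialPrim (n : ℕ) [NeZero n] (s t : ℝ) : ℝ :=
  ∫ ρ in (0 : ℝ)..t, ρ ^ ((n : ℝ) - s - 1) * outerReal n s (1 / ρ)

section Real

variable [NeZero n] {s : ℝ}

lemma tangentReal_pos (hs : s ∈ Ioo (0 : ℝ) 1) : 0 < tangentReal n s :=
  ENNReal.toReal_pos (tangentMass_pos s).ne' (tangentMass_lt_top hs baseVec_ne_zero).ne

lemma continuousAt_outerReal (hs : s ∈ Ioo (0 : ℝ) 1) {T : ℝ} (hT : 1 < T) :
    ContinuousAt (outerReal n s) T :=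
  (ENNReal.continuousAt_toReal
    (outerMass_lt_top hs.1 (by rwa [norm_baseVec])).ne).comp
    (continuousAt_outerMass hs.1 (by rwa [norm_baseVec]))

lemma tendsto_outerReal_atTop (hs : s ∈ Ioo (0 : ℝ) 1) :
    Tendsto (outerReal n s) atTop (nhds 0) :=
  (ENNReal.tendsto_toReal ENNReal.zero_ne_top).comp (tendsto_outerMass_atTop hs.1 _)

lemma measurable_outerReal : Measurable (outerReal n s) :=
  (antitone_outerMass _ _).measurable.ennreal_toReal

lemma lintegral_outerMass_ne_top (hs : s ∈ Ioo (0 : ℝ) 1) {t : ℝ} (ht : t ≤ 1) :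
    (∫⁻ ρ in Ioo 0 t, ENNReal.ofReal (ρ ^ ((n : ℝ) - s - 1))
          * outerMass (rieszKernel n s) (baseVec n) (1 / ρ)) ≠ ∞ := by
  refine ne_top_of_le_ne_top ?_ (lintegral_mono_set (Ioo_subset_Ioo_right ht))
  rw [lintegral_outerMass_eq_tangentMass hs]
  exact ENNReal.mul_ne_top ENNReal.ofReal_ne_top (tangentMass_lt_top hs baseVec_ne_zero).ne

lemma aemeasurable_radial (t : ℝ) :
    AEMeasurable (fun ρ => ENNReal.ofReal (ρ ^ ((n : ℝ) - s - 1))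
          * outerMass (rieszKernel n s) (baseVec n) (1 / ρ)) (volume.restrict (Ioo 0 t)) := by
  have hm : Measurable (outerMass (rieszKernel n s) (baseVec n)) :=
    (antitone_outerMass _ _).measurable
  fun_prop

lemma toReal_radial {ρ : ℝ} (hρ : 0 < ρ) : (ENNReal.ofReal (ρ ^ ((n : ℝ) - s - 1))
      * outerMass (rieszKernel n s) (baseVec n) (1 / ρ)).toReal
      = ρ ^ ((n : ℝ) - s - 1) * outerReal n s (1 / ρ) := by
  rw [ENNReal.toReal_mul, ENNReal.toReal_ofReal (by positivity), outerReal]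

lemma integrableOn_radial (hs : s ∈ Ioo (0 : ℝ) 1) :
    IntegrableOn (fun ρ => ρ ^ ((n : ℝ) - s - 1) * outerReal n s (1 / ρ)) (Ioc 0 1) := by
  rw [integrableOn_Ioc_iff_integrableOn_Ioo]
  refine IntegrableOn.congr_fun (f := fun ρ => (ENNReal.ofReal (ρ ^ ((n : ℝ) - s - 1))
      * outerMass (rieszKernel n s) (baseVec n) (1 / ρ)).toReal) ?_
    (fun ρ hρ => toReal_radial hρ.1) measurableSet_Ioo
  exact integrable_toReal_of_lintegral_ne_top (aemeasurable_radial 1)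
    (lintegral_outerMass_ne_top hs le_rfl)

lemma intervalIntegrable_radial (hs : s ∈ Ioo (0 : ℝ) 1) :
    IntervalIntegrable (fun ρ => ρ ^ ((n : ℝ) - s - 1) * outerReal n s (1 / ρ)) volume 0 1 := by
  rw [intervalIntegrable_iff_integrableOn_Ioc_of_le zero_le_one]
  exact integrableOn_radial hs

lemma radialPrim_eq_toReal (hs : s ∈ Ioo (0 : ℝ) 1) {t : ℝ} (ht0 : 0 < t) (ht1 : t ≤ 1) :
    radialPrim n s t = (∫⁻ ρ in Ioo 0 t, ENNReal.ofReal (ρ ^ ((n : ℝ) - s - 1))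
          * outerMass (rieszKernel n s) (baseVec n) (1 / ρ)).toReal := by
  rw [← integral_toReal (aemeasurable_radial t), radialPrim,
    intervalIntegral.integral_of_le ht0.le, integral_Ioc_eq_integral_Ioo]
  · exact setIntegral_congr_fun measurableSet_Ioo fun ρ hρ => (toReal_radial hρ.1).symm
  · exact ae_lt_top' (aemeasurable_radial t) (lintegral_outerMass_ne_top hs ht1)

lemma continuousOn_radialPrim (hs : s ∈ Ioo (0 : ℝ) 1) :
    ContinuousOn (radialPrim n s) (Icc 0 1) := by
  have := intervalIntegral.continuousOn_primitive_interval (μ := volume)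
    (f := fun ρ => ρ ^ ((n : ℝ) - s - 1) * outerReal n s (1 / ρ)) (a := 0) (b := 1) (by
    rw [uIcc_of_le zero_le_one, integrableOn_Icc_iff_integrableOn_Ioc]
    exact integrableOn_radial hs)
  rwa [uIcc_of_le zero_le_one] at this

lemma radialPrim_zero : radialPrim n s 0 = 0 := intervalIntegral.integral_same

lemma tangentReal_eq (hs : s ∈ Ioo (0 : ℝ) 1) :
    tangentReal n s = ((n : ℝ) - s) * radialPrim n s 1 := by
  have hd := sub_pos_of_mem_Ioo (n := n) hs
  rw [radialPrim_eq_toReal hs one_pos le_rfl, lintegral_outerMass_eq_tangentMass hs,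
    ENNReal.toReal_mul, ENNReal.toReal_ofReal (by positivity), tangentReal]
  field_simp

lemma radialPrim_identity (hs : s ∈ Ioo (0 : ℝ) 1) {t : ℝ} (ht : t ∈ Ioo (0 : ℝ) 1) :
    t ^ ((n : ℝ) - s) * outerReal n s (1 / t)
      = ((n : ℝ) - s) * radialPrim n s t + innerReal n s t := by
  have hd := sub_pos_of_mem_Ioo (n := n) hs
  have h0 := ht.1
  have h := congrArg ENNReal.toReal (outerMass_eq_lintegral_add_innerMass (n := n) hs ht.1)
  rw [ENNReal.toReal_add (lintegral_outerMass_ne_top hs ht.2.le)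
    (ENNReal.mul_ne_top ENNReal.ofReal_ne_top
      (innerMass_lt_top hs.1 (by rw [norm_baseVec]; exact ht.2)).ne),
    ← radialPrim_eq_toReal hs ht.1 ht.2.le, ENNReal.toReal_mul, ENNReal.toReal_mul,
    ENNReal.toReal_ofReal (by positivity), ENNReal.toReal_ofReal (by positivity)] at h
  change _ * outerReal n s (1 / t) = _ + _ * innerReal n s t at h
  field_simp at h
  exact h

lemma hasDerivAt_radialPrim (hs : s ∈ Ioo (0 : ℝ) 1) {t : ℝ} (ht : t ∈ Ioo (0 : ℝ) 1) :
    HasDerivAt (radialPrim n s) (t ^ ((n : ℝ) - s - 1) * outerReal n s (1 / t)) t := by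
  refine intervalIntegral.integral_hasDerivAt_right ?_ ?_ ?_
  · refine (intervalIntegrable_radial hs).mono_set ?_
    rw [uIcc_of_le ht.1.le, uIcc_of_le zero_le_one]
    exact Icc_subset_Icc_right ht.2.le
  · have hm := measurable_outerReal (n := n) (s := s)
    exact AEStronglyMeasurable.stronglyMeasurableAtFilter
      (Measurable.aestronglyMeasurable (by fun_prop))
  · have h1 : ContinuousAt (fun ρ : ℝ => outerReal n s (1 / ρ)) t := by
      refine ContinuousAt.comp' (continuousAt_outerReal hs ((one_lt_div ht.1).2 ht.2)) ?_
      exact continuousAt_const.div continuousAt_id ht.1.ne'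
    exact (Real.continuousAt_rpow_const _ _ (Or.inl ht.1.ne')).mul h1

lemma tendsto_radialPrim_div (hs : s ∈ Ioo (0 : ℝ) 1) :
    Tendsto (fun t => radialPrim n s t / t ^ ((n : ℝ) - s)) (nhdsWithin 0 (Ioi 0)) (nhds 0) := by
  have hd := sub_pos_of_mem_Ioo (n := n) hs
  have h1 : Tendsto (fun t : ℝ => outerReal n s (1 / t) / ((n : ℝ) - s)) (nhdsWithin 0 (Ioi 0))
      (nhds 0) := by
    have h2 : Tendsto (fun t : ℝ => 1 / t) (nhdsWithin 0 (Ioi 0)) atTop := by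
      simpa using tendsto_inv_nhdsGT_zero (𝕜 := ℝ)
    simpa using ((tendsto_outerReal_atTop hs).comp h2).div_const ((n : ℝ) - s)
  refine squeeze_zero' ?_ ?_ h1
  · filter_upwards [Ioo_mem_nhdsGT (zero_lt_one' ℝ)] with t ht
    have := ht.1
    rw [radialPrim_eq_toReal hs ht.1 ht.2.le]
    positivity
  · filter_upwards [Ioo_mem_nhdsGT (zero_lt_one' ℝ)] with t ht
    have h0 : 0 < t ^ ((n : ℝ) - s) := Real.rpow_pos_of_pos ht.1 _
    rw [div_le_div_iff₀ h0 hd]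
    have h3 : 0 ≤ innerReal n s t := by
      rw [innerReal]
      exact ENNReal.toReal_nonneg
    have := radialPrim_identity (n := n) hs ht
    linarith

end Real

end Riesz

section Variational

/-- The homogeneous pair interaction generated by a profile `g` on `[0, 1]`. -/
noncomputable def pairEnergy (d : ℝ) (g : ℝ → ℝ) (a b : ℝ) : ℝ :=
  max a b ^ d * g (min a b / max a b)

/-- The energy of the alternating family of radii `r`, with a penalization. -/
noncomputable def penalizedEnergy {m : ℕ} (d : ℝ) (g : ℝ → ℝ) (q : ℕ) (μ : ℝ) (r : Fin m → ℝ) :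
    ℝ :=
  (∑ i : Fin m, ∑ j : Fin m, (-1 : ℝ) ^ (i : ℕ) * (-1) ^ (j : ℕ) * pairEnergy d g (r i) (r j))
    - μ * ∑ i, r i ^ q

/-- Nondecreasing families of radii in `[0, 1]`. -/
def admissibleRadii (m : ℕ) : Set (Fin m → ℝ) := {r | Monotone r ∧ ∀ i, r i ∈ Icc (0 : ℝ) 1}

lemma pairEnergy_comm (d : ℝ) (g : ℝ → ℝ) (a b : ℝ) : pairEnergy d g a b = pairEnergy d g b a := by
  rw [pairEnergy, pairEnergy, max_comm, min_comm]

lemma pairEnergy_of_le {d : ℝ} {g : ℝ → ℝ} {a b : ℝ} (h : a ≤ b) :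
    pairEnergy d g a b = b ^ d * g (a / b) := by
  rw [pairEnergy, max_eq_right h, min_eq_left h]

lemma pairEnergy_self {d : ℝ} {g : ℝ → ℝ} {a : ℝ} (h : 0 < a) :
    pairEnergy d g a a = a ^ d * g 1 := by
  rw [pairEnergy_of_le le_rfl, div_self h.ne']

lemma pairEnergy_zero_left {d : ℝ} {g : ℝ → ℝ} (hg0 : g 0 = 0) {b : ℝ} (h : 0 ≤ b) :
    pairEnergy d g 0 b = 0 := by
  rw [pairEnergy_of_le h, zero_div, hg0, mul_zero]

lemma continuous_pairEnergy {d : ℝ} (hd : 0 < d) {g : ℝ → ℝ} (hg : Continuous g) {B : ℝ}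
    (hB : ∀ t, |g t| ≤ B) : Continuous fun p : ℝ × ℝ => pairEnergy d g p.1 p.2 := by
  rw [continuous_iff_continuousAt]
  intro p
  have hpow : Continuous fun p : ℝ × ℝ => max p.1 p.2 ^ d :=
    (Real.continuous_rpow_const hd.le).comp (continuous_fst.max continuous_snd)
  by_cases hp : max p.1 p.2 = 0
  · have h0 : pairEnergy d g p.1 p.2 = 0 := by
      rw [pairEnergy, hp, Real.zero_rpow hd.ne', zero_mul]
    rw [ContinuousAt, h0]
    have h1 : Tendsto (fun p : ℝ × ℝ => |max p.1 p.2 ^ d| * B) (nhds p) (nhds 0) := by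
      have := (hpow.abs.mul_const B).tendsto p
      rwa [hp, Real.zero_rpow hd.ne', abs_zero, zero_mul] at this
    refine squeeze_zero_norm (fun q => ?_) h1
    rw [pairEnergy, Real.norm_eq_abs, abs_mul]
    exact mul_le_mul_of_nonneg_left (hB _) (abs_nonneg _)
  · refine hpow.continuousAt.mul (hg.continuousAt.comp ?_)
    exact ContinuousAt.div (by fun_prop) (by fun_prop) hp

lemma continuous_penalizedEnergy {m : ℕ} {d : ℝ} (hd : 0 < d) {g : ℝ → ℝ} (hg : Continuous g)
    {B : ℝ} (hB : ∀ t, |g t| ≤ B) (q : ℕ) (μ : ℝ) :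
    Continuous (penalizedEnergy (m := m) d g q μ) := by
  have h : ∀ i j : Fin m, Continuous fun r : Fin m → ℝ => pairEnergy d g (r i) (r j) :=
    fun i j => (continuous_pairEnergy hd hg hB).comp' (f := fun r : Fin m → ℝ => (r i, r j))
      (by fun_prop)
  unfold penalizedEnergy
  fun_prop

lemma isCompact_admissibleRadii (m : ℕ) : IsCompact (admissibleRadii m) := by
  have h : IsCompact (Set.pi univ fun _ : Fin m => Icc (0 : ℝ) 1) :=
    isCompact_univ_pi fun _ => isCompact_Icc
  refine h.of_isClosed_subset ?_ fun r hr i _ => hr.2 i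
  have h1 : admissibleRadii m = (⋂ i : Fin m, ⋂ j : Fin m, ⋂ _ : i ≤ j, {r | r i ≤ r j})
      ∩ Set.pi univ fun _ : Fin m => Icc (0 : ℝ) 1 := by
    ext r
    simp only [admissibleRadii, Monotone, mem_inter_iff, mem_iInter, Set.mem_pi, mem_univ,
      mem_ofPred_eq,
      forall_const]
  rw [h1]
  refine IsClosed.inter ?_ h.isClosed
  exact isClosed_iInter fun i => isClosed_iInter fun j => isClosed_iInter fun _ =>
    isClosed_le (continuous_apply i) (continuous_apply j)

lemma exists_isMaxOn_penalizedEnergy {m : ℕ} {d : ℝ} (hd : 0 < d) {g : ℝ → ℝ} (hg : Continuous g)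
    (hg0 : g 0 = 0) {B : ℝ} (hB : ∀ t, |g t| ≤ B) {q : ℕ} (hq : q ≠ 0) :
    ∃ μ > 0, ∃ r ∈ admissibleRadii m, (∀ i, r i < 1)
      ∧ ∀ r' ∈ admissibleRadii m, penalizedEnergy d g q μ r' ≤ penalizedEnergy d g q μ r := by
  obtain ⟨A, hA⟩ := (isCompact_admissibleRadii m).exists_bound_of_continuousOn
    (continuous_penalizedEnergy (m := m) hd hg hB q 0).continuousOn
  have hzero : (0 : Fin m → ℝ) ∈ admissibleRadii m := ⟨fun _ _ _ => le_rfl, fun _ => by simp⟩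
  have hA0 : 0 ≤ A := (norm_nonneg _).trans (hA 0 hzero)
  obtain ⟨r, hr, hmax⟩ := (isCompact_admissibleRadii m).exists_isMaxOn ⟨0, hzero⟩
    (continuous_penalizedEnergy (m := m) hd hg hB q (A + 1)).continuousOn
  refine ⟨A + 1, by linarith, r, hr, fun i => lt_of_le_of_ne (hr.2 i).2 fun hi => ?_,
    fun r' hr' => hmax hr'⟩
  have h1 : penalizedEnergy d g q (A + 1) (0 : Fin m → ℝ) = 0 := by
    simp [penalizedEnergy, pairEnergy_zero_left hg0 le_rfl, hq]
  have h2 := hmax hzero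
  simp only [mem_ofPred_eq, h1] at h2
  have h3 := (le_abs_self _).trans (hA r hr)
  have h4 : (1 : ℝ) ≤ ∑ i, r i ^ q := by
    calc (1 : ℝ) = r i ^ q := by rw [hi, one_pow]
      _ ≤ ∑ i, r i ^ q := Finset.single_le_sum (f := fun i => r i ^ q)
        (fun j _ => pow_nonneg (hr.2 j).1 q) (Finset.mem_univ i)
  simp only [penalizedEnergy] at h2 h3
  nlinarith

lemma sum_alternating_congr {m : ℕ} {i i' : Fin m} (hi : (i' : ℕ) = i + 1) {r r' : Fin m → ℝ}
    (h : ∀ j, j ≠ i → j ≠ i' → r' j = r j) (hr : r i = r i') (hr' : r' i = r' i') (φ : ℝ → ℝ) :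
    ∑ j : Fin m, (-1 : ℝ) ^ (j : ℕ) * φ (r j) = ∑ j : Fin m, (-1 : ℝ) ^ (j : ℕ) * φ (r' j) := by
  rw [← sub_eq_zero, ← Finset.sum_sub_distrib]
  have hne : i ≠ i' := fun h => by
    rw [h] at hi
    omega
  rw [Finset.sum_eq_add i i' hne (fun c _ hc => by rw [h c hc.1 hc.2, sub_self])
    (fun h => absurd (Finset.mem_univ _) h) (fun h => absurd (Finset.mem_univ _) h),
    hi, hr, hr', pow_succ]
  ring

lemma sum_alternating_pair_congr {m : ℕ} {i i' : Fin m} (hi : (i' : ℕ) = i + 1) {r r' : Fin m → ℝ}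
    (h : ∀ j, j ≠ i → j ≠ i' → r' j = r j) (hr : r i = r i') (hr' : r' i = r' i')
    (G : ℝ → ℝ → ℝ) :
    ∑ j : Fin m, ∑ k : Fin m, (-1 : ℝ) ^ (j : ℕ) * (-1) ^ (k : ℕ) * G (r j) (r k)
      = ∑ j : Fin m, ∑ k : Fin m, (-1 : ℝ) ^ (j : ℕ) * (-1) ^ (k : ℕ) * G (r' j) (r' k) := by
  simp only [mul_assoc, ← Finset.mul_sum]
  rw [← sum_alternating_congr hi h hr hr' fun x => ∑ k : Fin m, (-1 : ℝ) ^ (k : ℕ) * G x (r' k)]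
  refine Finset.sum_congr rfl fun j _ => ?_
  rw [sum_alternating_congr hi h hr hr' (G (r j))]

lemma exists_sum_update {m : ℕ} {G : ℝ → ℝ → ℝ} (hG : ∀ a b, G a b = G b a) (q : ℕ) (μ : ℝ)
    (r : Fin m → ℝ) (k : Fin m) : ∃ S : ℝ, ∀ u,
    (∑ i : Fin m, ∑ j : Fin m, (-1 : ℝ) ^ (i : ℕ) * (-1) ^ (j : ℕ)
        * G (Function.update r k u i) (Function.update r k u j))
      - μ * ∑ i, Function.update r k u i ^ q
    = S + 2 * (-1) ^ (k : ℕ) * (∑ j ∈ Finset.univ.erase k, (-1 : ℝ) ^ (j : ℕ) * G u (r j))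
      + G u u - μ * u ^ q := by
  refine ⟨(∑ i ∈ Finset.univ.erase k, ∑ j ∈ Finset.univ.erase k,
    (-1 : ℝ) ^ (i : ℕ) * (-1) ^ (j : ℕ) * G (r i) (r j))
      - μ * ∑ i ∈ Finset.univ.erase k, r i ^ q, fun u => ?_⟩
  have hu : ∀ j ∈ Finset.univ.erase k, Function.update r k u j = r j := fun j hj =>
    Function.update_of_ne (Finset.ne_of_mem_erase hj) _ _
  have hsplit : ∀ f : Fin m → ℝ, ∑ i, f i = f k + ∑ i ∈ Finset.univ.erase k, f i := fun f =>
    (Finset.add_sum_erase _ f (Finset.mem_univ k)).symm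
  have h1 : ∀ f : ℝ → Fin m → ℝ, ∑ i ∈ Finset.univ.erase k, f (Function.update r k u i) i
      = ∑ i ∈ Finset.univ.erase k, f (r i) i := fun f =>
    Finset.sum_congr rfl fun i hi => by rw [hu i hi]
  have hsq : (-1 : ℝ) ^ (k : ℕ) * (-1) ^ (k : ℕ) = 1 := by
    rw [← mul_pow]
    norm_num
  simp only [hsplit, Function.update_self, Finset.sum_add_distrib]
  rw [h1 fun a _ => a ^ q, h1 fun a j => (-1 : ℝ) ^ (k : ℕ) * (-1) ^ (j : ℕ) * G u a,
    h1 fun a j => (-1 : ℝ) ^ (j : ℕ) * (-1) ^ (k : ℕ) * G a u,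
    h1 fun a i => ∑ j ∈ Finset.univ.erase k, (-1 : ℝ) ^ (i : ℕ) * (-1) ^ (j : ℕ)
      * G a (Function.update r k u j)]
  have h2 : ∀ i : Fin m, ∑ j ∈ Finset.univ.erase k, (-1 : ℝ) ^ (i : ℕ) * (-1) ^ (j : ℕ)
      * G (r i) (Function.update r k u j) = ∑ j ∈ Finset.univ.erase k,
      (-1 : ℝ) ^ (i : ℕ) * (-1) ^ (j : ℕ) * G (r i) (r j) := fun i =>
    h1 fun a j => (-1 : ℝ) ^ (i : ℕ) * (-1) ^ (j : ℕ) * G (r i) a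
  have h3 : ∑ j ∈ Finset.univ.erase k, (-1 : ℝ) ^ (j : ℕ) * (-1) ^ (k : ℕ) * G (r j) u
      = (-1) ^ (k : ℕ) * ∑ j ∈ Finset.univ.erase k, (-1 : ℝ) ^ (j : ℕ) * G u (r j) := by
    rw [Finset.mul_sum]
    exact Finset.sum_congr rfl fun j _ => by rw [hG]; ring
  have h4 : ∑ j ∈ Finset.univ.erase k, (-1 : ℝ) ^ (k : ℕ) * (-1) ^ (j : ℕ) * G u (r j)
      = (-1) ^ (k : ℕ) * ∑ j ∈ Finset.univ.erase k, (-1 : ℝ) ^ (j : ℕ) * G u (r j) := by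
    simp only [Finset.mul_sum, mul_assoc]
  simp only [h2, h3, h4, hsq]
  ring

section Maximizer

variable {m : ℕ} {d : ℝ} {g : ℝ → ℝ} {q : ℕ} {μ : ℝ} {r : Fin m → ℝ}

lemma not_exists_pos_pair (hq : q ≠ 0) (hμ : 0 < μ) (hr : r ∈ admissibleRadii m)
    (hmax : ∀ r' ∈ admissibleRadii m, penalizedEnergy d g q μ r' ≤ penalizedEnergy d g q μ r) :
    ∀ (a : ℕ) (i i' : Fin m), (i : ℕ) = a → (i' : ℕ) = i + 1 → 0 < r i → r i ≠ r i' := by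
  intro a
  induction a using Nat.strong_induction_on with
  | _ a ih =>
  intro i i' hia hi hpos heq
  obtain ⟨c, hc0, hcr, hc⟩ : ∃ c, 0 ≤ c ∧ c < r i ∧ ∀ j, j < i → r j ≤ c := by
    rcases Nat.eq_zero_or_pos (i : ℕ) with h0 | h0
    · refine ⟨0, le_rfl, hpos, fun j hj => ?_⟩
      rw [Fin.lt_def] at hj
      omega
    · let j : Fin m := ⟨i - 1, by omega⟩
      have hji : j ≤ i := by
        rw [Fin.le_def]
        exact Nat.sub_le _ _
      refine ⟨r j, (hr.2 j).1, lt_of_le_of_ne (hr.1 hji) fun h => ?_, fun l hl => hr.1 ?_⟩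
      · refine ih (i - 1) (by omega) j i rfl ?_ (h ▸ hpos) h
        simp only [j]
        omega
      · rw [Fin.lt_def] at hl
        rw [Fin.le_def]
        simp only [j]
        omega
  have hle : ∀ l, i < l → i' ≤ l := fun l hl => by
    rw [Fin.lt_def] at hl
    rw [Fin.le_def]
    omega
  have hii' : i < i' := by
    rw [Fin.lt_def]
    omega
  set r' : Fin m → ℝ := fun j => if j = i ∨ j = i' then c else r j with hr'
  have hr'i : r' i = c := by simp [hr']
  have hr'i' : r' i' = c := by simp [hr']
  have hoff : ∀ j, j ≠ i → j ≠ i' → r' j = r j := fun j h1 h2 => by simp [hr', h1, h2]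
  have hle_r : ∀ j, r' j ≤ r j := fun j => by
    by_cases h1 : j = i
    · rw [h1, hr'i]; exact hcr.le
    by_cases h2 : j = i'
    · rw [h2, hr'i', ← heq]; exact hcr.le
    rw [hoff j h1 h2]
  have hr'0 : ∀ j, 0 ≤ r' j := fun j => by
    simp only [hr']
    split_ifs
    exacts [hc0, (hr.2 j).1]
  have hadm : r' ∈ admissibleRadii m := by
    refine ⟨fun a b hab => ?_, fun j => ⟨hr'0 j, (hle_r j).trans (hr.2 j).2⟩⟩
    by_cases hb : b = i ∨ b = i'
    · have hb' : r' b = c := by rcases hb with rfl | rfl <;> assumption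
      by_cases ha : a = i ∨ a = i'
      · have ha' : r' a = c := by rcases ha with rfl | rfl <;> assumption
        rw [ha', hb']
      · push Not at ha
        rw [hoff a ha.1 ha.2, hb']
        refine hc a (lt_of_not_ge fun h => ?_)
        have h1 := hle a (lt_of_le_of_ne h ha.1.symm)
        have h2 := lt_of_le_of_ne h1 ha.2.symm
        rcases hb with rfl | rfl
        · exact absurd (hii'.trans h2) (not_lt.2 hab)
        · exact absurd h2 (not_lt.2 hab)
    · push Not at hb
      rw [hoff b hb.1 hb.2]
      exact (hle_r a).trans (hr.1 hab)
  have h1 := hmax r' hadm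
  simp only [penalizedEnergy] at h1
  rw [sum_alternating_pair_congr hi hoff heq (hr'i.trans hr'i'.symm) (pairEnergy d g)] at h1
  have h2 : ∑ j, r' j ^ q < ∑ j, r j ^ q := by
    refine Finset.sum_lt_sum (fun j _ => pow_le_pow_left₀ (hr'0 j) (hle_r j) q)
      ⟨i, Finset.mem_univ i, ?_⟩
    rw [hr'i]
    exact pow_lt_pow_left₀ hcr hc0 hq
  nlinarith

lemma exists_penalizedEnergy_update (d : ℝ) (g : ℝ → ℝ) (q : ℕ) (μ : ℝ) (r : Fin m → ℝ)
    (k : Fin m) : ∃ S : ℝ, ∀ u, penalizedEnergy d g q μ (Function.update r k u)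
      = S + 2 * (-1) ^ (k : ℕ) * (∑ j ∈ Finset.univ.erase k, (-1 : ℝ) ^ (j : ℕ)
        * pairEnergy d g u (r j)) + pairEnergy d g u u - μ * u ^ q :=
  exists_sum_update (pairEnergy_comm d g) q μ r k

lemma update_mem_admissibleRadii {u : ℝ} {k : Fin m} (hr : r ∈ admissibleRadii m)
    (hu : u ∈ Icc (0 : ℝ) 1)
    (hlo : ∀ j, j < k → r j ≤ u) (hhi : ∀ j, k < j → u ≤ r j) :
    Function.update r k u ∈ admissibleRadii m := by
  refine ⟨fun a b hab => ?_, fun j => ?_⟩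
  · by_cases ha : a = k
    · subst ha
      by_cases hb : b = a
      · rw [hb]
      · rw [Function.update_self, Function.update_of_ne hb]
        exact hhi b (lt_of_le_of_ne hab (Ne.symm hb))
    · rw [Function.update_of_ne ha]
      by_cases hb : b = k
      · subst hb
        rw [Function.update_self]
        exact hlo a (lt_of_le_of_ne hab ha)
      · rw [Function.update_of_ne hb]
        exact hr.1 hab
  · by_cases ha : j = k
    · subst ha
      rwa [Function.update_self]
    · rw [Function.update_of_ne ha]
      exact hr.2 j

lemma tendsto_pairEnergy_div {b : ℝ} (hg0 : g 0 = 0)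
    (hgd : Tendsto (fun t => g t / t ^ d) (nhdsWithin 0 (Ioi 0)) (nhds 0)) (hb : 0 ≤ b) :
    Tendsto (fun u => pairEnergy d g u b / u ^ d) (nhdsWithin 0 (Ioi 0)) (nhds 0) := by
  rcases hb.eq_or_lt with rfl | hb
  · refine tendsto_const_nhds.congr' ?_
    filter_upwards [self_mem_nhdsWithin] with u hu
    rw [pairEnergy_comm, pairEnergy_zero_left hg0 (le_of_lt hu), zero_div]
  · have h1 : Tendsto (fun u : ℝ => u / b) (nhdsWithin 0 (Ioi 0)) (nhdsWithin 0 (Ioi 0)) := by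
      refine tendsto_nhdsWithin_iff.2 ⟨?_, ?_⟩
      · have : Tendsto (fun u : ℝ => u / b) (nhds 0) (nhds (0 / b)) :=
          tendsto_id.div_const b
        rw [zero_div] at this
        exact this.mono_left nhdsWithin_le_nhds
      · filter_upwards [self_mem_nhdsWithin] with u hu
        exact div_pos hu hb
    refine (hgd.comp h1).congr' ?_
    filter_upwards [Ioo_mem_nhdsGT hb] with u hu
    have h2 : 0 < u ^ d := Real.rpow_pos_of_pos hu.1 d
    have h3 : 0 < b ^ d := Real.rpow_pos_of_pos hb d
    rw [Function.comp_apply, pairEnergy_of_le hu.2.le, Real.div_rpow hu.1.le hb.le]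
    field_simp

lemma ne_zero_of_maximizer (hdq : d < q) (hd : 0 < d) (hg0 : g 0 = 0) (hg1 : 0 < g 1)
    (hgd : Tendsto (fun t => g t / t ^ d) (nhdsWithin 0 (Ioi 0)) (nhds 0))
    (hr : r ∈ admissibleRadii m)
    (hmax : ∀ r' ∈ admissibleRadii m, penalizedEnergy d g q μ r' ≤ penalizedEnergy d g q μ r)
    (i : Fin m) : r i ≠ 0 := by
  intro hi
  obtain ⟨k, hk, hkmax⟩ := (Finset.univ.filter fun j => r j = 0).exists_maximal
    ⟨i, by simpa using hi⟩
  simp only [Finset.mem_filter, Finset.mem_univ, true_and] at hk hkmax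
  have hlo : ∀ j, j < k → r j = 0 := fun j hj =>
    le_antisymm (hk ▸ hr.1 hj.le) (hr.2 j).1
  have hhi : ∀ j, k < j → 0 < r j := fun j hj =>
    lt_of_le_of_ne (hr.2 j).1 fun h => absurd (hkmax h.symm hj.le) (not_le.2 hj)
  obtain ⟨S, hS⟩ := exists_penalizedEnergy_update d g q μ r k
  have hS0 := hS 0
  rw [show Function.update r k 0 = r by rw [← hk, Function.update_eq_self],
    pairEnergy_zero_left hg0 le_rfl,
    Finset.sum_eq_zero fun j _ => by rw [pairEnergy_zero_left hg0 (hr.2 j).1, mul_zero],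
    zero_pow (by rintro rfl; norm_num at hdq; linarith)] at hS0
  have hlim : Tendsto (fun u : ℝ => 2 * (-1) ^ (k : ℕ) * (∑ j ∈ Finset.univ.erase k,
      (-1 : ℝ) ^ (j : ℕ) * (pairEnergy d g u (r j) / u ^ d)) + g 1 - μ * u ^ ((q : ℝ) - d))
      (nhdsWithin 0 (Ioi 0)) (nhds (2 * (-1) ^ (k : ℕ) * (∑ j ∈ Finset.univ.erase k,
      (-1 : ℝ) ^ (j : ℕ) * 0) + g 1 - μ * 0)) := by
    refine ((Tendsto.const_mul _ (tendsto_finsetSum _ fun j _ =>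
      (tendsto_pairEnergy_div hg0 hgd (hr.2 j).1).const_mul _)).add_const _).sub
      (Tendsto.const_mul _ ?_)
    have := (Real.continuousAt_rpow_const 0 ((q : ℝ) - d) (Or.inr (by linarith))).tendsto
    rw [Real.zero_rpow (by linarith)] at this
    exact this.mono_left nhdsWithin_le_nhds
  simp only [mul_zero, Finset.sum_const_zero, zero_add, sub_zero] at hlim
  have hev : ∀ᶠ u in nhdsWithin (0 : ℝ) (Ioi 0), ∀ j, k < j → u ≤ r j := by
    refine eventually_all.2 fun j => ?_
    by_cases hj : k < j
    · filter_upwards [Ioo_mem_nhdsGT (hhi j hj)] with u hu _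
      exact hu.2.le
    · exact Eventually.of_forall fun u h => absurd h hj
  obtain ⟨u, hu1, hu2, hu3⟩ := ((hlim.eventually (lt_mem_nhds hg1)).and
    (hev.and (Ioo_mem_nhdsGT (zero_lt_one' ℝ)))).exists
  have h1 := hmax _ (update_mem_admissibleRadii hr ⟨hu3.1.le, hu3.2.le⟩
    (fun j hj => by rw [hlo j hj]; exact hu3.1.le) hu2)
  rw [hS u, hS0, pairEnergy_self hu3.1] at h1
  have h2 : 0 < u ^ d := Real.rpow_pos_of_pos hu3.1 d
  have h3 := mul_pos hu1 h2
  rw [sub_mul, add_mul, Real.rpow_sub hu3.1, Real.rpow_natCast, mul_assoc (2 * _),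
    Finset.sum_mul] at h3
  have h4 : ∀ j ∈ Finset.univ.erase k, (-1 : ℝ) ^ (j : ℕ) * (pairEnergy d g u (r j) / u ^ d) * u ^ d
      = (-1 : ℝ) ^ (j : ℕ) * pairEnergy d g u (r j) := fun j _ => by
    field_simp
  rw [Finset.sum_congr rfl h4, mul_assoc μ, div_mul_cancel₀ _ h2.ne'] at h3
  linarith

lemma hasDerivAt_pairEnergy_lt {Ψ : ℝ → ℝ}
    (hg' : ∀ t ∈ Ioo (0 : ℝ) 1, HasDerivAt g (t ^ (d - 1) * Ψ (1 / t)) t) {a b : ℝ} (ha : 0 < a)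
    (hab : a < b) :
    HasDerivAt (fun u => pairEnergy d g u b) (a ^ (d - 1) * Ψ (b / a)) a := by
  have hb : 0 < b := ha.trans hab
  have h1 : HasDerivAt (fun u => b ^ d * g (u / b))
      (b ^ d * ((a / b) ^ (d - 1) * Ψ (1 / (a / b)) * (1 / b))) a :=
    (HasDerivAt.comp a (hg' (a / b) ⟨div_pos ha hb, (div_lt_one hb).2 hab⟩)
      ((hasDerivAt_id a).div_const b)).const_mul _
  have h2 : b ^ d * ((a / b) ^ (d - 1) * Ψ (1 / (a / b)) * (1 / b)) = a ^ (d - 1) * Ψ (b / a) := by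
    have h3 : 0 < b ^ (d - 1) := Real.rpow_pos_of_pos hb _
    rw [one_div_div, Real.div_rpow ha.le hb.le, show b ^ d = b ^ (d - 1) * b by
      rw [← Real.rpow_add_one hb.ne', sub_add_cancel]]
    field_simp
  rw [h2] at h1
  refine h1.congr_of_eventuallyEq ?_
  filter_upwards [gt_mem_nhds hab] with u hu
  exact pairEnergy_of_le (le_of_lt hu)

lemma hasDerivAt_pairEnergy_gt {Ψ D : ℝ → ℝ}
    (hg' : ∀ t ∈ Ioo (0 : ℝ) 1, HasDerivAt g (t ^ (d - 1) * Ψ (1 / t)) t)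
    (hD : ∀ t ∈ Ioo (0 : ℝ) 1, t ^ d * Ψ (1 / t) = d * g t + D t) {a b : ℝ} (hb : 0 < b)
    (hba : b < a) :
    HasDerivAt (fun u => pairEnergy d g u b) (-(a ^ (d - 1) * D (b / a))) a := by
  have ha : 0 < a := hb.trans hba
  have ht : b / a ∈ Ioo (0 : ℝ) 1 := ⟨div_pos hb ha, (div_lt_one ha).2 hba⟩
  have h0 : HasDerivAt (fun u => b / u) (-b / a ^ 2) a := by
    simpa using (hasDerivAt_const a b).fun_div (hasDerivAt_id' a) ha.ne'
  have h1 := (Real.hasDerivAt_rpow_const (p := d) (Or.inl ha.ne')).mul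
    (HasDerivAt.comp a (hg' (b / a) ht) h0)
  have h2 : d * a ^ (d - 1) * g (b / a) + a ^ d * ((b / a) ^ (d - 1) * Ψ (1 / (b / a))
      * (-b / a ^ 2)) = -(a ^ (d - 1) * D (b / a)) := by
    have h3 := hD _ ht
    rw [show (b / a) ^ d = (b / a) ^ (d - 1) * (b / a) by
      rw [← Real.rpow_add_one ht.1.ne', sub_add_cancel]] at h3
    rw [show a ^ d = a ^ (d - 1) * a by rw [← Real.rpow_add_one ha.ne', sub_add_cancel],
      show D (b / a) = (b / a) ^ (d - 1) * (b / a) * Ψ (1 / (b / a)) - d * g (b / a) by linarith]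
    field_simp
    ring
  refine (h1.congr_deriv h2).congr_of_eventuallyEq ?_
  filter_upwards [lt_mem_nhds hba] with u hu
  rw [pairEnergy_comm]
  exact pairEnergy_of_le (le_of_lt hu)

/-- The Euler–Lagrange system of the alternating pair energy has a solution. -/
theorem exists_alternating_critical_radii (m : ℕ) {d : ℝ} (hd : 0 < d) {q : ℕ} (hdq : d < q)
    {g Ψ D : ℝ → ℝ} (hg : Continuous g) {B : ℝ} (hB : ∀ t, |g t| ≤ B) (hg0 : g 0 = 0)
    (hg1 : 0 < g 1) (hgd : Tendsto (fun t => g t / t ^ d) (nhdsWithin 0 (Ioi 0)) (nhds 0))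
    (hg' : ∀ t ∈ Ioo (0 : ℝ) 1, HasDerivAt g (t ^ (d - 1) * Ψ (1 / t)) t)
    (hD : ∀ t ∈ Ioo (0 : ℝ) 1, t ^ d * Ψ (1 / t) = d * g t + D t) :
    ∃ (r : Fin m → ℝ) (c : ℝ), StrictMono r ∧ (∀ k, 0 < r k) ∧ ∀ k : Fin m,
      d * g 1 + 2 * (-1) ^ (k : ℕ) * (∑ j ∈ Finset.univ.erase k, (-1 : ℝ) ^ (j : ℕ)
        * (if k < j then Ψ (r j / r k) else -D (r j / r k))) = c * r k ^ ((q : ℝ) - d) := by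
  have hq : q ≠ 0 := by
    rintro rfl
    norm_num at hdq
    linarith
  obtain ⟨μ, hμ, r, hr, hr1, hmax⟩ := exists_isMaxOn_penalizedEnergy (m := m) hd hg hg0 hB hq
  have hpos : ∀ k, 0 < r k := fun k => lt_of_le_of_ne (hr.2 k).1
    (ne_zero_of_maximizer hdq hd hg0 hg1 hgd hr hmax k).symm
  have hstrict : StrictMono r := by
    refine hr.1.strictMono_of_injective ?_
    have hlt : ∀ a b : Fin m, a < b → r a ≠ r b := fun a b hab h => by
      rw [Fin.lt_def] at hab
      let a' : Fin m := ⟨a + 1, by omega⟩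
      have h1 : r a ≤ r a' := hr.1 (Fin.le_def.2 (Nat.le_succ _))
      have h2 : r a' ≤ r b := hr.1 (Fin.le_def.2 hab)
      exact not_exists_pos_pair hq hμ hr hmax a a a' rfl rfl (hpos a) (by linarith)
    intro a b h
    by_contra hne
    rcases lt_or_gt_of_ne hne with h' | h'
    exacts [hlt a b h' h, hlt b a h' h.symm]
  refine ⟨r, μ * q, hstrict, hpos, fun k => ?_⟩
  obtain ⟨S, hS⟩ := exists_penalizedEnergy_update d g q μ r k
  have hself : HasDerivAt (fun u => pairEnergy d g u u) (r k ^ (d - 1) * (d * g 1)) (r k) := by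
    have h1 := (Real.hasDerivAt_rpow_const (p := d) (Or.inl (hpos k).ne')).mul_const (g 1)
    refine (h1.congr_deriv (by ring)).congr_of_eventuallyEq ?_
    filter_upwards [lt_mem_nhds (hpos k)] with u hu
    exact pairEnergy_self hu
  have hpair : ∀ j ∈ Finset.univ.erase k, HasDerivAt
      (fun u => (-1 : ℝ) ^ (j : ℕ) * pairEnergy d g u (r j))
      ((-1 : ℝ) ^ (j : ℕ) * (r k ^ (d - 1)
        * (if k < j then Ψ (r j / r k) else -D (r j / r k)))) (r k) := fun j hj => by
    refine HasDerivAt.const_mul _ ?_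
    split_ifs with h
    · exact hasDerivAt_pairEnergy_lt hg' (hpos k) (hstrict h)
    · rw [mul_neg]
      exact hasDerivAt_pairEnergy_gt hg' hD (hpos j)
        (hstrict (lt_of_le_of_ne (not_lt.1 h) (Finset.ne_of_mem_erase hj)))
  have hder := ((((HasDerivAt.fun_sum hpair).const_mul (2 * (-1) ^ (k : ℕ))).const_add S).add
    hself).sub ((hasDerivAt_pow q (r k)).const_mul μ)
  have hloc : IsLocalMax (fun u => penalizedEnergy d g q μ (Function.update r k u)) (r k) := by
    have h1 : ∀ᶠ u in nhds (r k), ∀ j, j < k → r j ≤ u := eventually_all.2 fun j => by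
      by_cases hj : j < k
      · filter_upwards [lt_mem_nhds (hstrict hj)] with u hu _ using le_of_lt hu
      · exact Eventually.of_forall fun u h => absurd h hj
    have h2 : ∀ᶠ u in nhds (r k), ∀ j, k < j → u ≤ r j := eventually_all.2 fun j => by
      by_cases hj : k < j
      · filter_upwards [gt_mem_nhds (hstrict hj)] with u hu _ using le_of_lt hu
      · exact Eventually.of_forall fun u h => absurd h hj
    filter_upwards [h1, h2, lt_mem_nhds (hpos k), gt_mem_nhds (hr1 k)] with u hu1 hu2 hu3 hu4
    rw [Function.update_eq_self]
    exact hmax _ (update_mem_admissibleRadii hr ⟨le_of_lt hu3, le_of_lt hu4⟩ hu1 hu2)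
  have hzero := hloc.hasDerivAt_eq_zero
    (hder.congr_of_eventuallyEq (Eventually.of_forall fun u => hS u))
  have hp : 0 < r k ^ (d - 1) := Real.rpow_pos_of_pos (hpos k) _
  have hsum : ∑ j ∈ Finset.univ.erase k, (-1 : ℝ) ^ (j : ℕ) * (r k ^ (d - 1)
        * (if k < j then Ψ (r j / r k) else -D (r j / r k)))
      = r k ^ (d - 1) * ∑ j ∈ Finset.univ.erase k, (-1 : ℝ) ^ (j : ℕ)
        * (if k < j then Ψ (r j / r k) else -D (r j / r k)) := by
    rw [Finset.mul_sum]
    exact Finset.sum_congr rfl fun j _ => by ring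
  have hpow : r k ^ (q - 1) = r k ^ (d - 1) * r k ^ ((q : ℝ) - d) := by
    rw [← Real.rpow_add (hpos k), ← Real.rpow_natCast,
      Nat.cast_sub (Nat.one_le_iff_ne_zero.2 hq)]
    congr 1
    push_cast
    ring
  rw [hsum, hpow] at hzero
  refine mul_left_cancel₀ hp.ne' ?_
  linarith

end Maximizer

end Variational

section PrincipalValue

variable {n : ℕ} {s : ℝ}

lemma tendsto_setLIntegral_truncKernel (hs : 0 < s)
    {φ : EuclideanSpace ℝ (Fin n) → EuclideanSpace ℝ (Fin n)} (hφ : Measurable φ)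
    {A : Set (EuclideanSpace ℝ (Fin n))}
    (hA : ∫⁻ y in A, rieszKernel n s (φ y) ≠ ∞) :
    Tendsto (fun ε => ∫⁻ y in A, truncKernel ε (rieszKernel n s) (φ y)) (nhdsWithin 0 (Ioi 0))
      (nhds (∫⁻ y in A, rieszKernel n s (φ y))) := by
  refine tendsto_lintegral_filter_of_dominated_convergence (fun y => rieszKernel n s (φ y))
    (Eventually.of_forall fun ε => (measurable_truncKernel s ε).comp hφ)
    (Eventually.of_forall fun ε => Eventually.of_forall fun y => ?_) hA
    (Eventually.of_forall fun y =>
      tendsto_truncKernel hs (tendsto_id.mono_left nhdsWithin_le_nhds) (φ y))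
  exact indicator_le_self _ _ _

/-- The truncated kernel, centered at `x`, as a real function. -/
noncomputable def truncReal (n : ℕ) (s ε : ℝ) (x y : EuclideanSpace ℝ (Fin n)) : ℝ :=
  (truncKernel ε (rieszKernel n s) (x - y)).toReal

lemma measurable_truncKernel_sub (ε : ℝ) (x : EuclideanSpace ℝ (Fin n)) :
    Measurable fun y => truncKernel ε (rieszKernel n s) (x - y) :=
  (measurable_truncKernel s ε).comp (by fun_prop)

lemma lintegral_truncKernel_sub_lt_top (hs : 0 < s) {ε : ℝ} (hε : 0 < ε)
    (x : EuclideanSpace ℝ (Fin n)) :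
    ∫⁻ y, truncKernel ε (rieszKernel n s) (x - y) < ∞ := by
  rw [lintegral_sub_left_eq_self]
  exact lintegral_truncKernel_lt_top hs hε

lemma setLIntegral_truncKernel_sub_lt_top (hs : 0 < s) {ε : ℝ} (hε : 0 < ε)
    (x : EuclideanSpace ℝ (Fin n)) (A : Set (EuclideanSpace ℝ (Fin n))) :
    ∫⁻ y in A, truncKernel ε (rieszKernel n s) (x - y) < ∞ :=
  (setLIntegral_le_lintegral _ _).trans_lt (lintegral_truncKernel_sub_lt_top hs hε x)

lemma integrable_truncReal (hs : 0 < s) {ε : ℝ} (hε : 0 < ε) (x : EuclideanSpace ℝ (Fin n)) :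
    Integrable (truncReal n s ε x) :=
  integrable_toReal_of_lintegral_ne_top (measurable_truncKernel_sub ε x).aemeasurable
    (lintegral_truncKernel_sub_lt_top hs hε x).ne

lemma setIntegral_truncReal (hs : 0 < s) {ε : ℝ} (hε : 0 < ε) (x : EuclideanSpace ℝ (Fin n))
    (A : Set (EuclideanSpace ℝ (Fin n))) :
    ∫ y in A, truncReal n s ε x y
      = (∫⁻ y in A, truncKernel ε (rieszKernel n s) (x - y)).toReal :=
  integral_toReal (measurable_truncKernel_sub ε x).aemeasurable
    (ae_lt_top (measurable_truncKernel_sub ε x)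
      (setLIntegral_truncKernel_sub_lt_top hs hε x A).ne)

lemma tendsto_setIntegral_truncReal (hs : 0 < s) {x : EuclideanSpace ℝ (Fin n)}
    {A : Set (EuclideanSpace ℝ (Fin n))}
    (hA : ∫⁻ y in A, rieszKernel n s (x - y) ≠ ∞) :
    Tendsto (fun ε => ∫ y in A, truncReal n s ε x y) (nhdsWithin 0 (Ioi 0))
      (nhds (∫⁻ y in A, rieszKernel n s (x - y)).toReal) := by
  have h := tendsto_setLIntegral_truncKernel hs (φ := fun y => x - y) (by fun_prop) hA
  refine ((ENNReal.tendsto_toReal hA).comp h).congr' ?_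
  filter_upwards [self_mem_nhdsWithin] with ε hε
  exact (setIntegral_truncReal hs hε x A).symm

variable [NeZero n]

lemma tendsto_outer_truncReal (hs : 0 < s) {x : EuclideanSpace ℝ (Fin n)} (hx : x ≠ 0) {T : ℝ}
    (hT : ‖x‖ < T) :
    Tendsto (fun ε => ∫ y in {y | T ≤ ‖y‖}, truncReal n s ε x y) (nhdsWithin 0 (Ioi 0))
      (nhds (‖x‖ ^ (-s) * outerReal n s (T / ‖x‖))) := by
  have h := tendsto_setIntegral_truncReal hs (outerMass_lt_top hs hT).ne
  change Tendsto _ _ (nhds (outerMass (rieszKernel n s) x T).toReal) at h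
  rwa [outerMass_rieszKernel s norm_baseVec hx, ENNReal.toReal_mul,
    ENNReal.toReal_ofReal (by positivity)] at h

lemma tendsto_inner_truncReal (hs : 0 < s) {x : EuclideanSpace ℝ (Fin n)} (hx : x ≠ 0) {T : ℝ}
    (hT : T < ‖x‖) :
    Tendsto (fun ε => ∫ y in {y | ‖y‖ < T}, truncReal n s ε x y) (nhdsWithin 0 (Ioi 0))
      (nhds (‖x‖ ^ (-s) * innerReal n s (T / ‖x‖))) := by
  have h' := (innerMass_lt_top hs hT).ne
  rw [innerMass_eq_lt] at h'
  have h := tendsto_setIntegral_truncReal hs h'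
  rwa [← innerMass_eq_lt, innerMass_rieszKernel s norm_baseVec hx, ENNReal.toReal_mul,
    ENNReal.toReal_ofReal (by positivity)] at h

lemma tendsto_ball_truncReal (hs : s ∈ Ioo (0 : ℝ) 1) {x : EuclideanSpace ℝ (Fin n)}
    (hx : x ≠ 0) :
    Tendsto (fun ε => (∫ y in {y | ‖x‖ ≤ ‖y‖}, truncReal n s ε x y)
        - ∫ y in {y | ‖y‖ < ‖x‖}, truncReal n s ε x y) (nhdsWithin 0 (Ioi 0))
      (nhds (‖x‖ ^ (-s) * tangentReal n s)) := by
  have hfin := (tangentMass_lt_top hs hx).ne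
  have h := (ENNReal.tendsto_toReal hfin).comp
    (tendsto_setLIntegral_truncKernel hs.1 measurable_id hfin)
  change Tendsto _ _ (nhds (tangentMass (rieszKernel n s) x).toReal) at h
  rw [tangentMass_rieszKernel s norm_baseVec hx, ENNReal.toReal_mul,
    ENNReal.toReal_ofReal (by positivity)] at h
  refine h.congr' ?_
  filter_upwards [self_mem_nhdsWithin] with ε hε
  have h1 := outerMass_norm_eq (measurable_truncKernel (n := n) s ε) (truncKernel_neg s ε) x
  rw [setIntegral_truncReal hs.1 hε, setIntegral_truncReal hs.1 hε, ← innerMass_eq_lt]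
  change (tangentMass (truncKernel ε (rieszKernel n s)) x).toReal
    = (outerMass (truncKernel ε (rieszKernel n s)) x ‖x‖).toReal - _
  have hi : innerMass (truncKernel ε (rieszKernel n s)) x ‖x‖ ≠ ∞ :=
    (setLIntegral_truncKernel_sub_lt_top hs.1 hε x _).ne
  have ho : outerMass (truncKernel ε (rieszKernel n s)) x ‖x‖ ≠ ∞ :=
    (setLIntegral_truncKernel_sub_lt_top hs.1 hε x _).ne
  rw [h1, ENNReal.toReal_add _ hi, add_sub_cancel_right]
  rw [h1] at ho
  exact ne_top_of_le_ne_top ho le_self_add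

lemma exists_critical_radii (m : ℕ) (hs : s ∈ Ioo (0 : ℝ) 1) :
    ∃ (r : Fin m → ℝ) (c : ℝ), StrictMono r ∧ (∀ k, 0 < r k) ∧ ∀ k : Fin m,
      tangentReal n s + 2 * (-1) ^ (k : ℕ) * (∑ j ∈ Finset.univ.erase k, (-1 : ℝ) ^ (j : ℕ)
        * (if k < j then outerReal n s (r j / r k) else -innerReal n s (r j / r k)))
      = c * r k ^ (1 + s) := by
  have hd := sub_pos_of_mem_Ioo (n := n) hs
  set g : ℝ → ℝ := IccExtend zero_le_one ((Icc 0 1).domRestrict (radialPrim n s)) with hgdef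
  have hgc : Continuous g := (continuousOn_radialPrim hs).domRestrict.Icc_extend'
  have hge : ∀ t ∈ Icc (0 : ℝ) 1, g t = radialPrim n s t := fun t ht =>
    IccExtend_of_mem _ _ ht
  have hev : ∀ t ∈ Ioo (0 : ℝ) 1, g =ᶠ[nhds t] radialPrim n s := fun t ht => by
    filter_upwards [Icc_mem_nhds ht.1 ht.2] with u hu using hge u hu
  obtain ⟨B, hB⟩ := isCompact_Icc.exists_bound_of_continuousOn (continuousOn_radialPrim (n := n) hs)
  have hg1 : g 1 = radialPrim n s 1 := hge 1 (right_mem_Icc.2 zero_le_one)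
  obtain ⟨r, c, h1, h2, h3⟩ := exists_alternating_critical_radii m hd (q := n + 1) (g := g)
    (Ψ := outerReal n s) (D := innerReal n s) (B := B)
    (by push_cast; linarith [hs.1]) hgc
    (fun t => hB _ (projIcc 0 1 zero_le_one t).2)
    (by rw [hge 0 (left_mem_Icc.2 zero_le_one), radialPrim_zero])
    (by
      have h := tangentReal_pos (n := n) hs
      rw [tangentReal_eq hs] at h
      rw [hg1]
      exact (pos_iff_pos_of_mul_pos h).1 hd)
    (by
      refine (tendsto_radialPrim_div (n := n) hs).congr' ?_
      filter_upwards [Ioo_mem_nhdsGT (zero_lt_one' ℝ)] with t ht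
      rw [hge t (Ioo_subset_Icc_self ht)])
    (fun t ht => (hasDerivAt_radialPrim hs ht).congr_of_eventuallyEq (hev t ht))
    (fun t ht => by rw [hge t (Ioo_subset_Icc_self ht), radialPrim_identity hs ht])
  refine ⟨r, c, h1, h2, fun k => ?_⟩
  rw [tangentReal_eq hs, ← hg1, h3 k]
  congr 2
  push_cast
  ring

lemma alternating_sum_lt {m : ℕ} (i : Fin m) :
    ∑ j ∈ Finset.univ.erase i, (-1 : ℝ) ^ (j : ℕ) * (if i < j then 0 else 1)
      = (1 - (-1) ^ (i : ℕ)) / 2 := by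
  have h1 : ∀ k : ℕ, ∑ j ∈ Finset.range k, (-1 : ℝ) ^ j = (1 - (-1) ^ k) / 2 := fun k => by
    induction k with
    | zero => simp
    | succ k ih =>
      rw [Finset.sum_range_succ, ih, pow_succ]
      ring
  rw [← h1 i, ← Fin.sum_univ_eq_sum_range fun j => (-1 : ℝ) ^ j]
  symm
  refine Finset.sum_bij_ne_zero (fun (j : Fin i) _ _ => (⟨j, j.2.trans i.2⟩ : Fin m))
    (fun j _ _ => ?_) (fun a _ _ b _ _ h => ?_) (fun j hj hj' => ?_) (fun j _ _ => ?_)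
  · simpa [Fin.ext_iff] using j.2.ne
  · simpa [Fin.ext_iff] using h
  · have hlt : ¬ i < j := fun h => hj' (by simp [h])
    have hlt' : j < i := lt_of_le_of_ne (not_lt.1 hlt) (Finset.ne_of_mem_erase hj)
    exact ⟨⟨j, hlt'⟩, Finset.mem_univ _, by simp, rfl⟩
  · have : ¬ i < (⟨j, j.2.trans i.2⟩ : Fin m) := not_lt.2 (Fin.le_def.2 j.2.le)
    simp [this]

/-- Fractional mean curvature of an alternating union of annuli on one of its boundary spheres. -/
theorem hasFracMeanCurvAt_alternating {m : ℕ} {r : Fin m → ℝ} (hs : s ∈ Ioo (0 : ℝ) 1)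
    (hr : StrictMono r) {E : Set (EuclideanSpace ℝ (Fin n))}
    (hE : ∀ y, E.indicator (fun _ => (1 : ℝ)) y = 1 - ∑ j : Fin m, (-1 : ℝ) ^ (j : ℕ)
      * {y : EuclideanSpace ℝ (Fin n) | r j ≤ ‖y‖}.indicator (fun _ => (1 : ℝ)) y)
    {i : Fin m} (hri : 0 < r i) {x : EuclideanSpace ℝ (Fin n)} (hx : ‖x‖ = r i) :
    HasFracMeanCurvAt n s E x ((-1) ^ (i : ℕ) * (r i ^ (-s) * (tangentReal n s
      + 2 * (-1) ^ (i : ℕ) * ∑ j ∈ Finset.univ.erase i, (-1 : ℝ) ^ (j : ℕ)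
        * (if i < j then outerReal n s (r j / r i) else -innerReal n s (r j / r i))))) := by
  have hx0 : x ≠ 0 := norm_pos_iff.1 (hx ▸ hri)
  set O : ℝ → Set (EuclideanSpace ℝ (Fin n)) := fun T => {y | T ≤ ‖y‖} with hO
  set I : ℝ → Set (EuclideanSpace ℝ (Fin n)) := fun T => {y | ‖y‖ < T} with hI
  have hOm : ∀ T, MeasurableSet (O T) := fun T => measurableSet_le (by fun_prop) (by fun_prop)
  have hIm : ∀ T, MeasurableSet (I T) := fun T => measurableSet_lt (by fun_prop) (by fun_prop)
  have hOI : ∀ T y (f : EuclideanSpace ℝ (Fin n) → ℝ),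
      (O T).indicator f y + (I T).indicator f y = f y := fun T y f => by
    by_cases h : T ≤ ‖y‖
    · simp [hO, hI, h]
    · simp [hO, hI, h, not_le.1 h]
  have hdec : ∀ (y : EuclideanSpace ℝ (Fin n)) (f : EuclideanSpace ℝ (Fin n) → ℝ),
      (Eᶜ.indicator (fun _ => (1 : ℝ)) y - E.indicator (fun _ => (1 : ℝ)) y) * f y
      = (-1) ^ (i : ℕ) * ((O (r i)).indicator f y - (I (r i)).indicator f y)
        + 2 * ∑ j ∈ Finset.univ.erase i, (-1 : ℝ) ^ (j : ℕ)
          * (if i < j then (O (r j)).indicator f y else -(I (r j)).indicator f y) := by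
    intro y f
    have h1 : Eᶜ.indicator (fun _ => (1 : ℝ)) y = 1 - E.indicator (fun _ => (1 : ℝ)) y := by
      by_cases h : y ∈ E <;> simp [h]
    have h2 : ∀ T, (O T).indicator f y = (O T).indicator (fun _ => (1 : ℝ)) y * f y := fun T => by
      by_cases h : y ∈ O T <;> simp [h]
    have h3 : ∀ j : Fin m, (if i < j then (O (r j)).indicator f y else -(I (r j)).indicator f y)
        = ((O (r j)).indicator (fun _ => (1 : ℝ)) y - if i < j then 0 else 1) * f y := fun j => by
      have := hOI (r j) y f
      have := h2 (r j)
      split_ifs <;> linarith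
    have h4 : ∑ j ∈ Finset.univ.erase i, (-1 : ℝ) ^ (j : ℕ)
          * (if i < j then (O (r j)).indicator f y else -(I (r j)).indicator f y)
        = ((∑ j ∈ Finset.univ.erase i, (-1 : ℝ) ^ (j : ℕ)
            * (O (r j)).indicator (fun _ => (1 : ℝ)) y) - (1 - (-1) ^ (i : ℕ)) / 2) * f y := by
      rw [← alternating_sum_lt i, ← Finset.sum_sub_distrib, Finset.sum_mul]
      exact Finset.sum_congr rfl fun j _ => by rw [h3]; ring
    have h5 := hOI (r i) y f
    have h6 := h2 (r i)
    rw [h1, hE, ← Finset.add_sum_erase _ _ (Finset.mem_univ i), h4,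
      show (I (r i)).indicator f y = f y - (O (r i)).indicator f y by linarith, h6]
    ring
  have hlim : Tendsto (fun ε => (-1 : ℝ) ^ (i : ℕ) * ((∫ y in O (r i), truncReal n s ε x y)
        - ∫ y in I (r i), truncReal n s ε x y)
        + 2 * ∑ j ∈ Finset.univ.erase i, (-1 : ℝ) ^ (j : ℕ)
          * (if i < j then ∫ y in O (r j), truncReal n s ε x y
            else -∫ y in I (r j), truncReal n s ε x y)) (nhdsWithin 0 (Ioi 0))
      (nhds ((-1 : ℝ) ^ (i : ℕ) * (r i ^ (-s) * tangentReal n s)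
        + 2 * ∑ j ∈ Finset.univ.erase i, (-1 : ℝ) ^ (j : ℕ)
          * (if i < j then r i ^ (-s) * outerReal n s (r j / r i)
            else -(r i ^ (-s) * innerReal n s (r j / r i))))) := by
    refine Tendsto.add ?_ (Tendsto.const_mul _ (tendsto_finsetSum _ fun j hj =>
      Tendsto.const_mul _ ?_))
    · rw [← hx]
      exact (tendsto_ball_truncReal hs hx0).const_mul _
    · split_ifs with h
      · rw [← hx]
        exact tendsto_outer_truncReal hs.1 hx0 (hx ▸ hr h)
      · rw [← hx]
        exact (tendsto_inner_truncReal hs.1 hx0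
          (hx ▸ hr (lt_of_le_of_ne (not_lt.1 h) (Finset.ne_of_mem_erase hj)))).neg
  have hval : (-1 : ℝ) ^ (i : ℕ) * (r i ^ (-s) * tangentReal n s)
        + 2 * ∑ j ∈ Finset.univ.erase i, (-1 : ℝ) ^ (j : ℕ)
          * (if i < j then r i ^ (-s) * outerReal n s (r j / r i)
            else -(r i ^ (-s) * innerReal n s (r j / r i)))
      = (-1) ^ (i : ℕ) * (r i ^ (-s) * (tangentReal n s
      + 2 * (-1) ^ (i : ℕ) * ∑ j ∈ Finset.univ.erase i, (-1 : ℝ) ^ (j : ℕ)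
        * (if i < j then outerReal n s (r j / r i) else -innerReal n s (r j / r i)))) := by
    have hsq : (-1 : ℝ) ^ (i : ℕ) * (-1) ^ (i : ℕ) = 1 := by
      rw [← mul_pow]
      norm_num
    have h1 : ∑ j ∈ Finset.univ.erase i, (-1 : ℝ) ^ (j : ℕ)
          * (if i < j then r i ^ (-s) * outerReal n s (r j / r i)
            else -(r i ^ (-s) * innerReal n s (r j / r i)))
        = r i ^ (-s) * ∑ j ∈ Finset.univ.erase i, (-1 : ℝ) ^ (j : ℕ)
        * (if i < j then outerReal n s (r j / r i) else -innerReal n s (r j / r i)) := by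
      rw [Finset.mul_sum]
      refine Finset.sum_congr rfl fun j _ => ?_
      split_ifs <;> ring
    rw [h1]
    linear_combination (-2 * r i ^ (-s) * ∑ j ∈ Finset.univ.erase i, (-1 : ℝ) ^ (j : ℕ)
        * (if i < j then outerReal n s (r j / r i) else -innerReal n s (r j / r i))) * hsq
  rw [hval] at hlim
  refine hlim.congr' ?_
  filter_upwards [self_mem_nhdsWithin] with ε hε
  have hint := integrable_truncReal hs.1 hε x
  have hmeas : MeasurableSet {y : EuclideanSpace ℝ (Fin n) | ε < dist y x} :=
    measurableSet_lt (by fun_prop) (by fun_prop)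
  have hpt : ∀ y, {y : EuclideanSpace ℝ (Fin n) | ε < dist y x}.indicator (fun y =>
      (Eᶜ.indicator (fun _ => (1 : ℝ)) y - E.indicator (fun _ => (1 : ℝ)) y)
          * ‖x - y‖ ^ (-((n : ℝ) + s))) y
      = (Eᶜ.indicator (fun _ => (1 : ℝ)) y - E.indicator (fun _ => (1 : ℝ)) y)
          * truncReal n s ε x y := fun y => by
    by_cases h : ε < dist y x
    · have h' : ε < ‖x - y‖ := by rwa [dist_comm, dist_eq_norm] at h
      have ht : truncReal n s ε x y = ‖x - y‖ ^ (-((n : ℝ) + s)) := by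
        rw [truncReal, truncKernel, indicator_of_mem (by exact h'), rieszKernel,
          ENNReal.toReal_ofReal (by positivity)]
      rw [indicator_of_mem (by exact h), ht]
    · have h' : ¬ ε < ‖x - y‖ := by rwa [dist_comm, dist_eq_norm] at h
      have ht : truncReal n s ε x y = 0 := by
        rw [truncReal, truncKernel, indicator_of_notMem (by exact h'), ENNReal.toReal_zero]
      rw [indicator_of_notMem (by exact h), ht, mul_zero]
  rw [← integral_indicator hmeas]
  simp only [hpt, hdec]
  have hiO : ∀ T, Integrable ((O T).indicator (truncReal n s ε x)) := fun T =>
    hint.indicator (hOm T)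
  have hiI : ∀ T, Integrable ((I T).indicator (truncReal n s ε x)) := fun T =>
    hint.indicator (hIm T)
  have hij : ∀ j : Fin m, Integrable fun y => (-1 : ℝ) ^ (j : ℕ)
      * (if i < j then (O (r j)).indicator (truncReal n s ε x) y
        else -(I (r j)).indicator (truncReal n s ε x) y) := fun j => by
    split_ifs
    exacts [(hiO _).const_mul _, (hiI _).neg.const_mul _]
  have hi0 : Integrable fun y => (-1 : ℝ) ^ (i : ℕ)
      * ((O (r i)).indicator (truncReal n s ε x) y - (I (r i)).indicator (truncReal n s ε x) y) :=
    ((hiO _).sub (hiI _)).const_mul _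
  have hi1 : Integrable fun y => 2 * ∑ j ∈ Finset.univ.erase i, (-1 : ℝ) ^ (j : ℕ)
      * (if i < j then (O (r j)).indicator (truncReal n s ε x) y
        else -(I (r j)).indicator (truncReal n s ε x) y) :=
    (integrable_finsetSum _ fun j _ => hij j).const_mul _
  rw [integral_add hi0 hi1, integral_const_mul,
    integral_sub (hiO _) (hiI _), integral_const_mul, integral_finsetSum _ fun j _ => hij j,
    integral_indicator (hOm _), integral_indicator (hIm _)]
  congr 2
  refine Finset.sum_congr rfl fun j _ => ?_
  rw [integral_const_mul]
  split_ifs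
  · rw [integral_indicator (hOm _)]
  · rw [integral_neg, integral_indicator (hIm _)]

end PrincipalValue

/-- The indicator function of an alternating union of annuli as an alternating sum of indicator
functions of complements of balls. -/
lemma indicator_ball_union_annuli {n : ℕ} (r : ℕ → ℝ) (N : ℕ)
    (hr : ∀ i, i < 2 * N → r i < r (i + 1)) (y : EuclideanSpace ℝ (Fin n)) :
    (ball (0 : EuclideanSpace ℝ (Fin n)) (r 0) ∪ ⋃ k ∈ Finset.Icc 1 N,
        (ball (0 : EuclideanSpace ℝ (Fin n)) (r (2 * k)) \ ball 0 (r (2 * k - 1)))).indicator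
      (fun _ => (1 : ℝ)) y = 1 - ∑ j ∈ Finset.range (2 * N + 1), (-1 : ℝ) ^ j
        * {y : EuclideanSpace ℝ (Fin n) | r j ≤ ‖y‖}.indicator (fun _ => (1 : ℝ)) y := by
  suffices h : (ball (0 : EuclideanSpace ℝ (Fin n)) (r 0) ∪ ⋃ k ∈ Finset.Icc 1 N,
        (ball (0 : EuclideanSpace ℝ (Fin n)) (r (2 * k)) \ ball 0 (r (2 * k - 1))))
          ⊆ ball 0 (r (2 * N)) ∧ _ from h.2
  induction N with
  | zero =>
    refine ⟨by simp, ?_⟩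
    by_cases h : r 0 ≤ ‖y‖
    · simp [h]
    · simp [h, not_le.1 h]
  | succ N ih =>
    obtain ⟨hsub, hind⟩ := ih fun i hi => hr i (by omega)
    have hr1 := hr (2 * N) (by omega)
    have hr2 : r (2 * N + 1) < r (2 * N + 2) := hr (2 * N + 1) (by omega)
    have hU : (⋃ k ∈ Finset.Icc 1 (N + 1),
        (ball (0 : EuclideanSpace ℝ (Fin n)) (r (2 * k)) \ ball 0 (r (2 * k - 1))))
        = (⋃ k ∈ Finset.Icc 1 N,
        (ball (0 : EuclideanSpace ℝ (Fin n)) (r (2 * k)) \ ball 0 (r (2 * k - 1))))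
        ∪ (ball 0 (r (2 * N + 2)) \ ball 0 (r (2 * N + 1))) := by
      rw [← Finset.insert_Icc_right_eq_Icc_add_one (by omega), Finset.set_biUnion_insert,
        union_comm]
      rfl
    rw [hU, ← union_assoc]
    refine ⟨union_subset (hsub.trans (ball_subset_ball (hr1.trans hr2).le)) sdiff_subset, ?_⟩
    rw [indicator_union_of_disjoint]
    · beta_reduce
      rw [hind, show 2 * (N + 1) + 1 = 2 * N + 1 + 1 + 1 by ring,
        Finset.sum_range_succ _ (2 * N + 1 + 1), Finset.sum_range_succ _ (2 * N + 1)]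
      have hodd : (-1 : ℝ) ^ (2 * N + 1) = -1 := by simp [pow_succ, pow_mul]
      have heven : (-1 : ℝ) ^ (2 * N + 1 + 1) = 1 := by simp [pow_succ, pow_mul]
      have h2 : (ball (0 : EuclideanSpace ℝ (Fin n)) (r (2 * N + 2))
            \ ball 0 (r (2 * N + 1))).indicator (fun _ => (1 : ℝ)) y
          = {y : EuclideanSpace ℝ (Fin n) | r (2 * N + 1) ≤ ‖y‖}.indicator (fun _ => (1 : ℝ)) y
          - {y : EuclideanSpace ℝ (Fin n) | r (2 * N + 2) ≤ ‖y‖}.indicator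
              (fun _ => (1 : ℝ)) y := by
        rcases lt_or_ge ‖y‖ (r (2 * N + 1)) with h | h
        · simp [h, not_le.2 h, not_le.2 (h.trans hr2)]
        · rcases lt_or_ge ‖y‖ (r (2 * N + 2)) with h' | h'
          · simp [h, h', not_le.2 h', not_lt.2 h]
          · simp [h, h', not_lt.2 h']
      rw [h2, hodd, heven]
      ring
    · exact disjoint_sdiff_right.mono_left (hsub.trans (ball_subset_ball hr1.le))

theorem symmetric_shrinker_with_ball_exists (n : ℕ) (hn : 1 ≤ n) (s : ℝ)
    (hs : s ∈ Set.Ioo (0 : ℝ) 1) (N : ℕ) (hN : 1 ≤ N) (R : ℝ) (hR : 0 < R) :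
    ∃ r : ℕ → ℝ, 0 < r 0 ∧ (∀ i, i < 2 * N → r i < r (i + 1)) ∧ r (2 * N) = R ∧
      ∃ H : ℕ → ℝ,
        (∀ i ∈ Finset.Icc 0 (2 * N),
          ∀ x : EuclideanSpace ℝ (Fin n), ‖x‖ = r i →
            HasFracMeanCurvAt n s
              (Metric.ball (0 : EuclideanSpace ℝ (Fin n)) (r 0) ∪
                ⋃ k ∈ Finset.Icc 1 N,
                  (Metric.ball (0 : EuclideanSpace ℝ (Fin n)) (r (2 * k)) \
                    Metric.ball 0 (r (2 * k - 1)))) x (H i)) ∧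
        (∀ i ∈ Finset.Icc 0 (2 * N - 1),
          r i * H (2 * N) + (-1 : ℝ) ^ (i + 1) * R * H i = 0) := by
  have : NeZero n := ⟨by omega⟩
  obtain ⟨a, c, ha, ha0, hcrit⟩ := exists_critical_radii (n := n) (2 * N + 1) hs
  set t : ℝ := R / a (Fin.last (2 * N)) with ht
  have ht0 : 0 < t := div_pos hR (ha0 _)
  set r : ℕ → ℝ := fun k => if h : k < 2 * N + 1 then t * a ⟨k, h⟩ else 0
  have hrv : ∀ j : Fin (2 * N + 1), r j = t * a j := fun j => dif_pos j.2
  have hmono : StrictMono fun j : Fin (2 * N + 1) => r j := fun j k hjk => by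
    simp only [hrv]
    exact mul_lt_mul_of_pos_left (ha hjk) ht0
  have hstep : ∀ i, i < 2 * N → r i < r (i + 1) := fun i hi =>
    @hmono ⟨i, by omega⟩ ⟨i + 1, by omega⟩ (by simp [Fin.lt_def])
  have hlast : r (2 * N) = R := by
    have := hrv (Fin.last (2 * N))
    rw [Fin.val_last] at this
    rw [this, ht, div_mul_cancel₀ _ (ha0 _).ne']
  refine ⟨r, ?_, hstep, hlast, fun k => (-1) ^ k * (c * t ^ (-s - 1) * r k), ?_, ?_⟩
  · have := hrv 0
    rw [Fin.val_zero] at this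
    exact this ▸ mul_pos ht0 (ha0 0)
  · intro i hi x hx
    have hi' : i < 2 * N + 1 := by
      have := (Finset.mem_Icc.1 hi).2
      omega
    lift i to Fin (2 * N + 1) using hi'
    have hri : 0 < r i := by
      rw [hrv]
      exact mul_pos ht0 (ha0 i)
    have key := hasFracMeanCurvAt_alternating hs hmono (fun y => by
      rw [indicator_ball_union_annuli r N hstep y, Fin.sum_univ_eq_sum_range fun j => (-1 : ℝ) ^ j
        * {y : EuclideanSpace ℝ (Fin n) | r j ≤ ‖y‖}.indicator (fun _ => (1 : ℝ)) y]) hri hx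
    convert key using 2
    have hratio : ∀ j : Fin (2 * N + 1), r j / r i = a j / a i := fun j => by
      rw [hrv, hrv, mul_div_mul_left _ _ ht0.ne']
    simp only [hratio]
    rw [hcrit i, hrv, Real.mul_rpow ht0.le (ha0 i).le, Real.rpow_sub_one ht0.ne',
      Real.rpow_one_add' (ha0 i).le (by linarith [hs.1]), Real.rpow_neg (ha0 i).le]
    have := (Real.rpow_pos_of_pos (ha0 i) s).ne'
    have := ht0.ne'
    field_simp
  · intro i _
    have h1 : (-1 : ℝ) ^ (2 * N) = 1 := by simp [pow_mul]
    have h2 : (-1 : ℝ) ^ i * (-1) ^ i = 1 := by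
      rw [← mul_pow]
      norm_num
    simp only [h1, hlast, pow_succ]
    linear_combination (-(R * (c * t ^ (-s - 1) * r i))) * h2
end

section
/- Let n ≥ 1 and s ∈ (0,1). For every r₁ ∈ (0,1) there exists r₀ ∈ (0, r₁) such that, setting Ẽ = B_{r₀} ∪ (B_1 \ B_{r₁}), the principal values H_s(x_{r₀}, Ẽ) and H_s(x_1, Ẽ) exist (x_{r₀} ∈ ∂B_{r₀}, x_1 ∈ ∂B_1) and r₀ · H_s(x_1, Ẽ) − H_s(x_{r₀}, Ẽ) = 0. -/
open MeasureTheory Filter Metric Set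

theorem integrableOn_norm_rpow_compl_ball (n : ℕ) {s ε : ℝ} (hs : 0 < s) (hε : 0 < ε) :
    IntegrableOn (fun z : EuclideanSpace ℝ (Fin n) => ‖z‖ ^ (-((n : ℝ) + s))) {z | ε ≤ ‖z‖} := by
  have hp : (0 : ℝ) < n + s := by positivity
  have h₁ : Integrable fun z : EuclideanSpace ℝ (Fin n) =>
      (1 / ε + 1) ^ ((n : ℝ) + s) * (1 + ‖z‖) ^ (-((n : ℝ) + s)) :=
    (integrable_one_add_norm (by simpa using hs)).const_mul _
  refine Integrable.mono' h₁.integrableOn (measurable_norm.pow_const _).aestronglyMeasurable ?_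
  refine (ae_restrict_iff' (measurableSet_le measurable_const measurable_norm)).2
    (ae_of_all _ fun z (hz : ε ≤ ‖z‖) => ?_)
  have hz0 : 0 < ‖z‖ := hε.trans_le hz
  have h₂ : 1 + ‖z‖ ≤ (1 / ε + 1) * ‖z‖ := by
    have : 1 ≤ ‖z‖ / ε := (one_le_div hε).2 hz
    linarith [show (1 / ε + 1) * ‖z‖ = ‖z‖ / ε + ‖z‖ by ring]
  have h₃ := Real.rpow_le_rpow (by positivity) h₂ hp.le
  rw [Real.mul_rpow (by positivity) hz0.le] at h₃
  rw [Real.norm_of_nonneg (by positivity), Real.rpow_neg hz0.le, Real.rpow_neg (by positivity),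
    ← div_eq_mul_inv, inv_eq_one_div, div_le_div_iff₀ (by positivity) (by positivity)]
  simpa using h₃

theorem integrable_indicator_abs_rpow {β : ℝ} (hβ : β < 1) :
    Integrable fun x : ℝ => (Iic (1 : ℝ)).indicator (fun t => t ^ (-β)) |x| := by
  have h := (integrable_fun_norm_addHaar (volume : Measure ℝ)
    (f := (Iic (1 : ℝ)).indicator (fun t => t ^ (-β)))).2
  refine h ?_
  simp only [Module.finrank_self, tsub_self, pow_zero, one_smul]
  rw [integrableOn_indicator_iff measurableSet_Iic, inter_comm, Ioi_inter_Iic,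
    ← intervalIntegrable_iff_integrableOn_Ioc_of_le zero_le_one]
  exact intervalIntegral.intervalIntegrable_rpow' (by linarith)

theorem integrable_prod_indicator_abs_rpow (n : ℕ) {β : ℝ} (hβ : β < 1) :
    Integrable fun z : EuclideanSpace ℝ (Fin n) =>
      ∏ i, (Iic (1 : ℝ)).indicator (fun t => t ^ (-β)) |z i| := by
  rw [← (PiLp.volume_preserving_toLp (Fin n)).integrable_comp_emb
    (MeasurableEquiv.toLp 2 _).measurableEmbedding]
  exact Integrable.fintype_prod (f := fun (_ : Fin n) (x : ℝ) =>
    (Iic (1 : ℝ)).indicator (fun t => t ^ (-β)) |x|) fun _ => integrable_indicator_abs_rpow hβ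

theorem ae_forall_coord_ne_zero (n : ℕ) :
    ∀ᵐ z : EuclideanSpace ℝ (Fin n), ∀ i, z i ≠ 0 := by
  refine ae_all_iff.2 fun i => ?_
  exact (PiLp.volume_preserving_ofLp (Fin n)).quasiMeasurePreserving.ae
    (Measure.ae_eval_ne (fun _ => (volume : Measure ℝ)) i 0)

/-- The set of `z` such that neither `x + z` nor `x - z` lies in the open ball of radius `‖x‖`. -/
def tangentRegion {n : ℕ} (x : EuclideanSpace ℝ (Fin n)) : Set (EuclideanSpace ℝ (Fin n)) :=
  {z | 2 * |inner ℝ x z| ≤ ‖z‖ ^ 2}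

theorem measurableSet_tangentRegion {n : ℕ} (x : EuclideanSpace ℝ (Fin n)) :
    MeasurableSet (tangentRegion x) :=
  measurableSet_le (by fun_prop) (by fun_prop)

theorem rpow_le_prod_of_mem_tangentRegion {n : ℕ} {s r : ℝ} (hs : 0 < s) (hr : 0 < r)
    (i : Fin n) {z : EuclideanSpace ℝ (Fin n)} (hz : ∀ j, z j ≠ 0) (hz1 : ‖z‖ ≤ 1)
    (hzr : z ∈ tangentRegion (r • EuclideanSpace.single i (1 : ℝ))) :
    ‖z‖ ^ (-((n : ℝ) + s)) ≤ (2 * r) ^ (-(((n : ℝ) + s) / (n + 1))) *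
      ∏ j, (Iic (1 : ℝ)).indicator (fun t => t ^ (-(((n : ℝ) + s) / (n + 1)))) |z j| := by
  set β := ((n : ℝ) + s) / (n + 1) with hβ
  have hle : ∀ j, |z j| ≤ ‖z‖ := fun j => by simpa using PiLp.norm_apply_le z j
  have hz0 : 0 < ‖z‖ := (abs_pos.2 (hz i)).trans_le (hle i)
  have h₁ : 2 * r * |z i| ≤ ‖z‖ ^ 2 := by
    have := hzr
    simp only [tangentRegion, mem_ofPred_eq, inner_smul_left, EuclideanSpace.inner_single_left] at this
    simpa [abs_mul, abs_of_pos hr, mul_assoc] using this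
  have h₂ : ∏ j ∈ Finset.univ.erase i, |z j| ≤ ‖z‖ ^ (n - 1) := by
    refine (Finset.prod_le_prod (fun _ _ => abs_nonneg _) fun j _ => hle j).trans ?_
    simp
  have h₃ : 2 * r * ∏ j, |z j| ≤ ‖z‖ ^ (n + 1) := by
    have hn : n + 1 = 2 + (n - 1) := by have := i.pos; omega
    rw [← Finset.mul_prod_erase _ _ (Finset.mem_univ i), ← mul_assoc, hn, pow_add]
    exact mul_le_mul h₁ h₂ (Finset.prod_nonneg fun _ _ => abs_nonneg _) (by positivity)
  have hpos : 0 < ∏ j, |z j| := Finset.prod_pos fun j _ => abs_pos.2 (hz j)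
  have h₄ : ∏ j, (Iic (1 : ℝ)).indicator (fun t => t ^ (-β)) |z j| = (∏ j, |z j|) ^ (-β) := by
    rw [← Real.finsetProd_rpow _ _ fun _ _ => abs_nonneg _]
    exact Finset.prod_congr rfl fun j _ => indicator_of_mem (mem_Iic.2 ((hle j).trans hz1)) _
  have h₅ : ‖z‖ ^ (-((n : ℝ) + s)) = (‖z‖ ^ (n + 1)) ^ (-β) := by
    rw [← Real.rpow_natCast, ← Real.rpow_mul hz0.le]
    congr 1
    rw [hβ]
    push_cast
    field_simp
  rw [h₄, h₅, ← Real.mul_rpow (by positivity) hpos.le]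
  exact Real.rpow_le_rpow_of_nonpos (by positivity) h₃ (neg_nonpos.2 (by positivity))

theorem integrableOn_tangentRegion_smul_single {n : ℕ} {s r : ℝ} (hs : s ∈ Ioo (0 : ℝ) 1)
    (hr : 0 < r) (i : Fin n) :
    IntegrableOn (fun z : EuclideanSpace ℝ (Fin n) => ‖z‖ ^ (-((n : ℝ) + s)))
      (tangentRegion (r • EuclideanSpace.single i (1 : ℝ))) := by
  set x := r • EuclideanSpace.single i (1 : ℝ)
  have hβ : ((n : ℝ) + s) / (n + 1) < 1 := by
    rw [div_lt_one (by positivity)]; linarith [hs.2]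
  have h₁ : IntegrableOn (fun z : EuclideanSpace ℝ (Fin n) => ‖z‖ ^ (-((n : ℝ) + s)))
      (tangentRegion x ∩ closedBall 0 1) := by
    refine Integrable.mono' ((integrable_prod_indicator_abs_rpow n hβ).const_mul
      ((2 * r) ^ (-(((n : ℝ) + s) / (n + 1))))).integrableOn
      (measurable_norm.pow_const _).aestronglyMeasurable ?_
    rw [ae_restrict_iff' ((measurableSet_tangentRegion x).inter measurableSet_closedBall)]
    filter_upwards [ae_forall_coord_ne_zero n] with z hz hzx
    rw [Real.norm_of_nonneg (by positivity)]
    exact rpow_le_prod_of_mem_tangentRegion hs.1 hr i hz (by simpa using hzx.2) hzx.1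
  refine (h₁.union (integrableOn_norm_rpow_compl_ball n hs.1 one_pos)).mono_set fun z hz => ?_
  rcases le_total ‖z‖ 1 with h | h
  · exact Or.inl ⟨hz, by simpa using h⟩
  · exact Or.inr h

theorem exists_linearIsometryEquiv_of_norm_eq {n : ℕ} {x y : EuclideanSpace ℝ (Fin n)}
    (h : ‖x‖ = ‖y‖) :
    ∃ U : EuclideanSpace ℝ (Fin n) ≃ₗᵢ[ℝ] EuclideanSpace ℝ (Fin n), U x = y :=
  ⟨_, Submodule.reflection_sub h⟩

theorem preimage_tangentRegion {n : ℕ} (x : EuclideanSpace ℝ (Fin n))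
    (U : EuclideanSpace ℝ (Fin n) ≃ₗᵢ[ℝ] EuclideanSpace ℝ (Fin n)) :
    U ⁻¹' tangentRegion (U x) = tangentRegion x := by
  ext z
  simp [tangentRegion]

theorem integrableOn_tangentRegion {n : ℕ} {s : ℝ} (hs : s ∈ Ioo (0 : ℝ) 1)
    {x : EuclideanSpace ℝ (Fin n)} (hx : x ≠ 0) :
    IntegrableOn (fun z : EuclideanSpace ℝ (Fin n) => ‖z‖ ^ (-((n : ℝ) + s)))
      (tangentRegion x) := by
  obtain ⟨i, -⟩ : ∃ i, x i ≠ 0 := by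
    by_contra! h
    exact hx (by ext i; simpa using h i)
  have hr := norm_pos_iff.2 hx
  obtain ⟨U, hU⟩ := exists_linearIsometryEquiv_of_norm_eq
    (x := x) (y := ‖x‖ • EuclideanSpace.single i (1 : ℝ)) (by simp [norm_smul])
  have h := (U.measurePreserving.integrableOn_comp_preimage
    U.toHomeomorph.measurableEmbedding).2 (integrableOn_tangentRegion_smul_single hs hr i)
  rw [← hU, preimage_tangentRegion] at h
  simpa [Function.comp_def] using h

theorem norm_indicator_compl_sub_indicator_mul_le {α : Type*} (E : Set α) (y : α) {c : ℝ}
    (hc : 0 ≤ c) :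
    ‖(Eᶜ.indicator (fun _ => (1 : ℝ)) y - E.indicator (fun _ => (1 : ℝ)) y) * c‖ ≤ c := by
  by_cases hy : y ∈ E <;> simp [hy, abs_of_nonneg hc]

theorem hasFracMeanCurvAt_ball {n : ℕ} {s : ℝ} (hs : s ∈ Ioo (0 : ℝ) 1)
    {x : EuclideanSpace ℝ (Fin n)} (hx : x ≠ 0) :
    HasFracMeanCurvAt n s (ball 0 ‖x‖) x
      (∫ z in tangentRegion x, ‖z‖ ^ (-((n : ℝ) + s))) := by
  set k : EuclideanSpace ℝ (Fin n) → ℝ := fun z => ‖z‖ ^ (-((n : ℝ) + s)) with hk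
  set B := ball (0 : EuclideanSpace ℝ (Fin n)) ‖x‖ with hB
  have hkm : Measurable k := measurable_norm.pow_const _
  have hki := integrableOn_tangentRegion hs hx
  have h_eq : ∀ ε > 0, ∫ y in {y : EuclideanSpace ℝ (Fin n) | ε < dist y x},
      (Bᶜ.indicator (fun _ => (1 : ℝ)) y - B.indicator (fun _ => (1 : ℝ)) y) * k (x - y)
      = ∫ z in tangentRegion x, {z | ε < ‖z‖}.indicator k z := by
    intro ε hε
    set g : EuclideanSpace ℝ (Fin n) → ℝ := {y | ε < dist y x}.indicator fun y =>
      (Bᶜ.indicator (fun _ => (1 : ℝ)) y - B.indicator (fun _ => (1 : ℝ)) y) * k (x - y) with hg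
    have hS : MeasurableSet {y : EuclideanSpace ℝ (Fin n) | ε < dist y x} :=
      measurableSet_lt measurable_const (by fun_prop)
    have hgi : Integrable g := by
      have h₁ := ((integrableOn_norm_rpow_compl_ball n hs.1 hε).integrable_indicator
        (measurableSet_le measurable_const measurable_norm)).comp_sub_left x
      refine h₁.mono' ?_ (ae_of_all _ fun y => ?_)
      · refine (Measurable.indicator ?_ hS).aestronglyMeasurable
        exact ((measurable_const.indicator measurableSet_ball.compl).sub
          (measurable_const.indicator measurableSet_ball)).mul (hkm.comp (by fun_prop))
      · by_cases hy : ε < dist y x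
        · have h₂ : ε ≤ ‖x - y‖ := by rw [← dist_eq_norm, dist_comm]; exact hy.le
          rw [indicator_of_mem (show x - y ∈ {z : EuclideanSpace ℝ (Fin n) | ε ≤ ‖z‖} from h₂), hg,
            indicator_of_mem (show y ∈ {y | ε < dist y x} from hy)]
          exact norm_indicator_compl_sub_indicator_mul_le B y (by positivity)
        · have h₃ : 0 ≤ {z : EuclideanSpace ℝ (Fin n) | ε ≤ ‖z‖}.indicator k (x - y) :=
            indicator_nonneg (fun _ _ => by positivity) _
          rwa [hg, indicator_of_notMem (show y ∉ {y | ε < dist y x} from hy), norm_zero]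
    have hsum : ∀ z, g (x + z) + g (x - z)
        = 2 * (tangentRegion x).indicator ({z | ε < ‖z‖}.indicator k) z := by
      intro z
      by_cases hz : ε < ‖z‖
      · have hz0 : 0 < ‖z‖ := hε.trans hz
        have h₁ : x + z ∈ B ↔ 2 * inner ℝ x z + ‖z‖ ^ 2 < 0 := by
          rw [hB, mem_ball_zero_iff, ← pow_lt_pow_iff_left₀ (norm_nonneg _) (norm_nonneg _)
            two_ne_zero, norm_add_sq_real]
          constructor <;> intro h <;> linarith
        have h₂ : x - z ∈ B ↔ -(2 * inner ℝ x z) + ‖z‖ ^ 2 < 0 := by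
          rw [hB, mem_ball_zero_iff, ← pow_lt_pow_iff_left₀ (norm_nonneg _) (norm_nonneg _)
            two_ne_zero, norm_sub_sq_real]
          constructor <;> intro h <;> linarith
        have h₃ : z ∈ tangentRegion x ↔ x + z ∉ B ∧ x - z ∉ B := by
          rw [h₁, h₂, tangentRegion, mem_ofPred_eq, ← abs_two (α := ℝ), ← abs_mul, abs_le, abs_two]
          constructor
          · rintro ⟨h, h'⟩
            constructor <;> linarith
          · rintro ⟨h, h'⟩
            constructor <;> linarith
        have h₄ : ¬ (x + z ∈ B ∧ x - z ∈ B) := by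
          rw [h₁, h₂]
          rintro ⟨h, h'⟩
          nlinarith
        have hkz : k (-z) = k z := by simp [hk]
        by_cases ha : x + z ∈ B <;> by_cases hb : x - z ∈ B
        · exact absurd ⟨ha, hb⟩ h₄
        all_goals simp [hg, hz, ha, hb, hkz, h₃, two_mul]
      · simp [hg, hz, indicator]
    have h₁ : ∫ z, g (x + z) = ∫ y, g y := integral_add_left_eq_self g x
    have h₂ : ∫ z, g (x - z) = ∫ y, g y := integral_sub_left_eq_self g volume x
    have h₃ := integral_add (hgi.comp_add_left x) (hgi.comp_sub_left x)
    simp_rw [hsum] at h₃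
    rw [h₁, h₂, integral_const_mul, integral_indicator (measurableSet_tangentRegion x)] at h₃
    rw [← integral_indicator hS]
    linarith
  have h_lim : Tendsto (fun ε : ℝ => ∫ z in tangentRegion x, {z | ε < ‖z‖}.indicator k z)
      (nhdsWithin 0 (Ioi 0)) (nhds (∫ z in tangentRegion x, k z)) := by
    refine tendsto_integral_filter_of_dominated_convergence k ?_ ?_ hki ?_
    · exact Eventually.of_forall fun ε =>
        (hkm.indicator (measurableSet_lt measurable_const measurable_norm)).aestronglyMeasurable
    · refine Eventually.of_forall fun ε => ae_of_all _ fun z => ?_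
      have hkz : 0 ≤ k z := by positivity
      by_cases hz : ε < ‖z‖ <;> simp [hz, hkz, abs_of_nonneg hkz]
    · refine ae_of_all _ fun z => ?_
      rcases eq_or_ne z 0 with rfl | hz
      · have hp : -((n : ℝ) + s) ≠ 0 := by
          have := hs.1
          exact neg_ne_zero.2 (by positivity)
        have h₀ : k 0 = 0 := by simp only [hk, norm_zero]; exact Real.zero_rpow hp
        simp [indicator, h₀]
      · refine tendsto_const_nhds.congr' ?_
        filter_upwards [nhdsWithin_le_nhds (Iio_mem_nhds (norm_pos_iff.2 hz))] with ε hε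
        exact (indicator_of_mem (show z ∈ {z | ε < ‖z‖} from hε) k).symm
  refine h_lim.congr' ?_
  filter_upwards [self_mem_nhdsWithin] with ε hε
  exact (h_eq ε hε).symm

theorem integrableOn_norm_sub_rpow {n : ℕ} {s δ : ℝ} (hs : 0 < s) (hδ : 0 < δ)
    (x : EuclideanSpace ℝ (Fin n)) {D : Set (EuclideanSpace ℝ (Fin n))}
    (hD : ∀ y ∈ D, δ ≤ dist y x) :
    IntegrableOn (fun y => ‖x - y‖ ^ (-((n : ℝ) + s))) D := by
  have h := (((integrableOn_norm_rpow_compl_ball n hs hδ).integrable_indicator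
    (measurableSet_le measurable_const measurable_norm)).comp_sub_left x)
  have hS : MeasurableSet {y : EuclideanSpace ℝ (Fin n) | δ ≤ dist y x} :=
    measurableSet_le measurable_const (by fun_prop)
  refine IntegrableOn.mono_set ?_ (show D ⊆ {y | δ ≤ dist y x} from hD)
  rw [← integrable_indicator_iff hS]
  refine h.congr (ae_of_all _ fun y => ?_)
  simp [indicator, dist_eq_norm, norm_sub_rev y x]

theorem setIntegral_eq_add_of_disjoint {n : ℕ} {s δ ε : ℝ} (hs : 0 < s)
    {x : EuclideanSpace ℝ (Fin n)} {E D : Set (EuclideanSpace ℝ (Fin n))}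
    (hE : MeasurableSet E) (hDm : MeasurableSet D) (hED : Disjoint E D)
    (hD : ∀ y ∈ D, δ ≤ dist y x) (hε : 0 < ε) (hεδ : ε < δ) :
    ∫ y in {y : EuclideanSpace ℝ (Fin n) | ε < dist y x},
        (Eᶜ.indicator (fun _ => (1 : ℝ)) y - E.indicator (fun _ => (1 : ℝ)) y)
          * ‖x - y‖ ^ (-((n : ℝ) + s))
      = (∫ y in {y : EuclideanSpace ℝ (Fin n) | ε < dist y x},
        ((E ∪ D)ᶜ.indicator (fun _ => (1 : ℝ)) y - (E ∪ D).indicator (fun _ => (1 : ℝ)) y)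
          * ‖x - y‖ ^ (-((n : ℝ) + s)))
        + 2 * ∫ y in D, ‖x - y‖ ^ (-((n : ℝ) + s)) := by
  set k : EuclideanSpace ℝ (Fin n) → ℝ := fun y => ‖x - y‖ ^ (-((n : ℝ) + s)) with hk
  have hkm : Measurable k := (measurable_const.sub measurable_id).norm.pow_const _
  have hki : IntegrableOn k {y | ε < dist y x} :=
    integrableOn_norm_sub_rpow hs hε x fun y hy => le_of_lt hy
  have hsub : D ⊆ {y | ε < dist y x} := fun y hy => hεδ.trans_le (hD y hy)
  have h₁ : ∫ y in D, k y = ∫ y in {y | ε < dist y x}, D.indicator k y := by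
    rw [setIntegral_indicator hDm, inter_eq_right.2 hsub]
  rw [h₁, ← integral_const_mul, ← integral_add]
  · refine integral_congr_ae (ae_of_all _ fun y => ?_)
    by_cases hyD : y ∈ D
    · have hyE : y ∉ E := fun h => hED.le_bot ⟨h, hyD⟩
      simp only [mem_compl_iff, mem_union, hyD, hyE, or_true, not_true_eq_false, not_false_eq_true,
        indicator_of_mem, indicator_of_notMem, hk]
      ring
    · by_cases hyE : y ∈ E <;> simp [hyD, hyE]
  · refine hki.mono' ?_ (ae_of_all _ fun y => ?_)
    · exact (((measurable_const.indicator (hE.union hDm).compl).sub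
        (measurable_const.indicator (hE.union hDm))).mul hkm).aestronglyMeasurable
    · exact norm_indicator_compl_sub_indicator_mul_le (E ∪ D) y (by positivity)
  · exact (hki.indicator hDm).const_mul 2

theorem HasFracMeanCurvAt.union {n : ℕ} {s δ H : ℝ} (hs : 0 < s)
    {x : EuclideanSpace ℝ (Fin n)} {E D : Set (EuclideanSpace ℝ (Fin n))}
    (h : HasFracMeanCurvAt n s E x H)
    (hE : MeasurableSet E) (hDm : MeasurableSet D) (hED : Disjoint E D)
    (hδ : 0 < δ) (hD : ∀ y ∈ D, δ ≤ dist y x) :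
    HasFracMeanCurvAt n s (E ∪ D) x (H - 2 * ∫ y in D, ‖x - y‖ ^ (-((n : ℝ) + s))) := by
  refine (Tendsto.sub_const h _).congr' ?_
  filter_upwards [self_mem_nhdsWithin, nhdsWithin_le_nhds (Iio_mem_nhds hδ)] with ε hε hεδ
  rw [setIntegral_eq_add_of_disjoint hs hE hDm hED hD hε hεδ, add_sub_cancel_right]

theorem HasFracMeanCurvAt.of_union {n : ℕ} {s δ H : ℝ} (hs : 0 < s)
    {x : EuclideanSpace ℝ (Fin n)} {E D : Set (EuclideanSpace ℝ (Fin n))}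
    (h : HasFracMeanCurvAt n s (E ∪ D) x H)
    (hE : MeasurableSet E) (hDm : MeasurableSet D) (hED : Disjoint E D)
    (hδ : 0 < δ) (hD : ∀ y ∈ D, δ ≤ dist y x) :
    HasFracMeanCurvAt n s E x (H + 2 * ∫ y in D, ‖x - y‖ ^ (-((n : ℝ) + s))) := by
  refine (Tendsto.add_const _ h).congr' ?_
  filter_upwards [self_mem_nhdsWithin, nhdsWithin_le_nhds (Iio_mem_nhds hδ)] with ε hε hεδ
  rw [setIntegral_eq_add_of_disjoint hs hE hDm hED hD hε hεδ]

theorem setIntegral_tangentRegion_map {n : ℕ} (s : ℝ) (x : EuclideanSpace ℝ (Fin n))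
    (U : EuclideanSpace ℝ (Fin n) ≃ₗᵢ[ℝ] EuclideanSpace ℝ (Fin n)) :
    ∫ z in tangentRegion (U x), ‖z‖ ^ (-((n : ℝ) + s))
      = ∫ z in tangentRegion x, ‖z‖ ^ (-((n : ℝ) + s)) := by
  rw [← U.measurePreserving.setIntegral_preimage_emb U.toHomeomorph.measurableEmbedding,
    preimage_tangentRegion]
  simp

theorem setIntegral_norm_sub_rpow_map {n : ℕ} (s : ℝ) (x : EuclideanSpace ℝ (Fin n))
    (U : EuclideanSpace ℝ (Fin n) ≃ₗᵢ[ℝ] EuclideanSpace ℝ (Fin n)) (a b : ℝ) :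
    ∫ y in ball 0 a \ ball 0 b, ‖U x - y‖ ^ (-((n : ℝ) + s))
      = ∫ y in ball 0 a \ ball 0 b, ‖x - y‖ ^ (-((n : ℝ) + s)) := by
  rw [← U.measurePreserving.setIntegral_preimage_emb U.toHomeomorph.measurableEmbedding]
  have h : U ⁻¹' (ball 0 a \ ball 0 b) = ball 0 a \ ball 0 b := by ext; simp
  rw [h]
  simp_rw [← map_sub, LinearIsometryEquiv.norm_map]

theorem smul_mem_tangentRegion_smul {n : ℕ} {x z : EuclideanSpace ℝ (Fin n)} {r : ℝ} (hr : 0 < r) :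
    r • z ∈ tangentRegion (r • x) ↔ z ∈ tangentRegion x := by
  simp only [tangentRegion, mem_ofPred_eq, inner_smul_left, inner_smul_right, norm_smul,
    Real.norm_of_nonneg hr.le, abs_mul, abs_of_pos hr, RCLike.conj_to_real, mul_pow]
  rw [show 2 * (r * (r * |inner ℝ x z|)) = r ^ 2 * (2 * |inner ℝ x z|) by ring,
    mul_le_mul_iff_right₀ (by positivity)]

theorem setIntegral_tangentRegion_smul {n : ℕ} {s r : ℝ} (hr : 0 < r)
    (x : EuclideanSpace ℝ (Fin n)) :
    ∫ z in tangentRegion (r • x), ‖z‖ ^ (-((n : ℝ) + s))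
      = r ^ (-s) * ∫ z in tangentRegion x, ‖z‖ ^ (-((n : ℝ) + s)) := by
  have h := Measure.integral_comp_smul (volume : Measure (EuclideanSpace ℝ (Fin n)))
    ((tangentRegion (r • x)).indicator fun z => ‖z‖ ^ (-((n : ℝ) + s))) r
  have h₁ : ∀ z, (tangentRegion (r • x)).indicator (fun z => ‖z‖ ^ (-((n : ℝ) + s))) (r • z)
      = r ^ (-((n : ℝ) + s)) *
        (tangentRegion x).indicator (fun z => ‖z‖ ^ (-((n : ℝ) + s))) z := by
    intro z
    by_cases hz : z ∈ tangentRegion x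
    · rw [indicator_of_mem hz, indicator_of_mem ((smul_mem_tangentRegion_smul hr).2 hz),
        norm_smul, Real.norm_of_nonneg hr.le, Real.mul_rpow hr.le (norm_nonneg _)]
    · rw [indicator_of_notMem hz, indicator_of_notMem (mt (smul_mem_tangentRegion_smul hr).1 hz),
        mul_zero]
  simp_rw [h₁] at h
  rw [integral_const_mul, integral_indicator (measurableSet_tangentRegion _),
    integral_indicator (measurableSet_tangentRegion _), finrank_euclideanSpace_fin, smul_eq_mul,
    abs_of_pos (by positivity)] at h
  have h₂ : r ^ (-s) = r ^ n * r ^ (-((n : ℝ) + s)) := by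
    rw [← Real.rpow_natCast, ← Real.rpow_add hr]
    congr 1
    ring
  rw [h₂, mul_assoc, h, mul_inv_cancel_left₀ (by positivity)]

theorem setIntegral_tangentRegion_pos {n : ℕ} {s : ℝ} (hs : s ∈ Ioo (0 : ℝ) 1)
    {x : EuclideanSpace ℝ (Fin n)} (hx : x ≠ 0) :
    0 < ∫ z in tangentRegion x, ‖z‖ ^ (-((n : ℝ) + s)) := by
  rw [setIntegral_pos_iff_support_of_nonneg_ae (ae_of_all _ fun z => by positivity)
    (integrableOn_tangentRegion hs hx)]
  have hr := norm_pos_iff.2 hx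
  have h₁ : IsOpen {z : EuclideanSpace ℝ (Fin n) | 2 * ‖x‖ < ‖z‖} :=
    isOpen_lt continuous_const continuous_norm
  refine (h₁.measure_pos volume ⟨(3 : ℝ) • x, ?_⟩).trans_le (measure_mono fun z hz => ?_)
  · simp only [mem_ofPred_eq, norm_smul]
    norm_num
    linarith
  · have hz' : 2 * ‖x‖ < ‖z‖ := hz
    have hz0 : 0 < ‖z‖ := by linarith
    refine ⟨(Real.rpow_pos_of_pos hz0 _).ne', ?_⟩
    have := abs_real_inner_le_norm x z
    simp only [tangentRegion, mem_ofPred_eq]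
    nlinarith

theorem setIntegral_norm_sub_rpow_le {n : ℕ} {s δ : ℝ} (hs : 0 < s) (hδ : 0 < δ)
    {x : EuclideanSpace ℝ (Fin n)} {D : Set (EuclideanSpace ℝ (Fin n))} (hD1 : D ⊆ ball 0 1)
    (hD : ∀ y ∈ D, δ ≤ dist y x) :
    ∫ y in D, ‖x - y‖ ^ (-((n : ℝ) + s))
      ≤ δ ^ (-((n : ℝ) + s)) * volume.real (ball (0 : EuclideanSpace ℝ (Fin n)) 1) := by
  have hfin : volume D < ⊤ := (measure_mono hD1).trans_lt measure_ball_lt_top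
  refine (Real.le_norm_self _).trans ((norm_setIntegral_le_of_norm_le_const hfin
    (C := δ ^ (-((n : ℝ) + s))) fun y hy => ?_).trans ?_)
  · rw [Real.norm_of_nonneg (by positivity)]
    refine Real.rpow_le_rpow_of_nonpos hδ ?_ (neg_nonpos.2 (by positivity))
    rw [← dist_eq_norm, dist_comm]
    exact hD y hy
  · exact mul_le_mul_of_nonneg_left (measureReal_mono hD1 measure_ball_lt_top.ne) (by positivity)

theorem le_dist_of_notMem_ball {n : ℕ} {a : ℝ} {x y : EuclideanSpace ℝ (Fin n)}
    (hy : y ∉ ball 0 a) : a - ‖x‖ ≤ dist y x := by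
  have h₁ : a ≤ ‖y‖ := by simpa using hy
  have h₂ := norm_sub_norm_le y x
  rw [dist_eq_norm]
  linarith

theorem le_dist_of_mem_ball {n : ℕ} {a : ℝ} {x y : EuclideanSpace ℝ (Fin n)}
    (hy : y ∈ ball 0 a) : ‖x‖ - a ≤ dist y x := by
  have h₁ : ‖y‖ < a := by simpa using hy
  have h₂ := norm_sub_norm_le x y
  rw [dist_comm, dist_eq_norm]
  linarith

theorem le_setIntegral_norm_sub_rpow {n : ℕ} {s r₁ δ : ℝ} (hs : 0 < s)
    {e : EuclideanSpace ℝ (Fin n)} (he : ‖e‖ = 1) (hδ : 0 < δ) (hδr : δ < r₁)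
    (hδ1 : r₁ + 2 * δ ≤ 1) :
    3 ^ (-((n : ℝ) + s)) * volume.real (ball (0 : EuclideanSpace ℝ (Fin n)) 1) * δ ^ (-s)
      ≤ ∫ y in ball 0 1 \ ball 0 r₁, ‖(r₁ - δ) • e - y‖ ^ (-((n : ℝ) + s)) := by
  set x := (r₁ - δ) • e with hx
  have hxn : ‖x‖ = r₁ - δ := by rw [hx, norm_smul, he, Real.norm_of_nonneg (by linarith), mul_one]
  have hxe : ‖(r₁ + δ) • e‖ = r₁ + δ := by
    rw [norm_smul, he, Real.norm_of_nonneg (by linarith), mul_one]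
  have hsub : ball ((r₁ + δ) • e) δ ⊆ ball 0 1 \ ball 0 r₁ := by
    intro y hy
    rw [mem_ball, dist_eq_norm] at hy
    have h₁ := norm_sub_norm_le y ((r₁ + δ) • e)
    have h₂ := norm_sub_norm_le ((r₁ + δ) • e) y
    rw [norm_sub_rev] at h₂
    simp only [Set.mem_sdiff, mem_ball_zero_iff, not_lt]
    constructor <;> linarith
  have hfar : ∀ y ∈ ball (0 : EuclideanSpace ℝ (Fin n)) 1 \ ball 0 r₁, δ ≤ dist y x := by
    intro y hy
    have := le_dist_of_notMem_ball (x := x) hy.2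
    linarith
  have hint := integrableOn_norm_sub_rpow hs hδ x hfar
  refine le_trans ?_ (setIntegral_mono_set hint (ae_of_all _ fun y => by positivity)
    hsub.eventuallyLE)
  have h₁ : ∫ y in ball ((r₁ + δ) • e) δ, (3 * δ) ^ (-((n : ℝ) + s))
      ≤ ∫ y in ball ((r₁ + δ) • e) δ, ‖x - y‖ ^ (-((n : ℝ) + s)) := by
    refine setIntegral_mono_on (integrableOn_const measure_ball_lt_top.ne) (hint.mono_set hsub)
      measurableSet_ball fun y hy => ?_
    have hy1 := hfar y (hsub hy)
    rw [dist_comm, dist_eq_norm] at hy1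
    refine Real.rpow_le_rpow_of_nonpos (by linarith) ?_ (neg_nonpos.2 (by positivity))
    rw [mem_ball] at hy
    have h₂ := dist_triangle y ((r₁ + δ) • e) x
    have h₃ : dist ((r₁ + δ) • e) x = 2 * δ := by
      rw [dist_eq_norm, hx, ← sub_smul, norm_smul, he, mul_one,
        show r₁ + δ - (r₁ - δ) = 2 * δ by ring, Real.norm_of_nonneg (by linarith)]
    rw [← dist_eq_norm, dist_comm]
    linarith
  refine le_trans (le_of_eq ?_) h₁
  have h₂ : δ ^ (-s) = δ ^ (-((n : ℝ) + s)) * δ ^ n := by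
    rw [← Real.rpow_natCast, ← Real.rpow_add hδ]
    congr 1
    ring
  rw [setIntegral_const, smul_eq_mul, measureReal_def, measureReal_def,
    Measure.addHaar_ball_of_pos _ _ hδ, finrank_euclideanSpace_fin, ENNReal.toReal_mul,
    ENNReal.toReal_ofReal (by positivity), Real.mul_rpow (by norm_num) hδ.le, h₂]
  ring

theorem continuousAt_setIntegral_norm_smul_sub_rpow {n : ℕ} {s r r₁ : ℝ} (hs : 0 < s)
    {e : EuclideanSpace ℝ (Fin n)} (he : ‖e‖ = 1) (hr : r ∈ Ioo 0 r₁) :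
    ContinuousAt
      (fun t : ℝ => ∫ y in ball 0 1 \ ball 0 r₁, ‖t • e - y‖ ^ (-((n : ℝ) + s))) r := by
  obtain ⟨b, hrb, hb⟩ := exists_between hr.2
  have hmem : ∀ᶠ t in nhds r, t ∈ Ioo 0 b := Ioo_mem_nhds hr.1 hrb
  have hDm : MeasurableSet (ball (0 : EuclideanSpace ℝ (Fin n)) 1 \ ball 0 r₁) :=
    measurableSet_ball.diff measurableSet_ball
  have hfar : ∀ t ∈ Ioo 0 b, ∀ y ∈ ball (0 : EuclideanSpace ℝ (Fin n)) 1 \ ball 0 r₁,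
      r₁ - b ≤ ‖t • e - y‖ := by
    intro t ht y hy
    have h := le_dist_of_notMem_ball (x := t • e) hy.2
    rw [norm_smul, he, Real.norm_of_nonneg ht.1.le, dist_comm, dist_eq_norm] at h
    linarith [ht.2]
  refine continuousAt_of_dominated (bound := fun _ => (r₁ - b) ^ (-((n : ℝ) + s))) ?_ ?_ ?_ ?_
  · exact Eventually.of_forall fun t =>
      ((measurable_const.sub measurable_id).norm.pow_const _).aestronglyMeasurable
  · filter_upwards [hmem] with t ht
    rw [ae_restrict_iff' hDm]
    refine ae_of_all _ fun y hy => ?_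
    rw [Real.norm_of_nonneg (by positivity)]
    exact Real.rpow_le_rpow_of_nonpos (by linarith) (hfar t ht y hy)
      (neg_nonpos.2 (by positivity))
  · exact integrableOn_const
      ((measure_mono sdiff_subset).trans_lt measure_ball_lt_top).ne
  · rw [ae_restrict_iff' hDm]
    refine ae_of_all _ fun y hy => ContinuousAt.rpow_const (by fun_prop) (Or.inl ?_)
    have := hfar r ⟨hr.1, hrb⟩ y hy
    linarith

theorem continuousAt_setIntegral_diff_ball {n : ℕ} {r r₁ : ℝ} (hr : r ≠ 0)
    {f : EuclideanSpace ℝ (Fin n) → ℝ} (hf : IntegrableOn f (ball 0 r₁)) :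
    ContinuousAt (fun t : ℝ => ∫ y in ball 0 r₁ \ ball 0 t, f y) r := by
  have h_eq : ∀ t, ∫ y in ball 0 r₁ \ ball 0 t, f y
      = ∫ y in ball 0 r₁, (ball 0 t)ᶜ.indicator f y := fun t => by
    rw [setIntegral_indicator measurableSet_ball.compl, sdiff_eq]
  simp_rw [h_eq]
  refine continuousAt_of_dominated (bound := fun y => ‖f y‖) ?_ ?_ hf.norm ?_
  · exact Eventually.of_forall fun t =>
      hf.aestronglyMeasurable.indicator measurableSet_ball.compl
  · exact Eventually.of_forall fun t => ae_of_all _ fun y => norm_indicator_le_norm_self _ _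
  · have hns : ∀ᵐ y : EuclideanSpace ℝ (Fin n), ‖y‖ ≠ r := by
      have h := Measure.addHaar_sphere_of_ne_zero volume (0 : EuclideanSpace ℝ (Fin n)) hr
      filter_upwards [measure_eq_zero_iff_ae_notMem.1 h] with y hy
      simpa using hy
    refine ae_restrict_of_ae ?_
    filter_upwards [hns] with y hy
    rcases lt_or_gt_of_ne hy with h | h
    · refine (continuousAt_const (y := (0 : ℝ))).congr ?_
      filter_upwards [Ioi_mem_nhds h] with t ht
      have : y ∈ ball 0 t := by simpa using ht
      simp [this]
    · refine (continuousAt_const (y := f y)).congr ?_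
      filter_upwards [Iio_mem_nhds h] with t ht
      have : y ∉ ball 0 t := by simpa using (mem_Iio.1 ht).le
      simp [this]

theorem exists_root_of_blowup {s r₁ δ₀ c K M M' : ℝ} {I J : ℝ → ℝ} (hs : 0 < s) (hr₁ : 0 < r₁)
    (hr₁1 : r₁ ≤ 1) (hδ₀ : 0 < δ₀) (hc : 0 < c) (hK : 0 < K)
    (hIc : ContinuousOn I (Ioo 0 r₁)) (hJc : ContinuousOn J (Ioo 0 r₁))
    (hJ0 : ∀ r, 0 ≤ J r) (hJM : ∀ r, J r ≤ M) (hIM : ∀ r ∈ Ioo 0 (r₁ / 2), I r ≤ M')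
    (hI : ∀ δ ∈ Ioo 0 δ₀, δ < r₁ → K * δ ^ (-s) ≤ I (r₁ - δ)) :
    ∃ r ∈ Ioo 0 r₁, r * (c + 2 * J r) - (r ^ (-s) * c - 2 * I r) = 0 := by
  have hcont : ContinuousOn (fun r => r * (c + 2 * J r) - (r ^ (-s) * c - 2 * I r))
      (Ioo 0 r₁) := by
    have hp : ContinuousOn (fun r : ℝ => r ^ (-s)) (Ioo 0 r₁) :=
      continuousOn_id.rpow_const fun r hr => Or.inl hr.1.ne'
    fun_prop
  have hblow := tendsto_rpow_neg_nhdsGT_zero (neg_lt_zero.2 hs)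
  have hsmall : ∀ {x : ℝ}, 0 < x → ∀ᶠ t in nhdsWithin (0 : ℝ) (Ioi 0), t < x := fun hx =>
    nhdsWithin_le_nhds (Iio_mem_nhds hx)
  have hpos : ∀ᶠ t in nhdsWithin (0 : ℝ) (Ioi 0), 0 < t := self_mem_nhdsWithin
  obtain ⟨a, haM, ha, ha0⟩ := ((hblow.eventually_gt_atTop ((c + 2 * M + 2 * M') / c)).and
    ((hsmall (half_pos hr₁)).and hpos)).exists
  have hFa : a * (c + 2 * J a) - (a ^ (-s) * c - 2 * I a) < 0 := by
    have h₃ := (div_lt_iff₀ hc).1 haM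
    have h₄ : a * (c + 2 * J a) ≤ 1 * (c + 2 * J a) :=
      mul_le_mul_of_nonneg_right (by linarith) (by linarith [hJ0 a])
    linarith [hJM a, hIM a ⟨ha0, ha⟩]
  obtain ⟨δ, hδM, hδ1, hδ2, hδ0⟩ := ((hblow.eventually_gt_atTop ((r₁ / 2) ^ (-s) * c / K)).and
    ((hsmall (half_pos hr₁)).and ((hsmall hδ₀).and hpos))).exists
  have hFb : 0 < (r₁ - δ) * (c + 2 * J (r₁ - δ)) - ((r₁ - δ) ^ (-s) * c - 2 * I (r₁ - δ)) := by
    have h₂ : (r₁ - δ) ^ (-s) * c ≤ (r₁ / 2) ^ (-s) * c :=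
      mul_le_mul_of_nonneg_right (Real.rpow_le_rpow_of_nonpos (half_pos hr₁) (by linarith)
        (by linarith)) hc.le
    have h₃ := (div_lt_iff₀' hK).1 hδM
    have h₄ : 0 ≤ (r₁ - δ) * (c + 2 * J (r₁ - δ)) :=
      mul_nonneg (by linarith) (by linarith [hJ0 (r₁ - δ)])
    have h₅ : 0 ≤ (r₁ / 2) ^ (-s) * c := by positivity
    linarith [hI δ ⟨hδ0, hδ2⟩ (by linarith)]
  exact isPreconnected_Ioo.intermediate_value (a := a) (b := r₁ - δ) ⟨ha0, by linarith⟩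
    ⟨by linarith, by linarith⟩ hcont ⟨hFa.le, hFb.le⟩

theorem exists_radius_balance {n : ℕ} {s r₁ : ℝ} (hs : s ∈ Ioo (0 : ℝ) 1)
    (hr₁ : r₁ ∈ Ioo (0 : ℝ) 1) {e : EuclideanSpace ℝ (Fin n)} (he : ‖e‖ = 1) :
    ∃ r ∈ Ioo 0 r₁,
      r * ((∫ z in tangentRegion e, ‖z‖ ^ (-((n : ℝ) + s)))
          + 2 * ∫ y in ball 0 r₁ \ ball 0 r, ‖e - y‖ ^ (-((n : ℝ) + s)))
        - ((∫ z in tangentRegion (r • e), ‖z‖ ^ (-((n : ℝ) + s)))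
          - 2 * ∫ y in ball 0 1 \ ball 0 r₁, ‖r • e - y‖ ^ (-((n : ℝ) + s))) = 0 := by
  obtain ⟨hr₁0, hr₁1⟩ := hr₁
  have he0 : e ≠ 0 := norm_ne_zero_iff.1 (by rw [he]; exact one_ne_zero)
  have hV : 0 < volume.real (ball (0 : EuclideanSpace ℝ (Fin n)) 1) :=
    ENNReal.toReal_pos (measure_ball_pos _ _ one_pos).ne' measure_ball_lt_top.ne
  have hnear : ∀ y ∈ ball (0 : EuclideanSpace ℝ (Fin n)) r₁, 1 - r₁ ≤ dist y e := fun y hy => by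
    have := le_dist_of_mem_ball (x := e) hy
    rwa [he] at this
  obtain ⟨r, hr, hroot⟩ := exists_root_of_blowup
    (I := fun r => ∫ y in ball 0 1 \ ball 0 r₁, ‖r • e - y‖ ^ (-((n : ℝ) + s)))
    (J := fun r => ∫ y in ball 0 r₁ \ ball 0 r, ‖e - y‖ ^ (-((n : ℝ) + s)))
    hs.1 hr₁0 hr₁1.le (half_pos (sub_pos.2 hr₁1)) (setIntegral_tangentRegion_pos hs he0)
    (mul_pos (Real.rpow_pos_of_pos three_pos (-((n : ℝ) + s))) hV)
    (fun r hr => (continuousAt_setIntegral_norm_smul_sub_rpow hs.1 he hr).continuousWithinAt)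
    (fun r hr => (continuousAt_setIntegral_diff_ball hr.1.ne'
      (integrableOn_norm_sub_rpow hs.1 (sub_pos.2 hr₁1) e hnear)).continuousWithinAt)
    (fun r => integral_nonneg fun y => by positivity)
    (fun r => setIntegral_norm_sub_rpow_le hs.1 (sub_pos.2 hr₁1)
      (sdiff_subset.trans (ball_subset_ball hr₁1.le)) fun y hy => hnear y hy.1)
    (fun r hr => setIntegral_norm_sub_rpow_le hs.1 (half_pos hr₁0) sdiff_subset fun y hy => by
      have := le_dist_of_notMem_ball (x := r • e) hy.2
      rw [norm_smul, he, Real.norm_of_nonneg hr.1.le] at this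
      linarith [hr.2])
    (fun δ hδ hδr => le_setIntegral_norm_sub_rpow hs.1 he hδ.1 hδr (by linarith [hδ.2]))
  refine ⟨r, hr, ?_⟩
  rw [setIntegral_tangentRegion_smul hr.1]
  exact hroot



theorem inner_ball_radius_exists (n : ℕ) (hn : 1 ≤ n) (s : ℝ)
    (hs : s ∈ Set.Ioo (0 : ℝ) 1) (r₁ : ℝ) (hr₁ : r₁ ∈ Set.Ioo (0 : ℝ) 1) :
    ∃ r₀ ∈ Set.Ioo (0 : ℝ) r₁,
      ∀ x₀ x₁ : EuclideanSpace ℝ (Fin n), ‖x₀‖ = r₀ → ‖x₁‖ = 1 →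
        ∃ H₀ H₁ : ℝ,
          HasFracMeanCurvAt n s
            (Metric.ball (0 : EuclideanSpace ℝ (Fin n)) r₀ ∪
              (Metric.ball 0 1 \ Metric.ball 0 r₁)) x₀ H₀ ∧
          HasFracMeanCurvAt n s
            (Metric.ball (0 : EuclideanSpace ℝ (Fin n)) r₀ ∪
              (Metric.ball 0 1 \ Metric.ball 0 r₁)) x₁ H₁ ∧
          r₀ * H₁ - H₀ = 0 := by
  set e : EuclideanSpace ℝ (Fin n) := EuclideanSpace.single ⟨0, hn⟩ 1
  have he : ‖e‖ = 1 := by simp [e]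
  obtain ⟨r, hr, hbal⟩ := exists_radius_balance hs hr₁ he
  refine ⟨r, hr, fun x₀ x₁ hx₀ hx₁ => ⟨_, _, ?_, ?_, hbal⟩⟩
  · obtain ⟨U, rfl⟩ : ∃ U : EuclideanSpace ℝ (Fin n) ≃ₗᵢ[ℝ] EuclideanSpace ℝ (Fin n),
        U (r • e) = x₀ := exists_linearIsometryEquiv_of_norm_eq
      (by rw [hx₀, norm_smul, he, Real.norm_of_nonneg hr.1.le, mul_one])
    have h := hasFracMeanCurvAt_ball hs (norm_pos_iff.1 (hx₀ ▸ hr.1))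
    rw [hx₀] at h
    rw [← setIntegral_norm_sub_rpow_map s _ U, ← setIntegral_tangentRegion_map s _ U]
    refine h.union hs.1 measurableSet_ball (measurableSet_ball.diff measurableSet_ball)
      (disjoint_sdiff_right.mono_left (ball_subset_ball hr.2.le)) (sub_pos.2 hr.2) fun y hy => ?_
    simpa only [hx₀] using le_dist_of_notMem_ball (x := U (r • e)) hy.2
  · obtain ⟨U, rfl⟩ : ∃ U : EuclideanSpace ℝ (Fin n) ≃ₗᵢ[ℝ] EuclideanSpace ℝ (Fin n),
        U e = x₁ := exists_linearIsometryEquiv_of_norm_eq (by rw [hx₁, he])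
    have h := hasFracMeanCurvAt_ball hs (norm_pos_iff.1 (hx₁ ▸ one_pos))
    rw [hx₁] at h
    rw [← setIntegral_norm_sub_rpow_map s _ U, ← setIntegral_tangentRegion_map s _ U]
    have hsub : ball (0 : EuclideanSpace ℝ (Fin n)) r ⊆ ball 0 r₁ := ball_subset_ball hr.2.le
    have hsub₁ : ball (0 : EuclideanSpace ℝ (Fin n)) r₁ ⊆ ball 0 1 := ball_subset_ball hr₁.2.le
    have hE : ball (0 : EuclideanSpace ℝ (Fin n)) 1
        = ball 0 r ∪ (ball 0 1 \ ball 0 r₁) ∪ (ball 0 r₁ \ ball 0 r) := by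
      ext y
      have := @hsub y
      have := @hsub₁ y
      simp only [mem_union, Set.mem_sdiff]
      tauto
    rw [hE] at h
    refine h.of_union hs.1
      (measurableSet_ball.union (measurableSet_ball.diff measurableSet_ball))
      (measurableSet_ball.diff measurableSet_ball) ?_ (sub_pos.2 hr₁.2) fun y hy => ?_
    · rw [disjoint_union_left]
      exact ⟨disjoint_sdiff_right, disjoint_sdiff_left.mono_right sdiff_subset⟩
    · simpa only [hx₁] using le_dist_of_mem_ball (x := U e) hy.1
end

section
/- Let n ≥ 2, s ∈ (0,1). On the open set {(r₁,r₂) : 0 < r₁ < r₂} define g₁(r₁,r₂) = H_s(x_{r₁}, B_{r₂} \ B_{r₁}) + r₁ and g₂(r₁,r₂) = −H_s(x_{r₂}, B_{r₂} \ B_{r₁}) + r₂, where x_{r_i} ∈ ∂B_{r_i}. Suppose (r̄₁, r̄₂) with 0 < r̄₁ < r̄₂ satisfies g₁(r̄₁,r̄₂) = g₂(r̄₁,r̄₂) = 0. Then g = (g₁,g₂) is differentiable at (r̄₁,r̄₂), its Jacobian matrix Dg(r̄₁,r̄₂) has the vector (r̄₁,r̄₂) as an eigenvector with eigenvalue s+1,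 and its second eigenvalue is real and strictly greater than s+1. In particular both eigenvalues of Dg(r̄₁,r̄₂) are positive, so the stationary point (r̄₁,r̄₂) of the rescaled flow ṙ = g(r) has Morse index 2 and the corresponding homothetic annular solution is dynamically unstable. -/
open MeasureTheory Filter Metric Set

theorem integral_eq_integral_Ioi_integral_sphere {E : Type*} [NormedAddCommGroup E]
    [NormedSpace ℝ E] [MeasurableSpace E] [BorelSpace E] [FiniteDimensional ℝ E] [Nontrivial E]
    (μ : Measure E) [μ.IsAddHaarMeasure] {f : E → ℝ} (hf : Integrable f μ) :
    ∫ x, f x ∂μ = ∫ r in Ioi (0 : ℝ), r ^ (Module.finrank ℝ E - 1) *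
      ∫ w : sphere (0 : E) 1, f (r • (w : E)) ∂μ.toSphere := by
  have hmp := μ.measurePreserving_homeomorphUnitSphereProd.symm
    (homeomorphUnitSphereProd E).toMeasurableEquiv
  have hcomap : ∫ x, f x ∂μ = ∫ x : ({(0 : E)}ᶜ : Set E), f x ∂(μ.comap (↑)) := by
    rw [integral_subtype_comap (measurableSet_singleton _).compl f,
      restrict_compl_singleton]
  have hint : Integrable (fun x : ({(0 : E)}ᶜ : Set E) => f x) (μ.comap (↑)) := by
    have := hf.integrableOn (s := ({(0 : E)}ᶜ : Set E))
    rwa [integrableOn_iff_comap_subtypeVal (measurableSet_singleton _).compl] at this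
  rw [hcomap, ← hmp.integral_comp
    (homeomorphUnitSphereProd E).symm.measurableEmbedding]
  rw [← hmp.integrable_comp_emb (homeomorphUnitSphereProd E).symm.measurableEmbedding] at hint
  have h2 := integral_prod_symm _ hint
  refine h2.trans ?_
  rw [Measure.volumeIoiPow]
  refine (integral_withDensity_eq_integral_smul
    (measurable_subtype_coe.pow_const _).real_toNNReal _).trans ?_
  rw [← integral_subtype_comap measurableSet_Ioi (fun r : ℝ => r ^ (Module.finrank ℝ E - 1) *
      ∫ w : sphere (0 : E) 1, f (r • (w : E)) ∂μ.toSphere)]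
  refine integral_congr_ae (Eventually.of_forall fun r => ?_)
  simp only [NNReal.smul_def]
  rw [Real.coe_toNNReal _ (pow_nonneg r.2.out.le _), smul_eq_mul]
  rfl

theorem integrableOn_norm_sub_rpow_neg {E : Type*} [NormedAddCommGroup E]
    [NormedSpace ℝ E] [MeasurableSpace E] [BorelSpace E] [FiniteDimensional ℝ E]
    (μ : Measure E) [μ.IsAddHaarMeasure] {a : ℝ} (ha : (Module.finrank ℝ E : ℝ) < a) (x : E)
    {ε : ℝ} (hε : 0 < ε) :
    IntegrableOn (fun y => ‖x - y‖ ^ (-a)) {y | ε < dist y x} μ := by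
  have ha0 : 0 ≤ a := (Nat.cast_nonneg _).trans ha.le
  have hmeas : MeasurableSet {y : E | ε < dist y x} :=
    measurableSet_lt measurable_const (by fun_prop)
  have h1 : Integrable (fun y => (1 + 1 / ε) ^ a * (1 + ‖x - y‖) ^ (-a)) μ :=
    ((integrable_one_add_norm ha).comp_sub_left x).const_mul _
  refine h1.integrableOn.mono' (Measurable.aestronglyMeasurable (by fun_prop)) ?_
  filter_upwards [ae_restrict_mem hmeas] with y hy
  have hy' : ε < ‖x - y‖ := by simpa [dist_eq_norm, norm_sub_rev] using hy
  have h0 : 0 < ‖x - y‖ := hε.trans hy'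
  rw [Real.norm_of_nonneg (by positivity), Real.rpow_neg h0.le, Real.rpow_neg (by positivity),
    ← div_eq_mul_inv, inv_eq_one_div, div_le_div_iff₀ (by positivity) (by positivity), one_mul,
    ← Real.mul_rpow (by positivity) h0.le]
  refine Real.rpow_le_rpow (by positivity) ?_ ha0
  have : 1 ≤ ‖x - y‖ / ε := (one_le_div hε).2 hy'.le
  calc 1 + ‖x - y‖ ≤ ‖x - y‖ / ε + ‖x - y‖ := by gcongr
    _ = _ := by ring

theorem HasFracMeanCurvAt.sub_eq {n : ℕ} {s : ℝ} (hs : 0 < s)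
    {E E' : Set (EuclideanSpace ℝ (Fin n))} {x : EuclideanSpace ℝ (Fin n)} {H H' δ : ℝ}
    (hE : MeasurableSet E) (hE' : MeasurableSet E') (hsub : E ⊆ E') (hδ : 0 < δ)
    (hdist : ∀ y ∈ E' \ E, δ ≤ dist y x)
    (h : HasFracMeanCurvAt n s E x H) (h' : HasFracMeanCurvAt n s E' x H') :
    H - H' = 2 * ∫ y in E' \ E, ‖x - y‖ ^ (-((n : ℝ) + s)) := by
  refine tendsto_nhds_unique (h.sub h') (tendsto_const_nhds.congr' ?_)
  filter_upwards [self_mem_nhdsWithin, nhdsWithin_le_nhds (Iio_mem_nhds hδ)] with ε hε hεδ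
  have hmeas : MeasurableSet {y : EuclideanSpace ℝ (Fin n) | ε < dist y x} :=
    measurableSet_lt measurable_const (by fun_prop)
  have hk := integrableOn_norm_sub_rpow_neg volume (a := (n : ℝ) + s) (by simpa using hs) x hε
  have hint : ∀ A : Set (EuclideanSpace ℝ (Fin n)), MeasurableSet A →
      IntegrableOn (fun y => (indicator Aᶜ (fun _ => (1 : ℝ)) y - indicator A (fun _ => (1 : ℝ)) y)
          * ‖x - y‖ ^ (-((n : ℝ) + s))) {y | ε < dist y x} := by
    intro A hA
    refine hk.bdd_mul (c := 1) ?_ (Eventually.of_forall fun y => ?_)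
    · exact ((measurable_const.indicator hA.compl).sub
        (measurable_const.indicator hA)).aestronglyMeasurable
    · by_cases hy : y ∈ A <;> simp [hy]
  rw [← integral_sub (hint E hE) (hint E' hE'), ← integral_const_mul,
    ← integral_indicator (hE'.diff hE), ← integral_indicator hmeas]
  refine integral_congr_ae (Eventually.of_forall fun y => ?_)
  by_cases hy : y ∈ E' \ E
  · have : ε < dist y x := lt_of_lt_of_le hεδ (hdist y hy)
    simp [indicator, hy.1, hy.2, this]
    ring
  · by_cases hyE : y ∈ E
    · simp [indicator, hyE, hsub hyE]
    · have : y ∉ E' := fun h => hy ⟨h, hyE⟩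
      simp [indicator, hyE, this]

open scoped Pointwise in
theorem HasFracMeanCurvAt.smul {n : ℕ} {s : ℝ} {E : Set (EuclideanSpace ℝ (Fin n))}
    {x : EuclideanSpace ℝ (Fin n)} {H c : ℝ} (hc : 0 < c) (h : HasFracMeanCurvAt n s E x H) :
    HasFracMeanCurvAt n s (c • E) (c • x) (c ^ (-s) * H) := by
  have hlim : Tendsto (fun ε : ℝ => ε / c) (nhdsWithin 0 (Ioi 0)) (nhdsWithin 0 (Ioi 0)) := by
    refine tendsto_nhdsWithin_iff.2 ⟨?_, ?_⟩
    · have : Tendsto (fun ε : ℝ => ε / c) (nhds 0) (nhds (0 / c)) :=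
        (continuous_id.div_const c).tendsto 0
      rw [zero_div] at this
      exact this.mono_left nhdsWithin_le_nhds
    · filter_upwards [self_mem_nhdsWithin] with ε hε using div_pos hε hc
  refine ((h.comp hlim).const_mul (c ^ (-s))).congr fun ε => ?_
  have hset : {y : EuclideanSpace ℝ (Fin n) | ε < dist y (c • x)} =
      c • {y : EuclideanSpace ℝ (Fin n) | ε / c < dist y x} := by
    ext y
    rw [mem_smul_set_iff_inv_smul_mem₀ hc.ne']
    have : dist y (c • x) = c * dist (c⁻¹ • y) x := by
      conv_lhs => rw [← smul_inv_smul₀ hc.ne' y]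
      rw [dist_smul₀, Real.norm_of_nonneg hc.le]
    simp only [mem_ofPred_eq, this]
    rw [div_lt_iff₀ hc, mul_comm]
  have hcv := Measure.setIntegral_comp_smul_of_pos volume
    (fun y => (indicator (c • E)ᶜ (fun _ => (1 : ℝ)) y - indicator (c • E) (fun _ => (1 : ℝ)) y)
          * ‖c • x - y‖ ^ (-((n : ℝ) + s))) {y | ε / c < dist y x} hc
  rw [← hset, finrank_euclideanSpace_fin, smul_eq_mul, eq_inv_mul_iff_mul_eq₀ (by positivity)]
    at hcv
  rw [← hcv, Function.comp_apply, ← integral_const_mul, ← integral_const_mul]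
  refine integral_congr_ae (Eventually.of_forall fun y => ?_)
  have hmem : c • y ∈ c • E ↔ y ∈ E := smul_mem_smul_set_iff₀ hc.ne' _ _
  have hpow : ‖c • x - c • y‖ ^ (-((n : ℝ) + s)) =
      c ^ (-((n : ℝ) + s)) * ‖x - y‖ ^ (-((n : ℝ) + s)) := by
    rw [← smul_sub, norm_smul, Real.norm_of_nonneg hc.le, Real.mul_rpow hc.le (norm_nonneg _)]
  have hcc : c ^ (-s) = c ^ n * c ^ (-((n : ℝ) + s)) := by
    rw [← Real.rpow_natCast, ← Real.rpow_add hc]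
    congr 1; ring
  dsimp only
  rw [hpow, hcc]
  by_cases hy : y ∈ E
  · simp only [indicator, mem_compl_iff, hmem, hy, not_true_eq_false, if_true, if_false]
    ring
  · simp only [indicator, mem_compl_iff, hmem, hy, not_false_eq_true, if_true, if_false]
    ring

/-- The derivative in `r` of `∫_{B_r} |e - y|^{-(n+s)} dy`. -/
noncomputable def shellDensity (n : ℕ) (s : ℝ) (e : EuclideanSpace ℝ (Fin n)) (r : ℝ) : ℝ :=
  r ^ (n - 1) * ∫ w : sphere (0 : EuclideanSpace ℝ (Fin n)) 1,
    ‖e - r • (w : EuclideanSpace ℝ (Fin n))‖ ^ (-((n : ℝ) + s)) ∂(volume : Measure _).toSphere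

theorem abs_norm_sub_le_norm_sub_smul {E : Type*} [NormedAddCommGroup E] [NormedSpace ℝ E] (e : E)
    {r : ℝ} (hr : 0 ≤ r) (w : sphere (0 : E) 1) : |‖e‖ - r| ≤ ‖e - r • (w : E)‖ := by
  have h := abs_norm_sub_norm_le e (r • (w : E))
  rwa [norm_smul, norm_eq_of_mem_sphere, mul_one, Real.norm_of_nonneg hr] at h

section

variable {n : ℕ} {s : ℝ} {e : EuclideanSpace ℝ (Fin n)}

theorem continuous_norm_sub_smul_rpow {r : ℝ} (hr : 0 ≤ r) (hre : r ≠ ‖e‖) (p : ℝ) :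
    Continuous fun w : sphere (0 : EuclideanSpace ℝ (Fin n)) 1 =>
      ‖e - r • (w : EuclideanSpace ℝ (Fin n))‖ ^ p := by
  refine Continuous.rpow_const (by fun_prop) fun w => Or.inl ?_
  exact ((abs_pos.2 (sub_ne_zero.2 hre.symm)).trans_le (abs_norm_sub_le_norm_sub_smul e hr w)).ne'

theorem continuousAt_shellDensity (hs : 0 < s) {r : ℝ} (hr : 0 < r) (hre : r ≠ ‖e‖) :
    ContinuousAt (shellDensity n s e) r := by
  refine (continuous_pow _).continuousAt.mul ?_
  have hpos : 0 < |‖e‖ - r| := abs_pos.2 (sub_ne_zero.2 hre.symm)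
  have hcont : ContinuousAt (fun q : ℝ => |‖e‖ - q|) r := by fun_prop
  refine continuousAt_of_dominated (bound := fun _ => (|‖e‖ - r| / 2) ^ (-((n : ℝ) + s)))
    ?_ ?_ (integrable_const _) ?_
  · filter_upwards [lt_mem_nhds hr, isOpen_ne.mem_nhds hre] with q hq hqe
    exact (continuous_norm_sub_smul_rpow hq.le hqe _).aestronglyMeasurable
  · filter_upwards [lt_mem_nhds hr, hcont.eventually (lt_mem_nhds (half_lt_self hpos))] with q hq hqe
    refine Eventually.of_forall fun w => ?_
    rw [Real.norm_of_nonneg (by positivity)]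
    exact Real.rpow_le_rpow_of_nonpos (by positivity)
      (hqe.le.trans (abs_norm_sub_le_norm_sub_smul e hq.le w)) (by
        have : (0 : ℝ) ≤ n := n.cast_nonneg
        linarith)
  · refine Eventually.of_forall fun w => ?_
    refine ContinuousAt.rpow_const (by fun_prop) (Or.inl ?_)
    exact (hpos.trans_le (abs_norm_sub_le_norm_sub_smul e hr.le w)).ne'

theorem shellDensity_pos (hn : n ≠ 0) {r : ℝ} (hr : 0 < r) (hre : r ≠ ‖e‖) :
    0 < shellDensity n s e r := by
  have : Nonempty (Fin n) := ⟨⟨0, Nat.pos_of_ne_zero hn⟩⟩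
  refine mul_pos (pow_pos hr _) ?_
  have hc := continuous_norm_sub_smul_rpow hr.le hre (-((n : ℝ) + s))
  have hpos (w : sphere (0 : EuclideanSpace ℝ (Fin n)) 1) :
      0 < ‖e - r • (w : EuclideanSpace ℝ (Fin n))‖ ^ (-((n : ℝ) + s)) :=
    Real.rpow_pos_of_pos ((abs_pos.2 (sub_ne_zero.2 hre.symm)).trans_le
      (abs_norm_sub_le_norm_sub_smul e hr.le w)) _
  have hint : Integrable (fun w : sphere (0 : EuclideanSpace ℝ (Fin n)) 1 =>
      ‖e - r • (w : EuclideanSpace ℝ (Fin n))‖ ^ (-((n : ℝ) + s)))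
      (volume : Measure (EuclideanSpace ℝ (Fin n))).toSphere :=
    hc.integrable_of_hasCompactSupport (HasCompactSupport.of_compactSpace _)
  rw [integral_pos_iff_support_of_nonneg (fun w => (hpos w).le) hint]
  have : Function.support (fun w : sphere (0 : EuclideanSpace ℝ (Fin n)) 1 =>
      ‖e - r • (w : EuclideanSpace ℝ (Fin n))‖ ^ (-((n : ℝ) + s))) = univ :=
    eq_univ_of_forall fun w => (hpos w).ne'
  rw [this]
  exact Measure.measure_univ_pos.2 (Measure.toSphere_ne_zero _)

theorem integral_shell_eq (hn : n ≠ 0) (hs : 0 < s) {a b δ : ℝ} (ha : 0 < a) (hab : a ≤ b)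
    (hδ : 0 < δ) (hdist : ∀ y ∈ ball (0 : EuclideanSpace ℝ (Fin n)) b \ ball 0 a, δ < dist y e) :
    ∫ y in ball (0 : EuclideanSpace ℝ (Fin n)) b \ ball 0 a, ‖e - y‖ ^ (-((n : ℝ) + s)) =
      ∫ r in a..b, shellDensity n s e r := by
  have : Nonempty (Fin n) := ⟨⟨0, Nat.pos_of_ne_zero hn⟩⟩
  have hm : MeasurableSet (ball (0 : EuclideanSpace ℝ (Fin n)) b \ ball 0 a) :=
    measurableSet_ball.diff measurableSet_ball
  have hint : Integrable ((ball (0 : EuclideanSpace ℝ (Fin n)) b \ ball 0 a).indicator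
      fun y => ‖e - y‖ ^ (-((n : ℝ) + s))) :=
    (integrable_indicator_iff hm).2 ((integrableOn_norm_sub_rpow_neg volume (a := (n : ℝ) + s)
      (by simpa using hs) e hδ).mono_set hdist)
  rw [← integral_indicator hm, integral_eq_integral_Ioi_integral_sphere _ hint,
    intervalIntegral.integral_of_le hab, ← integral_Ico_eq_integral_Ioc,
    ← integral_indicator measurableSet_Ioi, ← integral_indicator measurableSet_Ico]
  refine integral_congr_ae (Eventually.of_forall fun r => ?_)
  have hmem (h0 : 0 < r) (w : sphere (0 : EuclideanSpace ℝ (Fin n)) 1) :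
      r • (w : EuclideanSpace ℝ (Fin n)) ∈ ball (0 : EuclideanSpace ℝ (Fin n)) b \ ball 0 a ↔
        r ∈ Ico a b := by
    simp [norm_smul, abs_of_pos h0, and_comm]
  by_cases h0 : 0 < r
  · by_cases hr : r ∈ Ico a b
    · simp [indicator, h0, hmem h0, hr, shellDensity, -mem_Ico]
    · simp [indicator, h0, hmem h0, hr, -mem_Ico]
  · have hr : r ∉ Ico a b := fun h => h0 (ha.trans_le h.1)
    simp [indicator, h0, hr, -mem_Ico]

end

theorem hasDerivAt_of_sub_eq_const_mul_integral {f D : ℝ → ℝ} {U : Set ℝ} {c t : ℝ}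
    (hU : IsOpen U) (ht : t ∈ U) (hD : ContinuousOn D U)
    (hf : ∀ a ∈ U, ∀ b ∈ U, a ≤ b → f b - f a = c * ∫ r in a..b, D r) :
    HasDerivAt f (c * D t) t := by
  have h := ((intervalIntegral.integral_hasDerivAt_right (IntervalIntegrable.refl (a := t))
    (hD.stronglyMeasurableAtFilter hU t ht) (hD.continuousAt (hU.mem_nhds ht))).const_mul c).const_add
      (f t)
  refine h.congr_of_eventuallyEq ?_
  filter_upwards [hU.mem_nhds ht] with u hu
  rcases le_total t u with htu | hut
  · rw [← hf t ht u hu htu]; ring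
  · have := hf u hu t ht hut
    rw [intervalIntegral.integral_symm]
    linarith

theorem hasFDerivAt_rpow_mul_comp_div {E : Type*} [NormedAddCommGroup E] [NormedSpace ℝ E]
    (X Y : E →L[ℝ] ℝ) {p : E} (hX : 0 < X p) {u : ℝ → ℝ} {u' s : ℝ}
    (hu : HasDerivAt u u' (Y p / X p)) :
    HasFDerivAt (fun q => X q ^ (-s) * u (Y q / X q))
      ((X p ^ (-s) * u' / X p) • Y
        - (s * (X p ^ (-s) * u (Y p / X p)) / X p + X p ^ (-s) * u' / X p * (Y p / X p)) • X) p := by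
  have h1 := (X.hasFDerivAt (x := p)).rpow_const (p := -s) (Or.inl hX.ne')
  have hY := Y.hasFDerivAt (x := p)
  have hinv := (hasDerivAt_inv hX.ne').comp_hasFDerivAt p (X.hasFDerivAt (x := p))
  have h2 := hu.comp_hasFDerivAt p (f := fun q => Y q / X q) (hY.fun_mul hinv)
  refine (h1.fun_mul h2).congr_fderiv ?_
  ext v
  have : X p ^ (-s - 1) = X p ^ (-s) / X p := Real.rpow_sub_one hX.ne' _
  simp [this]
  field_simp
  ring

theorem HasFracMeanCurvAt.unique {n : ℕ} {s : ℝ} {E : Set (EuclideanSpace ℝ (Fin n))}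
    {x : EuclideanSpace ℝ (Fin n)} {H H' : ℝ} (h : HasFracMeanCurvAt n s E x H)
    (h' : HasFracMeanCurvAt n s E x H') : H = H' :=
  tendsto_nhds_unique h h'

open scoped Pointwise in
theorem smul_ball_diff_ball {E : Type*} [NormedAddCommGroup E] [NormedSpace ℝ E] {c : ℝ}
    (hc : 0 < c) (a b : ℝ) :
    c • (ball (0 : E) b \ ball 0 a) = ball 0 (c * b) \ ball 0 (c * a) := by
  rw [smul_set_sdiff₀ hc.ne', _root_.smul_ball hc.ne', _root_.smul_ball hc.ne', smul_zero,
    Real.norm_of_nonneg hc.le]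

section

variable {n : ℕ} {s : ℝ} {H : ℝ → ℝ → ℝ} {e : EuclideanSpace ℝ (Fin n)}

theorem hasDerivAt_innerCurvature (hn : n ≠ 0) (hs : 0 < s) (he : ‖e‖ = 1)
    (hH : ∀ r₁ r₂ : ℝ, 0 < r₁ → r₁ < r₂ → ∀ x : EuclideanSpace ℝ (Fin n), ‖x‖ = r₁ →
      HasFracMeanCurvAt n s (ball 0 r₂ \ ball 0 r₁) x (H r₁ r₂)) {t : ℝ} (ht : 1 < t) :
    HasDerivAt (H 1) (-2 * shellDensity n s e t) t := by
  refine hasDerivAt_of_sub_eq_const_mul_integral isOpen_Ioi ht (fun r hr => ?_) ?_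
  · exact (continuousAt_shellDensity hs (one_pos.trans hr) (he ▸ ne_of_gt hr)).continuousWithinAt
  · intro a ha b hb hab
    have hset : (ball (0 : EuclideanSpace ℝ (Fin n)) b \ ball 0 1) \ (ball 0 a \ ball 0 1) =
        ball 0 b \ ball 0 a := by
      ext y
      have : ‖y‖ < 1 → ‖y‖ < a := fun h => h.trans ha
      simp only [Set.mem_sdiff, mem_ball_zero_iff]
      tauto
    have hdist : ∀ y ∈ ball (0 : EuclideanSpace ℝ (Fin n)) b \ ball 0 a,
        a - 1 ≤ dist y e := fun y hy => by
      have h1 : a ≤ ‖y‖ := by simpa using hy.2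
      have h2 := norm_sub_norm_le y e
      rw [dist_eq_norm]
      linarith
    have ha' : (0 : ℝ) < a - 1 := sub_pos.2 ha
    have h := (hH 1 a one_pos ha e he).sub_eq hs (measurableSet_ball.diff measurableSet_ball)
      (measurableSet_ball.diff measurableSet_ball) (sdiff_subset_sdiff_left (ball_subset_ball hab))
      ha' (by rwa [hset]) (hH 1 b one_pos hb e he)
    rw [hset, integral_shell_eq hn hs (one_pos.trans ha) hab (half_pos ha')
      fun y hy => (half_lt_self ha').trans_le (hdist y hy)] at h
    linarith

theorem hasDerivAt_outerCurvature (hn : n ≠ 0) (hs : 0 < s) (he : ‖e‖ = 1)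
    (hH : ∀ r₁ r₂ : ℝ, 0 < r₁ → r₁ < r₂ → ∀ x : EuclideanSpace ℝ (Fin n), ‖x‖ = r₂ →
      HasFracMeanCurvAt n s (ball 0 r₂ \ ball 0 r₁) x (H r₁ r₂)) {t : ℝ} (ht0 : 0 < t)
    (ht : t < 1) :
    HasDerivAt (fun r => H r 1) (2 * shellDensity n s e t) t := by
  refine hasDerivAt_of_sub_eq_const_mul_integral isOpen_Ioo (mem_Ioo.2 ⟨ht0, ht⟩)
    (fun r hr => ?_) ?_
  · exact (continuousAt_shellDensity hs hr.1 (he ▸ ne_of_lt hr.2)).continuousWithinAt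
  · intro a ha b hb hab
    have hset : (ball (0 : EuclideanSpace ℝ (Fin n)) 1 \ ball 0 a) \ (ball 0 1 \ ball 0 b) =
        ball 0 b \ ball 0 a := by
      ext y
      have : ‖y‖ < b → ‖y‖ < 1 := fun h => h.trans hb.2
      simp only [Set.mem_sdiff, mem_ball_zero_iff]
      tauto
    have hdist : ∀ y ∈ ball (0 : EuclideanSpace ℝ (Fin n)) b \ ball 0 a,
        1 - b ≤ dist y e := fun y hy => by
      have h1 : ‖y‖ < b := by simpa using hy.1
      have h2 := norm_sub_norm_le e y
      rw [dist_eq_norm']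
      linarith
    have hb' : (0 : ℝ) < 1 - b := sub_pos.2 hb.2
    have h := (hH b 1 hb.1 hb.2 e he).sub_eq hs (measurableSet_ball.diff measurableSet_ball)
      (measurableSet_ball.diff measurableSet_ball)
      (sdiff_subset_sdiff_right (ball_subset_ball hab))
      hb' (by rwa [hset]) (hH a 1 ha.1 ha.2 e he)
    rw [hset, integral_shell_eq hn hs ha.1 hab (half_pos hb')
      fun y hy => (half_lt_self hb').trans_le (hdist y hy)] at h
    linarith

theorem innerCurvature_eq_rpow_mul (he : ‖e‖ = 1)
    (hH : ∀ r₁ r₂ : ℝ, 0 < r₁ → r₁ < r₂ → ∀ x : EuclideanSpace ℝ (Fin n), ‖x‖ = r₁ →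
      HasFracMeanCurvAt n s (ball 0 r₂ \ ball 0 r₁) x (H r₁ r₂)) {r₁ r₂ : ℝ} (h₁ : 0 < r₁)
    (h₂ : r₁ < r₂) : H r₁ r₂ = r₁ ^ (-s) * H 1 (r₂ / r₁) := by
  have h := (hH 1 (r₂ / r₁) one_pos ((one_lt_div h₁).2 h₂) e he).smul h₁
  rw [smul_ball_diff_ball h₁, mul_one, mul_div_cancel₀ _ h₁.ne'] at h
  exact (hH r₁ r₂ h₁ h₂ (r₁ • e) (by rw [norm_smul, he, mul_one, Real.norm_of_nonneg h₁.le])).unique h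

theorem outerCurvature_eq_rpow_mul (he : ‖e‖ = 1)
    (hH : ∀ r₁ r₂ : ℝ, 0 < r₁ → r₁ < r₂ → ∀ x : EuclideanSpace ℝ (Fin n), ‖x‖ = r₂ →
      HasFracMeanCurvAt n s (ball 0 r₂ \ ball 0 r₁) x (H r₁ r₂)) {r₁ r₂ : ℝ} (h₁ : 0 < r₁)
    (h₂ : r₁ < r₂) : H r₁ r₂ = r₂ ^ (-s) * H (r₁ / r₂) 1 := by
  have h0 := h₁.trans h₂
  have h := (hH (r₁ / r₂) 1 (div_pos h₁ h0) ((div_lt_one h0).2 h₂) e he).smul h0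
  rw [smul_ball_diff_ball h0, mul_one, mul_div_cancel₀ _ h0.ne'] at h
  exact (hH r₁ r₂ h₁ h₂ (r₂ • e) (by rw [norm_smul, he, mul_one, Real.norm_of_nonneg h0.le])).unique h

end

theorem annulus_shrinker_unstable (n : ℕ) (hn : 2 ≤ n) (s : ℝ)
    (hs : s ∈ Set.Ioo (0 : ℝ) 1)
    (Hin Hout : ℝ → ℝ → ℝ)
    (hHin : ∀ r₁ r₂ : ℝ, 0 < r₁ → r₁ < r₂ →
      ∀ x : EuclideanSpace ℝ (Fin n), ‖x‖ = r₁ →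
        HasFracMeanCurvAt n s (Metric.ball 0 r₂ \ Metric.ball 0 r₁) x (Hin r₁ r₂))
    (hHout : ∀ r₁ r₂ : ℝ, 0 < r₁ → r₁ < r₂ →
      ∀ x : EuclideanSpace ℝ (Fin n), ‖x‖ = r₂ →
        HasFracMeanCurvAt n s (Metric.ball 0 r₂ \ Metric.ball 0 r₁) x (Hout r₁ r₂))
    (g : ℝ × ℝ → ℝ × ℝ)
    (hg : ∀ p : ℝ × ℝ, 0 < p.1 → p.1 < p.2 →
      g p = (Hin p.1 p.2 + p.1, -(Hout p.1 p.2) + p.2))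
    (pbar : ℝ × ℝ) (hp1 : 0 < pbar.1) (hp2 : pbar.1 < pbar.2) (hcrit : g pbar = 0) :
    DifferentiableAt ℝ g pbar ∧
    fderiv ℝ g pbar pbar = (s + 1) • pbar ∧
    ∃ lam : ℝ, s + 1 < lam ∧
      ∃ v : ℝ × ℝ, v ≠ 0 ∧ (∀ t : ℝ, v ≠ t • pbar) ∧ fderiv ℝ g pbar v = lam • v := by
  have hs0 : 0 < s := hs.1
  have hn0 : n ≠ 0 := by omega
  have : Nonempty (Fin n) := ⟨⟨0, by omega⟩⟩
  obtain ⟨e, he⟩ : ∃ e : EuclideanSpace ℝ (Fin n), ‖e‖ = 1 := exists_norm_eq _ zero_le_one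
  obtain ⟨p₁, p₂⟩ := pbar
  dsimp only at hp1 hp2
  have hp0 : 0 < p₂ := hp1.trans hp2
  have ht : 1 < p₂ / p₁ := (one_lt_div hp1).2 hp2
  have ht' : p₁ / p₂ < 1 := (div_lt_one hp0).2 hp2
  have ht0 : 0 < p₁ / p₂ := div_pos hp1 hp0
  have hu := hasDerivAt_innerCurvature hn0 hs0 he hHin ht
  have hw := hasDerivAt_outerCurvature hn0 hs0 he hHout ht0 ht'
  have hu' : -2 * shellDensity n s e (p₂ / p₁) < 0 := by
    have := shellDensity_pos (s := s) (e := e) hn0 (one_pos.trans ht) (he ▸ ht.ne')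
    linarith
  have hw' : 0 < 2 * shellDensity n s e (p₁ / p₂) := by
    have := shellDensity_pos (s := s) (e := e) hn0 ht0 (he ▸ ht'.ne)
    linarith
  set u' := -2 * shellDensity n s e (p₂ / p₁)
  set w' := 2 * shellDensity n s e (p₁ / p₂)
  have hcrit' := (hg (p₁, p₂) hp1 hp2).symm.trans hcrit
  have hc1 : p₁ ^ (-s) * Hin 1 (p₂ / p₁) = -p₁ := by
    rw [← innerCurvature_eq_rpow_mul he hHin hp1 hp2]
    have := congrArg Prod.fst hcrit'
    simp only [Prod.fst_zero] at this
    linarith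
  have hc2 : p₂ ^ (-s) * Hout (p₁ / p₂) 1 = p₂ := by
    rw [← outerCurvature_eq_rpow_mul he hHout hp1 hp2]
    have := congrArg Prod.snd hcrit'
    simp only [Prod.snd_zero] at this
    linarith
  have hA := hasFDerivAt_rpow_mul_comp_div (s := s) (p := (p₁, p₂))
    (ContinuousLinearMap.fst ℝ ℝ ℝ) (ContinuousLinearMap.snd ℝ ℝ ℝ) hp1 hu
  have hB := hasFDerivAt_rpow_mul_comp_div (s := s) (p := (p₁, p₂))
    (ContinuousLinearMap.snd ℝ ℝ ℝ) (ContinuousLinearMap.fst ℝ ℝ ℝ) hp0 hw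
  have hL := (hA.fun_add (ContinuousLinearMap.fst ℝ ℝ ℝ).hasFDerivAt).prodMk
    (hB.fun_neg.fun_add (ContinuousLinearMap.snd ℝ ℝ ℝ).hasFDerivAt)
  simp only [ContinuousLinearMap.coe_fst', ContinuousLinearMap.coe_snd', hc1, hc2] at hL
  have hgL := hL.congr_of_eventuallyEq (f₁ := g) (by
    have ho : IsOpen {p : ℝ × ℝ | 0 < p.1 ∧ p.1 < p.2} :=
      (isOpen_lt continuous_const continuous_fst).inter (isOpen_lt continuous_fst continuous_snd)
    filter_upwards [ho.mem_nhds (show (p₁, p₂) ∈ _ from ⟨hp1, hp2⟩)] with p hp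
    rw [hg p hp.1 hp.2, innerCurvature_eq_rpow_mul he hHin hp.1 hp.2,
      outerCurvature_eq_rpow_mul he hHout hp.1 hp.2])
  have hb : p₁ ^ (-s) * u' / p₁ < 0 :=
    div_neg_of_neg_of_pos (mul_neg_of_pos_of_neg (Real.rpow_pos_of_pos hp1 _) hu') hp1
  have hd : 0 < p₂ ^ (-s) * w' / p₂ :=
    div_pos (mul_pos (Real.rpow_pos_of_pos hp0 _) hw') hp0
  set b := p₁ ^ (-s) * u' / p₁
  set d := p₂ ^ (-s) * w' / p₂
  refine ⟨hgL.differentiableAt, ?_, s + 1 - b * (p₂ / p₁) + d * (p₁ / p₂), ?_,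
    (b, d * (p₁ / p₂)), ?_, ?_, ?_⟩
  · rw [hgL.fderiv]
    ext <;> simp <;> field_simp <;> ring
  · have h1 := mul_neg_of_neg_of_pos hb (one_pos.trans ht)
    have h2 := mul_pos hd ht0
    linarith
  · exact fun h => hb.ne (congrArg Prod.fst h)
  · intro t h
    have h1 : b = t * p₁ := congrArg Prod.fst h
    have h2 : d * (p₁ / p₂) = t * p₂ := congrArg Prod.snd h
    have h3 := mul_pos hd ht0
    rw [h2] at h3
    have ht_pos : 0 < t := pos_of_mul_pos_left h3 hp0.le
    linarith [mul_pos ht_pos hp1]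
  · rw [hgL.fderiv]
    ext <;> simp <;> field_simp <;> ring
end
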